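/- Let n ≥ 3 and let Q be a real quadratic form on ℝⁿ. Assume Q is nondegenerate (its associated symmetric bilinear form is nondegenerate), Q is indefinite (there exist vectors v, w ∈ ℝⁿ with Q(v) > 0 and Q(w) < 0), and Q is not a real scalar multiple of a quadratic form with integer coefficients. Then the set Q(ℤⁿ) = {Q(m) : m ∈ ℤⁿ} is dense in ℝ. -/

import Mathlib

set_option linter.all false
noncomputable section
namespace Opp
open Matrix Set Filter Topology

abbrev M3 := Matrix (Fin 3) (Fin 3) ℝ
abbrev G := Matrix.SpecialLinearGroup (Fin 3) ℝ
abbrev Ga := Matrix.SpecialLinearGroup (Fin 3) ℤ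

def _root_.Matrix.SpecialLinearGroup.mt {R : Type*} [CommRing R]
    (g : Matrix.SpecialLinearGroup (Fin 3) R) : Matrix (Fin 3) (Fin 3) R := g.1
lemma val_mul {R : Type*} [CommRing R] (g h : Matrix.SpecialLinearGroup (Fin 3) R) :
    (g * h).mt = g.mt * h.mt := rfl
lemma val_one {R : Type*} [CommRing R] : (1 : Matrix.SpecialLinearGroup (Fin 3) R).mt = 1 := rfl
lemma val_T {R : Type*} [CommRing R] (g : Matrix.SpecialLinearGroup (Fin 3) R) :
    (g.transpose).mt = g.mtᵀ := rfl
lemma val_inj {R : Type*} [CommRing R] {g h : Matrix.SpecialLinearGroup (Fin 3) R}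
    (e : g.mt = h.mt) : g = h := Subtype.ext e
lemma det_mt {R : Type*} [CommRing R] (g : Matrix.SpecialLinearGroup (Fin 3) R) :
    g.mt.det = 1 := g.2

def io : Ga →* G := Matrix.SpecialLinearGroup.map (Int.castRingHom ℝ)

lemma io_apply (γ : Ga) (i j : Fin 3) : (io γ).mt i j = (γ.mt i j : ℝ) := by
  simp [io, Matrix.SpecialLinearGroup.mt]

def J : M3 := !![0,0,1;0,-1,0;1,0,0]
def E33 : M3 := !![0,0,0;0,0,0;0,0,1]
def JG : G := ⟨J, by simp [J, Matrix.det_fin_three]⟩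
def JZ : Ga := ⟨!![0,0,1;0,-1,0;1,0,0], by simp [Matrix.det_fin_three]⟩

def u (t : ℝ) : G := ⟨!![1,t,t^2/2;0,1,t;0,0,1], by simp [Matrix.det_fin_three]⟩
def v (s : ℝ) : G := ⟨!![1,0,s;0,1,0;0,0,1], by simp [Matrix.det_fin_three]⟩

lemma ext3 {R : Type*} {A B : Matrix (Fin 3) (Fin 3) R} (h00 : A 0 0 = B 0 0) (h01 : A 0 1 = B 0 1) (h02 : A 0 2 = B 0 2)
    (h10 : A 1 0 = B 1 0) (h11 : A 1 1 = B 1 1) (h12 : A 1 2 = B 1 2)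
    (h20 : A 2 0 = B 2 0) (h21 : A 2 1 = B 2 1) (h22 : A 2 2 = B 2 2) : A = B := by
  ext i j
  fin_cases i <;> fin_cases j <;> assumption

lemma val_u (t : ℝ) : (u t).mt = !![1,t,t^2/2;0,1,t;0,0,1] := rfl
lemma val_v (t : ℝ) : (v t).mt = !![1,0,t;0,1,0;0,0,1] := rfl
lemma val_JZ : (JZ).mt = !![0,0,1;0,-1,0;1,0,0] := rfl
lemma val_JG : (JG).mt = J := rfl
lemma mul3 {R : Type*} [CommRing R] (A B : Matrix (Fin 3) (Fin 3) R) (i j : Fin 3) :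
    (A * B) i j = A i 0 * B 0 j + A i 1 * B 1 j + A i 2 * B 2 j := by
  rw [Matrix.mul_apply, Fin.sum_univ_three]

lemma u_add (s t : ℝ) : u (s+t) = u s * u t := by
  apply val_inj
  apply ext3 <;> simp [val_mul, val_u, mul3] <;> try ring

lemma u_zero : u 0 = 1 := by
  apply val_inj
  apply ext3 <;> simp [val_u, val_one]

lemma u_neg (t : ℝ) : u (-t) = (u t)⁻¹ := by
  rw [eq_inv_iff_mul_eq_one, ← u_add]; simp [u_zero]

lemma u_natmul (t : ℝ) (k : ℕ) : u (k * t) = (u t)^k := by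
  induction k with
  | zero => simp [u_zero]
  | succ k ih => rw [pow_succ, ← ih, ← u_add]; congr 1; push_cast; ring

lemma continuous_u : Continuous u := by
  refine continuous_induced_rng.mpr ?_
  refine continuous_matrix fun i j => ?_
  fin_cases i <;> fin_cases j <;> simp [u] <;> fun_prop

def cg (C : M3) (g : G) : M3 := g.mtᵀ * C * g.mt

lemma cg_mul (C : M3) (g h : G) : cg C (g*h) = cg (cg C g) h := by
  simp [cg, val_mul, Matrix.transpose_mul, Matrix.mul_assoc]
lemma cg_one (C : M3) : cg C 1 = C := by simp [cg, val_one]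
lemma cg_add (C D : M3) (g : G) : cg (C+D) g = cg C g + cg D g := by
  simp [cg, Matrix.mul_add, Matrix.add_mul]
lemma cg_sub (C D : M3) (g : G) : cg (C-D) g = cg C g - cg D g := by
  simp [cg, Matrix.mul_sub, Matrix.sub_mul]
lemma cg_smul (a : ℝ) (C : M3) (g : G) : cg (a•C) g = a • cg C g := by
  simp [cg]
lemma cg_zero (g : G) : cg 0 g = 0 := by simp [cg]
lemma det_cg (C : M3) (g : G) : (cg C g).det = C.det := by
  simp only [cg, Matrix.det_mul, Matrix.det_transpose, det_mt]; ring
lemma cg_inv (C : M3) (g : G) : cg (cg C g) g⁻¹ = C := by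
  rw [← cg_mul]; simp [cg_one]
lemma cg_inv' (C : M3) (g : G) : cg (cg C g⁻¹) g = C := by
  rw [← cg_mul]; simp [cg_one]
lemma cg_symm {C : M3} (h : Cᵀ = C) (g : G) : (cg C g)ᵀ = cg C g := by
  simp [cg, Matrix.transpose_mul, h, Matrix.mul_assoc]
lemma cg_inj {C D : M3} (g : G) (h : cg C g = cg D g) : C = D := by
  rw [← cg_inv C g, h, cg_inv]

lemma continuous_val : Continuous (fun g : G => g.mt) := continuous_subtype_val

lemma continuous_cg : Continuous (fun p : M3 × G => cg p.1 p.2) := by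
  unfold cg
  have h2 : Continuous (fun p : M3 × G => p.2.mt) := continuous_val.comp continuous_snd
  exact ((h2.matrix_transpose).matrix_mul continuous_fst).matrix_mul h2

lemma tendsto_cg {α : Type*} {l : Filter α} {f : α → M3} {g : α → G} {a : M3} {b : G}
    (hf : Tendsto f l (𝓝 a)) (hg : Tendsto g l (𝓝 b)) :
    Tendsto (fun x => cg (f x) (g x)) l (𝓝 (cg a b)) :=
  ((continuous_cg.tendsto (a,b)).comp (hf.prodMk_nhds hg) :)

def F (g : G) : M3 := cg J g
def E (g : G) : M3 := cg E33 g

lemma F_mul (g h : G) : F (g*h) = cg (F g) h := cg_mul _ _ _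
lemma E_mul (g h : G) : E (g*h) = cg (E g) h := cg_mul _ _ _
lemma cg_J_u (t : ℝ) : cg J (u t) = J := by
  apply ext3 <;> simp [cg, J, val_u, mul3] <;> try ring
lemma cg_E_u (t : ℝ) : cg E33 (u t) = E33 := by
  apply ext3 <;> simp [cg, E33, val_u, mul3]
lemma cg_J_v (t : ℝ) : cg J (v t) = J + (2*t) • E33 := by
  apply ext3 <;> simp [cg, J, val_v, E33, mul3] <;> try ring
lemma cg_E_v (t : ℝ) : cg E33 (v t) = E33 := by
  apply ext3 <;> simp [cg, E33, val_v, mul3]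
lemma v_u (s t : ℝ) : v s * u t = u t * v s := by
  apply val_inj
  apply ext3 <;> simp [val_mul, val_u, val_v, mul3] <;> try ring
lemma F_u (t : ℝ) (g : G) : F (u t * g) = F g := by rw [F, cg_mul, cg_J_u]; rfl
lemma E_u (t : ℝ) (g : G) : E (u t * g) = E g := by rw [E, cg_mul, cg_E_u]; rfl
lemma F_v (t : ℝ) (g : G) : F (v t * g) = F g + (2*t) • E g := by
  rw [F, cg_mul, cg_J_v, cg_add, cg_smul]; rfl
lemma E_v (t : ℝ) (g : G) : E (v t * g) = E g := by rw [E, cg_mul, cg_E_v]; rfl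
lemma J_symm : Jᵀ = J := by apply ext3 <;> simp [J]
lemma E33_symm : E33ᵀ = E33 := by apply ext3 <;> simp [E33]
lemma F_symm (g : G) : (F g)ᵀ = F g := cg_symm J_symm g
lemma det_J : J.det = 1 := JG.2
lemma det_F (g : G) : (F g).det = 1 := by rw [F, det_cg, det_J]
lemma E_apply (g : G) (i j : Fin 3) : E g i j = g.mt 2 i * g.mt 2 j := by
  simp [E, cg, E33, mul3]
lemma E33_ne : E33 ≠ 0 := by
  intro h; have := congrFun (congrFun h 2) 2; simp [E33] at this
lemma E_ne (g : G) : E g ≠ 0 := by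
  intro h; apply E33_ne; apply cg_inj g; rw [cg_zero]; exact h
lemma continuous_cg_right (C : M3) : Continuous (fun g : G => cg C g) := by
  unfold cg
  exact ((continuous_val.matrix_transpose).matrix_mul continuous_const).matrix_mul continuous_val
lemma continuous_cg_left (g : G) : Continuous (fun C : M3 => cg C g) := by
  unfold cg
  exact (continuous_const.matrix_mul continuous_id).matrix_mul continuous_const
lemma continuous_F : Continuous F := by
  unfold F; exact continuous_cg_right J
lemma continuous_E : Continuous E := by
  unfold E; exact continuous_cg_right E33

/-! dual -/
def star (g : G) : G := JG * (g⁻¹).transpose * JG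
def starZ (g : Ga) : Ga := JZ * (g⁻¹).transpose * JZ

lemma JG_sq : JG * JG = 1 := by
  apply val_inj
  apply ext3 <;> simp [val_mul, val_JG, val_one, J, mul3]
lemma JZ_sq : JZ * JZ = 1 := by
  apply val_inj
  apply ext3 <;> simp [val_mul, val_JZ, val_one, mul3]
lemma JG_T : JG.transpose = JG := Subtype.ext J_symm
lemma io_JZ : io JZ = JG := by
  apply val_inj
  apply ext3 <;> simp [val_JG, J, io_apply, val_JZ]
lemma transpose_mul' (a b : G) : (a*b).transpose = b.transpose * a.transpose :=
  Subtype.ext (Matrix.transpose_mul _ _)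
lemma star_mul' (g h : G) : star (g*h) = star g * star h := by
  unfold star
  rw [_root_.mul_inv_rev, transpose_mul']
  calc _ = JG * (g⁻¹.transpose * 1 * h⁻¹.transpose) * JG := by simp
    _ = _ := by rw [← JG_sq]; group
lemma inv_T (g : G) : (g.transpose)⁻¹ = (g⁻¹).transpose := by
  rw [inv_eq_iff_mul_eq_one, ← transpose_mul', inv_mul_cancel]
  apply val_inj; simp [val_T, val_one]
lemma JG_inv : JG⁻¹ = JG := inv_eq_of_mul_eq_one_right JG_sq
lemma star_star' (g : G) : star (star g) = g := by
  have h : ((star g)⁻¹).transpose = JG * g * JG := by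
    unfold star
    rw [_root_.mul_inv_rev, _root_.mul_inv_rev, inv_T, JG_inv, transpose_mul', transpose_mul', JG_T, inv_inv]
    rfl
  have h2 : star (star g) = JG * ((star g)⁻¹).transpose * JG := rfl
  rw [h2, h]
  calc _ = (JG * JG) * g * (JG * JG) := by group
    _ = _ := by rw [JG_sq]; simp
lemma star_u (t : ℝ) : star (u t) = u t := by
  unfold star
  rw [← u_neg]
  apply val_inj
  apply ext3 <;> simp [val_mul, val_JG, val_T, J, val_u, Matrix.mul_apply, Fin.sum_univ_three, -Matrix.cons_mul]
lemma io_T (γ : Ga) : io (γ.transpose) = (io γ).transpose := by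
  apply val_inj
  ext i j
  simp [io_apply, val_T]
lemma io_starZ (γ : Ga) : io (starZ γ) = star (io γ) := by
  unfold starZ star
  rw [map_mul, map_mul, io_JZ, io_T, map_inv]
lemma continuous_T : Continuous (fun g : G => g.transpose) := by
  refine continuous_induced_rng.mpr ?_
  exact continuous_val.matrix_transpose
lemma continuous_star : Continuous star := by
  unfold star
  exact (continuous_const.mul (continuous_T.comp continuous_inv)).mul continuous_const

/-- action on integer vectors -/
def act (g : G) (m : Fin 3 → ℤ) : Fin 3 → ℝ := g.mt *ᵥ (fun i => (m i : ℝ))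
lemma act_io (g : G) (γ : Ga) (m : Fin 3 → ℤ) : act (g * io γ) m = act g (γ.mt *ᵥ m) := by
  unfold act
  rw [val_mul, ← Matrix.mulVec_mulVec]
  congr 1
  ext i
  simp [Matrix.mulVec, dotProduct, io_apply]
lemma act_mul (g h : G) (m : Fin 3 → ℤ) : act (g * h) m = g.mt *ᵥ (act h m) := by
  unfold act
  rw [val_mul, ← Matrix.mulVec_mulVec]
lemma act_u (t : ℝ) (g : G) (m : Fin 3 → ℤ) : act (u t * g) m =
    ![act g m 0 + t * act g m 1 + t^2/2 * act g m 2, act g m 1 + t * act g m 2, act g m 2] := by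
  rw [act_mul]
  ext i
  fin_cases i <;> simp [val_u, Matrix.mulVec, dotProduct, Fin.sum_univ_three]
lemma act_smul (g : G) (d : ℤ) (m : Fin 3 → ℤ) : act g (d • m) = (d:ℝ) • act g m := by
  unfold act
  rw [← Matrix.mulVec_smul]; congr 1; ext i; simp
lemma act_neg (g : G) (m : Fin 3 → ℤ) : act g (-m) = - act g m := by
  have := act_smul g (-1) m; simpa using this
lemma inv_mulVec_act (g : G) (m : Fin 3 → ℤ) : (g⁻¹).mt *ᵥ (act g m) = fun i => (m i : ℝ) := by
  rw [← act_mul]; simp [act, val_one]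
lemma mulVec_inj (g : G) {x y : Fin 3 → ℝ} (h : g.mt *ᵥ x = g.mt *ᵥ y) : x = y := by
  have := congrArg (fun z => (g⁻¹).mt *ᵥ z) h
  simp only [Matrix.mulVec_mulVec, ← val_mul, inv_mul_cancel, val_one] at this
  simpa using this

def Prim (m : Fin 3 → ℤ) : Prop := ∃ a : Fin 3 → ℤ, a 0 * m 0 + a 1 * m 1 + a 2 * m 2 = 1

lemma Prim.ne {m : Fin 3 → ℤ} (h : Prim m) : m ≠ 0 := by
  rintro rfl; obtain ⟨a, ha⟩ := h; simp at ha

lemma exists_prim (m : Fin 3 → ℤ) (hm : m ≠ 0) : ∃ d : ℤ, ∃ p, d ≠ 0 ∧ Prim p ∧ m = d • p := by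
  obtain ⟨d, hd⟩ := (IsPrincipalIdealRing.principal (Ideal.span (Set.range m))).principal
  have hd' : Ideal.span (Set.range m) = Ideal.span {d} := hd
  have h1 : ∀ i, d ∣ m i := fun i => by
    rw [← Ideal.mem_span_singleton, ← hd']; exact Ideal.subset_span ⟨i, rfl⟩
  choose p hp using h1
  have h2 : d ∈ Ideal.span (Set.range m) := by rw [hd']; exact Ideal.mem_span_singleton_self d
  obtain ⟨a, ha⟩ := (Ideal.mem_span_range_iff_exists_fun).1 h2
  have hd0 : d ≠ 0 := by
    rintro rfl; apply hm; ext i; simp [hp i]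
  refine ⟨d, p, hd0, ⟨a, ?_⟩, ?_⟩
  · rw [Fin.sum_univ_three, hp 0, hp 1, hp 2] at ha
    have : d * (a 0 * p 0 + a 1 * p 1 + a 2 * p 2) = d * 1 := by linarith
    exact mul_left_cancel₀ hd0 this
  · ext i; simp [hp i]

lemma prim_parallel {m m' : Fin 3 → ℤ} (h : Prim m) (h' : Prim m')
    (c0 : m 1 * m' 2 = m 2 * m' 1) (c1 : m 2 * m' 0 = m 0 * m' 2) (c2 : m 0 * m' 1 = m 1 * m' 0) :
    m' = m ∨ m' = -m := by
  obtain ⟨a, ha⟩ := h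
  obtain ⟨b, hb⟩ := h'
  set c := a 0 * m' 0 + a 1 * m' 1 + a 2 * m' 2 with hc
  have e0 : m' 0 = c * m 0 := by linear_combination (-(m' 0)) * ha - a 1 * c2 + a 2 * c1
  have e1 : m' 1 = c * m 1 := by linear_combination (-(m' 1)) * ha + a 0 * c2 - a 2 * c0
  have e2 : m' 2 = c * m 2 := by linear_combination (-(m' 2)) * ha - a 0 * c1 + a 1 * c0
  have hu : c * (b 0 * m 0 + b 1 * m 1 + b 2 * m 2) = 1 := by
    rw [e0, e1, e2] at hb; linarith
  rcases Int.eq_one_or_neg_one_of_mul_eq_one hu with h1 | h1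
  · left; ext i; fin_cases i <;> simp [e0, e1, e2, h1]
  · right; ext i; fin_cases i <;> simp [e0, e1, e2, h1]

lemma prim_mul (γ : Ga) {m : Fin 3 → ℤ} (h : Prim m) : Prim (γ.mt *ᵥ m) := by
  obtain ⟨a, ha⟩ := h
  refine ⟨a ᵥ* (γ⁻¹).mt, ?_⟩
  have : (a ᵥ* (γ⁻¹).mt) ⬝ᵥ (γ.mt *ᵥ m) = 1 := by
    rw [Matrix.dotProduct_mulVec, Matrix.vecMul_vecMul, ← val_mul]
    simp [val_one, dotProduct, Fin.sum_univ_three, ha]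
  simpa [dotProduct, Fin.sum_univ_three] using this

end Opp
end

noncomputable section
namespace Opp
open Matrix Set Filter Topology

lemma poly1 {A B C b ρ : ℝ} (hb : 0 < b) (h : ∀ t ∈ Icc 0 b, |A + B*t + C*t^2| ≤ ρ)
    (h1 : ρ ≤ |A + B*b + C*b^2|) : ∀ t ∈ Icc (31*b/32) b, ρ/2 ≤ |A + B*t + C*t^2| := by
  intro t ht
  obtain ⟨τ, rfl⟩ : ∃ τ, t = b * τ := ⟨t/b, by field_simp⟩
  have hτ1 : τ ≤ 1 := by
    have := ht.2; by_contra hh; push Not at hh; nlinarith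
  have hτ0 : 31/32 ≤ τ := by
    have := ht.1; by_contra hh; push Not at hh; nlinarith
  have e0 := h 0 ⟨le_rfl, hb.le⟩
  have e1 := h (b/2) ⟨by linarith, by linarith⟩
  have e2 := h b ⟨hb.le, le_rfl⟩
  set q0 := A + B*0 + C*0^2
  set q1 := A + B*(b/2) + C*(b/2)^2
  set q2 := A + B*b + C*b^2
  have key : q2 - (A + B*(b*τ) + C*(b*τ)^2) = (1-τ)*((2*τ-1)*q0 - 4*τ*q1 + (1+2*τ)*q2) := by
    simp only [q0, q1, q2]; ring
  have hρ : 0 ≤ ρ := (abs_nonneg _).trans e0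
  have k2 : |(2*τ-1)*q0 - 4*τ*q1 + (1+2*τ)*q2| ≤ 8*ρ := by
    rw [abs_le] at *
    constructor <;> nlinarith
  have k3 : |q2 - (A + B*(b*τ) + C*(b*τ)^2)| ≤ ρ/2 := by
    rw [key, abs_mul, abs_of_nonneg (by linarith : 0 ≤ 1-τ)]
    nlinarith [abs_nonneg ((2*τ-1)*q0 - 4*τ*q1 + (1+2*τ)*q2)]
  have := abs_sub_abs_le_abs_sub q2 (A + B*(b*τ) + C*(b*τ)^2)
  linarith

lemma poly2 {A B C b η : ℝ} (hb : 0 < b) (h : ∀ t ∈ Icc (31*b/32) b, |A + B*t + C*t^2| ≤ η) :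
    ∀ t ∈ Icc 0 b, |A + B*t + C*t^2| ≤ 8000 * η := by
  intro t ht
  obtain ⟨x, rfl⟩ : ∃ x, t = 31*b/32 + b/64*x := ⟨(t-31*b/32)/(b/64), by field_simp; ring⟩
  have hx1 : x ≤ 2 := by
    have := ht.2; by_contra hh; push Not at hh; nlinarith
  have hx0 : -62 ≤ x := by
    have := ht.1; by_contra hh; push Not at hh; nlinarith
  have e0 := h (31*b/32) ⟨by linarith, by linarith⟩
  have e1 := h (63*b/64) ⟨by linarith, by linarith⟩
  have e2 := h b ⟨by linarith, le_rfl⟩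
  set q0 := A + B*(31*b/32) + C*(31*b/32)^2
  set q1 := A + B*(63*b/64) + C*(63*b/64)^2
  set q2 := A + B*b + C*b^2
  have hη : 0 ≤ η := (abs_nonneg _).trans e0
  have key : A + B*(31*b/32 + b/64*x) + C*(31*b/32 + b/64*x)^2
      = (x-1)*(x-2)/2*q0 + x*(2-x)*q1 + x*(x-1)/2*q2 := by
    simp only [q0, q1, q2]; ring
  rw [key]
  have f0 : |(x-1)*(x-2)/2| ≤ 2016 := by rw [abs_le]; constructor <;> nlinarith
  have f1 : |x*(2-x)| ≤ 3968 := by rw [abs_le]; constructor <;> nlinarith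
  have f2 : |x*(x-1)/2| ≤ 1953 := by rw [abs_le]; constructor <;> nlinarith
  have g0 : |(x-1)*(x-2)/2*q0| ≤ 2016 * η := by
    rw [abs_mul]; exact mul_le_mul f0 e0 (abs_nonneg _) (by norm_num)
  have g1 : |x*(2-x)*q1| ≤ 3968 * η := by
    rw [abs_mul]; exact mul_le_mul f1 e1 (abs_nonneg _) (by norm_num)
  have g2 : |x*(x-1)/2*q2| ≤ 1953 * η := by
    rw [abs_mul]; exact mul_le_mul f2 e2 (abs_nonneg _) (by norm_num)
  have := abs_add_three ((x-1)*(x-2)/2*q0) (x*(2-x)*q1) (x*(x-1)/2*q2)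
  linarith

lemma inv_mt (g : G) : (g⁻¹).mt = g.mt.adjugate := rfl

lemma star_mt (g : G) : (star g).mt =
    !![g.mt 0 0 * g.mt 1 1 - g.mt 0 1 * g.mt 1 0, g.mt 0 0 * g.mt 1 2 - g.mt 0 2 * g.mt 1 0,
         g.mt 0 1 * g.mt 1 2 - g.mt 0 2 * g.mt 1 1;
       g.mt 0 0 * g.mt 2 1 - g.mt 0 1 * g.mt 2 0, g.mt 0 0 * g.mt 2 2 - g.mt 0 2 * g.mt 2 0,
         g.mt 0 1 * g.mt 2 2 - g.mt 0 2 * g.mt 2 1;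
       g.mt 1 0 * g.mt 2 1 - g.mt 1 1 * g.mt 2 0, g.mt 1 0 * g.mt 2 2 - g.mt 1 2 * g.mt 2 0,
         g.mt 1 1 * g.mt 2 2 - g.mt 1 2 * g.mt 2 1] := by
  unfold star
  rw [val_mul, val_mul, val_T, inv_mt, val_JG, Matrix.adjugate_fin_three]
  apply ext3 <;>
    simp [J, Matrix.mul_apply, Fin.sum_univ_three, -Matrix.cons_mul] <;> ring

lemma act_apply (g : G) (m : Fin 3 → ℤ) (i : Fin 3) :
    act g m i = g.mt i 0 * m 0 + g.mt i 1 * m 1 + g.mt i 2 * m 2 := by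
  simp [act, Matrix.mulVec, dotProduct, Fin.sum_univ_three]

/-- J-twisted cross product -/
def jc {R : Type*} [CommRing R] (x y : Fin 3 → R) : Fin 3 → R :=
  ![x 0 * y 1 - x 1 * y 0, -(x 2 * y 0 - x 0 * y 2), x 1 * y 2 - x 2 * y 1]

lemma act_jc (g : G) (m m' : Fin 3 → ℤ) : act (star g) (jc m m') = jc (act g m) (act g m') := by
  ext i
  fin_cases i <;> simp [act_apply, star_mt, jc] <;> ring

def jp {R : Type*} [CommRing R] (x y : Fin 3 → R) : R := x 0 * y 2 - x 1 * y 1 + x 2 * y 0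

lemma act_jp (g : G) (m m' : Fin 3 → ℤ) : jp (act g m) (act (star g) m') = (jp m m' : ℤ) := by
  have h := det_mt g
  rw [Matrix.det_fin_three] at h
  simp [act_apply, star_mt, jp]
  linear_combination ((m 0 : ℝ) * m' 2 - m 1 * m' 1 + m 2 * m' 0) * h

lemma norm_jc (x y : Fin 3 → ℝ) : ‖jc x y‖ ≤ 2 * ‖x‖ * ‖y‖ := by
  have h : ∀ i j, |x i * y j| ≤ ‖x‖ * ‖y‖ := fun i j => by
    rw [abs_mul]; exact mul_le_mul (norm_le_pi_norm x i) (norm_le_pi_norm y j) (abs_nonneg _) (norm_nonneg _)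
  have h2 : ∀ i j k l, |x i * y j - x k * y l| ≤ 2 * ‖x‖ * ‖y‖ := fun i j k l => by
    have := abs_sub (x i * y j) (x k * y l)
    have := h i j; have := h k l; linarith
  rw [pi_norm_le_iff_of_nonneg (by positivity)]
  intro i
  rw [Real.norm_eq_abs]
  fin_cases i <;> simp only [jc]
  · exact h2 _ _ _ _
  · simpa using (h2 0 2 2 0)
  · exact h2 _ _ _ _

lemma abs_jp (x y : Fin 3 → ℝ) : |jp x y| ≤ 3 * ‖x‖ * ‖y‖ := by
  have h : ∀ i j, |x i * y j| ≤ ‖x‖ * ‖y‖ := fun i j => by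
    rw [abs_mul]; exact mul_le_mul (norm_le_pi_norm x i) (norm_le_pi_norm y j) (abs_nonneg _) (norm_nonneg _)
  have a := h 0 2; have b := h 1 1; have c := h 2 0
  unfold jp
  rw [abs_le] at *
  constructor <;> linarith

lemma jc_eq {m0 m m' : Fin 3 → ℤ} (h0 : Prim m0) (h : jp m0 m = 0) (h' : jp m0 m' = 0) :
    ∃ c : ℤ, jc m m' = c • m0 := by
  obtain ⟨a, ha⟩ := h0
  unfold jp at h h'
  refine ⟨a 0 * jc m m' 0 + a 1 * jc m m' 1 + a 2 * jc m m' 2, ?_⟩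
  ext i
  fin_cases i <;> simp [jc]
  · linear_combination (-(m 0 * m' 1 - m 1 * m' 0)) * ha + a 1 * (m' 0 * h - m 0 * h') + a 2 * (m' 1 * h - m 1 * h')
  · linear_combination (m 2 * m' 0 - m 0 * m' 2) * ha - a 0 * (m' 0 * h - m 0 * h') + a 2 * (m' 2 * h - m 2 * h')
  · linear_combination (-(m 1 * m' 2 - m 2 * m' 1)) * ha - a 0 * (m' 1 * h - m 1 * h') - a 1 * (m' 2 * h - m 2 * h')

lemma jc_zero {m m' : Fin 3 → ℤ} (h : Prim m) (h' : Prim m') (h0 : jc m m' = 0) : m' = m ∨ m' = -m := by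
  have e0 := congrFun h0 0
  have e1 := congrFun h0 1
  have e2 := congrFun h0 2
  simp [jc] at e0 e1 e2
  exact prim_parallel h h' (by linarith) (by linarith) (by linarith)

lemma act_ne (g : G) {m : Fin 3 → ℤ} (h : m ≠ 0) : act g m ≠ 0 := by
  intro h0
  have := inv_mulVec_act g m
  rw [h0] at this
  apply h
  ext i
  have := congrFun this i
  simp at this
  simpa using this.symm

lemma nd_pair (h : G) {m0 m m' : Fin 3 → ℤ} {ρ ε : ℝ} (hρ : 0 < ρ) (hm0 : Prim m0) (hm : Prim m) (hm' : Prim m')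
    (h1 : ‖act h m0‖ ≤ ρ) (h2 : ρ/2 ≤ ‖act h m0‖) (e1 : 3 * ρ * ε < 1) (e2 : 2 * ε^2 < ρ/2)
    (k : ‖act (star h) m‖ < ε) (k' : ‖act (star h) m'‖ < ε) : m' = m ∨ m' = -m := by
  have hz : ∀ n, ‖act (star h) n‖ < ε → jp m0 n = 0 := by
    intro n hn
    have a := abs_jp (act h m0) (act (star h) n)
    rw [act_jp] at a
    have : |((jp m0 n : ℤ) : ℝ)| < 1 := by
      refine lt_of_le_of_lt a (lt_of_le_of_lt ?_ e1)
      have : ‖act h m0‖ * ‖act (star h) n‖ ≤ ρ * ε := mul_le_mul h1 hn.le (norm_nonneg _) hρ.le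
      linarith
    have : |jp m0 n| < 1 := by exact_mod_cast this
    exact Int.abs_lt_one_iff.1 this
  obtain ⟨c, hc⟩ := jc_eq hm0 (hz m k) (hz m' k')
  apply jc_zero hm hm'
  rw [hc]
  have a := act_jc (star h) m m'
  rw [star_star', hc, act_smul] at a
  have b := norm_jc (act (star h) m) (act (star h) m')
  rw [← a, norm_smul] at b
  have : ‖act (star h) m‖ * ‖act (star h) m'‖ ≤ ε * ε :=
    mul_le_mul k.le k'.le (norm_nonneg _) ((norm_nonneg _).trans k.le)
  have hc1 : |(c:ℝ)| < 1 := by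
    by_contra hh; push Not at hh
    rw [Real.norm_eq_abs] at b
    nlinarith [norm_nonneg (act h m0)]
  have : |c| < 1 := by exact_mod_cast hc1
  rw [Int.abs_lt_one_iff.1 this]; simp

lemma continuous_act_u (g : G) (m : Fin 3 → ℤ) : Continuous (fun t => act (u t * g) m) := by
  simp only [act_u]
  refine continuous_pi fun i => ?_
  fin_cases i <;> simp <;> fun_prop

lemma act_u_poly (g : G) (m : Fin 3 → ℤ) (i : Fin 3) : ∃ A B C : ℝ, ∀ t, act (u t * g) m i = A + B*t + C*t^2 := by
  simp only [act_u]
  fin_cases i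
  · exact ⟨act g m 0, act g m 1, act g m 2 / 2, fun t => by simp; ring⟩
  · exact ⟨act g m 1, act g m 2, 0, fun t => by simp; ring⟩
  · exact ⟨act g m 2, 0, 0, fun t => by simp⟩

lemma finite_act (g : G) (ρ : ℝ) : {m : Fin 3 → ℤ | ‖act g m‖ < ρ}.Finite := by
  obtain ⟨N, hN⟩ : ∃ N : ℝ, ∀ x : Fin 3 → ℝ, ‖x‖ < ρ → ∀ i, |((g⁻¹).mt *ᵥ x) i| ≤ N := by
    refine ⟨∑ i, ∑ j, |(g⁻¹).mt i j| * |ρ|, fun x hx i => ?_⟩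
    have h1 : |((g⁻¹).mt *ᵥ x) i| ≤ ∑ j, |(g⁻¹).mt i j| * |ρ| := by
      simp only [Matrix.mulVec, dotProduct]
      refine (Finset.abs_sum_le_sum_abs _ _).trans (Finset.sum_le_sum fun j _ => ?_)
      rw [abs_mul]
      exact mul_le_mul_of_nonneg_left (((norm_le_pi_norm x j).trans hx.le).trans (le_abs_self _)) (abs_nonneg _)
    refine h1.trans (Finset.single_le_sum (f := fun i => ∑ j, |(g⁻¹).mt i j| * |ρ|) (fun i _ => ?_) (Finset.mem_univ i))
    exact Finset.sum_nonneg fun j _ => by positivity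
  refine Set.Finite.subset (s := Set.pi univ (fun _ => Icc (-⌈N⌉) ⌈N⌉)) ?_ ?_
  · exact Set.Finite.pi (fun _ => Set.finite_Icc _ _)
  · intro m hm i _
    have := hN _ hm i
    rw [inv_mulVec_act] at this
    rw [abs_le] at this
    constructor
    · have h1 := Int.le_ceil N
      have : (-(⌈N⌉:ℝ)) ≤ m i := by linarith
      exact_mod_cast this
    · have h1 := Int.le_ceil N
      have : (m i : ℝ) ≤ ⌈N⌉ := by linarith
      exact_mod_cast this

lemma hitting {f : ℝ → ℝ} (hf : Continuous f) {ρ : ℝ} (h : ∃ t, 0 ≤ t ∧ ρ ≤ f t) :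
    ∃ b, 0 ≤ b ∧ ρ ≤ f b ∧ ∀ t, 0 ≤ t → t < b → f t < ρ := by
  set s : Set ℝ := {t | 0 ≤ t ∧ ρ ≤ f t}
  have hs : IsClosed s := (isClosed_le continuous_const continuous_id).inter (isClosed_le continuous_const hf)
  have hb : BddBelow s := ⟨0, fun t ht => ht.1⟩
  have hm := hs.csInf_mem h hb
  refine ⟨sInf s, hm.1, hm.2, fun t h0 ht => ?_⟩
  by_contra hh; push Not at hh
  exact absurd (csInf_le hb ⟨h0, hh⟩) (not_le.2 ht)

/-- main step: the latest hitting vector is of first type -/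
lemma nd_step {g : G} {m0 : Fin 3 → ℤ} {ρ ε b : ℝ} (hρ : 0 < ρ) (hb : 0 < b)
    (hm0 : Prim m0) (hε : 0 < ε) (e1 : 3 * ρ * ε < 1) (e2 : 2 * ε^2 < ρ/2) (e3 : 9000 * ε ≤ ρ)
    (h1 : ∀ t ∈ Icc 0 b, ‖act (u t * g) m0‖ ≤ ρ) (h2 : ρ ≤ ‖act (u b * g) m0‖)
    (h3 : ∀ m, Prim m → ∃ t ∈ Icc 0 b, ρ ≤ ‖act (u t * star g) m‖) :
    ∃ t, 0 ≤ t ∧ (∀ m, Prim m → ε ≤ ‖act (u t * star g) m‖) ∧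
      (∀ m, Prim m → min (ρ/2) (ε / (2*ρ)) ≤ ‖act (u t * g) m‖) := by
  have hI : ∀ t ∈ Icc (31*b/32) b, ρ/2 ≤ ‖act (u t * g) m0‖ := by
    obtain ⟨i, hi⟩ : ∃ i, ρ ≤ |act (u b * g) m0 i| := by
      by_contra hh; push Not at hh
      exact absurd ((pi_norm_lt_iff hρ).2 hh) (not_lt.2 h2)
    obtain ⟨A, B, C, hq⟩ := act_u_poly g m0 i
    intro t ht
    refine le_trans ?_ (norm_le_pi_norm _ i)
    rw [Real.norm_eq_abs, hq]
    refine poly1 hb (fun s hs => ?_) (by rw [← hq]; exact hi) t ht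
    rw [← hq]
    exact (norm_le_pi_norm _ i).trans (h1 s hs)
  have hsu : ∀ t, u t * star g = star (u t * g) := fun t => by rw [star_mul', star_u]
  have hsub : Icc (31*b/32) b ⊆ Icc 0 b := Icc_subset_Icc (by linarith) le_rfl
  obtain ⟨t, ht, hts⟩ : ∃ t ∈ Icc (31*b/32) b, ∀ m, Prim m → ε ≤ ‖act (u t * star g) m‖ := by
    by_contra hcon
    push Not at hcon
    obtain ⟨m1, hm1, hlt⟩ := hcon b ⟨by linarith, le_rfl⟩
    have ho : ∀ m, IsOpen {t | ‖act (u t * star g) m‖ < ε} := fun m =>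
      isOpen_lt (continuous_act_u (star g) m).norm continuous_const
    have hpc : IsPreconnected (Icc (31*b/32) b) := isPreconnected_Icc
    have hss : Icc (31*b/32) b ⊆ {t | ‖act (u t * star g) m1‖ < ε} := by
      intro t ht
      by_contra hnot
      obtain ⟨m2, hm2, hlt2⟩ := hcon t ht
      have hpm : ∀ m s, ‖act (u s * star g) (-m)‖ = ‖act (u s * star g) m‖ := fun m s => by
        rw [act_neg, norm_neg]
      have hne2 : ¬ (m2 = m1 ∨ m2 = -m1) := by
        rintro (rfl | rfl)
        · exact hnot hlt2
        · rw [hpm] at hlt2; exact hnot hlt2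
      obtain ⟨s, hs, hsu1, hsv⟩ := hpc {t | ‖act (u t * star g) m1‖ < ε}
        (⋃ m : {m // Prim m ∧ ¬ (m = m1 ∨ m = -m1)}, {t | ‖act (u t * star g) m.1‖ < ε})
        (ho m1) (isOpen_iUnion fun m => ho m.1) (by
          intro s hs
          obtain ⟨m3, hm3, hlt3⟩ := hcon s hs
          by_cases hp : m3 = m1 ∨ m3 = -m1
          · left
            rcases hp with rfl | rfl
            · exact hlt3
            · rw [hpm] at hlt3; exact hlt3
          · right; exact mem_iUnion.2 ⟨⟨m3, hm3, hp⟩, hlt3⟩)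
        ⟨b, ⟨by linarith, le_rfl⟩, hlt⟩ ⟨t, ht, mem_iUnion.2 ⟨⟨m2, hm2, hne2⟩, hlt2⟩⟩
      obtain ⟨⟨m3, hm3, hne3⟩, hlt3⟩ := mem_iUnion.1 hsv
      apply hne3
      simp only [mem_setOf_eq, hsu] at hsu1 hlt3
      exact nd_pair (u s * g) hρ hm0 hm1 hm3 (h1 s (hsub hs)) (hI s hs) e1 e2 hsu1 hlt3
    obtain ⟨t, ht, hle⟩ := h3 m1 hm1
    have : ‖act (u t * star g) m1‖ ≤ 8000 * ε := by
      rw [pi_norm_le_iff_of_nonneg (by positivity)]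
      intro i
      obtain ⟨A, B, C, hq⟩ := act_u_poly (star g) m1 i
      rw [Real.norm_eq_abs, hq]
      refine poly2 hb (fun s hs => ?_) t ht
      rw [← hq]
      exact (norm_le_pi_norm _ i).trans (le_of_lt (hss hs))
    linarith
  refine ⟨t, (hsub ht).1, hts, fun m hm => ?_⟩
  by_cases hpar : m = m0 ∨ m = -m0
  · refine (min_le_left _ _).trans ((hI t ht).trans (le_of_eq ?_))
    rcases hpar with rfl | rfl
    · rfl
    · rw [act_neg, norm_neg]
  · refine (min_le_right _ _).trans ?_
    have hne : jc m0 m ≠ 0 := fun h0 => hpar (jc_zero hm0 hm h0)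
    obtain ⟨d, p, hd, hp, hdp⟩ := exists_prim _ hne
    have a := act_jc (u t * g) m0 m
    rw [hdp, act_smul, ← hsu] at a
    have c := norm_jc (act (u t * g) m0) (act (u t * g) m)
    rw [← a, norm_smul, Real.norm_eq_abs] at c
    have hd1 : (1:ℝ) ≤ |(d:ℝ)| := by exact_mod_cast Int.one_le_abs hd
    have c2 := hts p hp
    have c3 := h1 t (hsub ht)
    rw [div_le_iff₀ (by positivity)]
    have : ‖act (u t * g) m0‖ * ‖act (u t * g) m‖ ≤ ρ * ‖act (u t * g) m‖ :=
      mul_le_mul_of_nonneg_right c3 (norm_nonneg _)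
    nlinarith [norm_nonneg (act (u t * star g) p)]

theorem ND {ρ : ℝ} (hρ : 0 < ρ) (hρ1 : ρ ≤ 1) : ∃ ε > 0, ∀ g : G,
    (∀ m, Prim m → ∃ t, 0 ≤ t ∧ ρ ≤ ‖act (u t * g) m‖) →
    (∀ m, Prim m → ∃ t, 0 ≤ t ∧ ρ ≤ ‖act (u t * star g) m‖) →
    ∃ t, 0 ≤ t ∧ ∀ m, m ≠ 0 → ε ≤ ‖act (star (u t * g)) m‖ := by
  set ε0 := ρ / 9000 with hε0
  have hε0p : 0 < ε0 := by positivity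
  have e1 : 3 * ρ * ε0 < 1 := by rw [hε0]; nlinarith
  have e2 : 2 * ε0^2 < ρ/2 := by rw [hε0]; nlinarith
  have e3 : 9000 * ε0 ≤ ρ := by rw [hε0]; linarith
  set ε := min ε0 (min (ρ/2) (ε0 / (2*ρ))) with hε
  have hεp : 0 < ε := lt_min hε0p (lt_min (by positivity) (by positivity))
  refine ⟨ε, hεp, fun g hA hB => ?_⟩
  suffices h : ∃ t, 0 ≤ t ∧ ∀ m, Prim m → ε ≤ ‖act (u t * star g) m‖ by
    obtain ⟨t, ht, h⟩ := h
    refine ⟨t, ht, fun m hm => ?_⟩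
    obtain ⟨d, p, hd, hp, rfl⟩ := exists_prim m hm
    rw [star_mul', star_u, act_smul, norm_smul, Real.norm_eq_abs]
    have hd1 : (1:ℝ) ≤ |(d:ℝ)| := by exact_mod_cast Int.one_le_abs hd
    nlinarith [h p hp]
  let gg : Bool → G := fun b => if b then star g else g
  have hAB : ∀ b m, Prim m → ∃ t, 0 ≤ t ∧ ρ ≤ ‖act (u t * gg b) m‖ := by
    intro b; cases b
    · exact hA
    · exact hB
  have hh : ∀ x : Bool × (Fin 3 → ℤ), ∃ b, Prim x.2 → 0 ≤ b ∧ ρ ≤ ‖act (u b * gg x.1) x.2‖ ∧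
      ∀ t, 0 ≤ t → t < b → ‖act (u t * gg x.1) x.2‖ < ρ := by
    intro x
    by_cases hx : Prim x.2
    · obtain ⟨b, hb⟩ := hitting (continuous_act_u (gg x.1) x.2).norm (hAB x.1 x.2 hx)
      exact ⟨b, fun _ => hb⟩
    · exact ⟨0, fun h => absurd h hx⟩
  choose hit hhit using hh
  let Bad : Set (Bool × (Fin 3 → ℤ)) := {x | Prim x.2 ∧ ‖act (gg x.1) x.2‖ < ρ}
  have hfin : Bad.Finite := by
    refine Set.Finite.subset ((Set.finite_univ (α := Bool)).prod ((finite_act g ρ).union (finite_act (star g) ρ))) ?_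
    rintro ⟨b, m⟩ ⟨_, h⟩
    refine ⟨mem_univ _, ?_⟩
    cases b
    · left; exact h
    · right; exact h
  rcases Bad.eq_empty_or_nonempty with hempty | hne
  · refine ⟨0, le_rfl, fun m hm => ?_⟩
    rw [u_zero, one_mul]
    by_contra hlt
    push Not at hlt
    have : ((true, m) : Bool × (Fin 3 → ℤ)) ∈ Bad :=
      ⟨hm, lt_of_lt_of_le hlt ((min_le_left _ _).trans (by linarith))⟩
    rw [hempty] at this; exact this
  · obtain ⟨⟨b0, m0⟩, hx0, hmax⟩ := Set.exists_max_image Bad hit hfin hne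
    set b := hit (b0, m0) with hbdef
    obtain ⟨hb0, hb1, hb2⟩ := hhit (b0, m0) hx0.1
    simp only [← hbdef] at hb0 hb1 hb2
    have hbpos : 0 < b := by
      rcases hb0.lt_or_eq with h | h
      · exact h
      · rw [← h, u_zero, one_mul] at hb1
        exact absurd hx0.2 (not_lt.2 hb1)
    have hle : ∀ t ∈ Icc 0 b, ‖act (u t * gg b0) m0‖ ≤ ρ := by
      have hcl : IsClosed {t | ‖act (u t * gg b0) m0‖ ≤ ρ} :=
        isClosed_le (continuous_act_u _ _).norm continuous_const
      have : closure (Ico 0 b) ⊆ {t | ‖act (u t * gg b0) m0‖ ≤ ρ} :=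
        hcl.closure_subset_iff.2 fun t ht => (hb2 t ht.1 ht.2).le
      rwa [closure_Ico hbpos.ne] at this
    have hall : ∀ c m, Prim m → ∃ t ∈ Icc 0 b, ρ ≤ ‖act (u t * gg c) m‖ := by
      intro c m hm
      by_cases hbad : ((c, m) : Bool × (Fin 3 → ℤ)) ∈ Bad
      · obtain ⟨k0, k1, k2⟩ := hhit (c, m) hm
        exact ⟨hit (c, m), ⟨k0, hmax _ hbad⟩, k1⟩
      · refine ⟨0, ⟨le_rfl, hb0⟩, ?_⟩
        rw [u_zero, one_mul]
        by_contra hlt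
        push Not at hlt
        exact hbad ⟨hm, hlt⟩
    cases b0
    · obtain ⟨t, ht, k1, k2⟩ := nd_step hρ hbpos hx0.1 hε0p e1 e2 e3 hle hb1 (hall true)
      exact ⟨t, ht, fun m hm => (min_le_left _ _).trans (k1 m hm)⟩
    · obtain ⟨t, ht, k1, k2⟩ := nd_step (g := star g) hρ hbpos hx0.1 hε0p e1 e2 e3 hle hb1
        (by rw [star_star']; exact hall false)
      exact ⟨t, ht, fun m hm => (min_le_right _ _).trans (k2 m hm)⟩

end Opp
end

noncomputable section
namespace Opp
open Matrix Set Filter Topology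

def cn (k : G) (j : Fin 3) : ℝ := k.mt 0 j ^ 2 + k.mt 1 j ^ 2 + k.mt 2 j ^ 2
def NN (k : G) : ℝ := cn k 0 + cn k 1 + cn k 2

lemma star_bound_io {ε : ℝ} {k : G} (h : ∀ m, m ≠ 0 → ε ≤ ‖act (star k) m‖) (γ : Ga) :
    ∀ m, m ≠ 0 → ε ≤ ‖act (star (k * io γ)) m‖ := by
  intro m hm
  rw [star_mul', ← io_starZ, act_io]
  apply h
  intro h0
  apply hm
  have := congrArg (fun z => ((starZ γ)⁻¹).mt *ᵥ z) h0
  simpa [Matrix.mulVec_mulVec, ← val_mul, val_one] using this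

def colop (m n : ℤ) : Ga := ⟨!![1,0,m;0,1,n;0,0,1], by simp [Matrix.det_fin_three]⟩
lemma val_colop (m n : ℤ) : (colop m n).mt = !![1,0,m;0,1,n;0,0,1] := rfl
def cyc : Ga := ⟨!![0,0,1;1,0,0;0,1,0], by simp [Matrix.det_fin_three]⟩
lemma val_cyc : (cyc).mt = !![0,0,1;1,0,0;0,1,0] := rfl

lemma cn_cyc (k : G) : cn (k * io cyc) 0 = cn k 1 ∧ cn (k * io cyc) 1 = cn k 2 ∧ cn (k * io cyc) 2 = cn k 0 := by
  simp [cn, val_mul, mul3, io_apply, val_cyc]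

lemma avg4 {x w a b D f g : ℝ} (f0 : 0 ≤ f) (f1 : f ≤ 1) (g0 : 0 ≤ g) (g1 : g ≤ 1)
    (ha : 0 ≤ a) (hb : 0 ≤ b)
    (i00 : x ≤ w + (-f)^2 * a + (-g)^2 * b + 2 * (-f) * (-g) * D)
    (i10 : x ≤ w + (1-f)^2 * a + (-g)^2 * b + 2 * (1-f) * (-g) * D)
    (i01 : x ≤ w + (-f)^2 * a + (1-g)^2 * b + 2 * (-f) * (1-g) * D)
    (i11 : x ≤ w + (1-f)^2 * a + (1-g)^2 * b + 2 * (1-f) * (1-g) * D) : x ≤ w + a/4 + b/4 := by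
  have s0 : x ≤ w + (-f)^2 * a + g*(1-g) * b := by
    linear_combination (1-g) * i00 + g * i01
  have s1 : x ≤ w + (1-f)^2 * a + g*(1-g) * b := by
    linear_combination (1-g) * i10 + g * i11
  have tot : x ≤ w + f*(1-f)*a + g*(1-g)*b := by
    linear_combination (1-f) * s0 + f * s1
  have q0 : f*(1-f)*a ≤ 1/4 * a := mul_le_mul_of_nonneg_right (by nlinarith [sq_nonneg (f-1/2)]) ha
  have q1 : g*(1-g)*b ≤ 1/4 * b := mul_le_mul_of_nonneg_right (by nlinarith [sq_nonneg (g-1/2)]) hb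
  linarith

lemma avg {x w a b D c0 c1 : ℝ} (h : ∀ m n : ℤ, x ≤ w + (m - c0)^2 * a + (n - c1)^2 * b + 2 * (m-c0)*(n-c1)*D)
    (ha : 0 ≤ a) (hb : 0 ≤ b) : x ≤ w + a/4 + b/4 := by
  have e0 : (⌊c0⌋:ℝ) - c0 = -(Int.fract c0) := by rw [Int.fract]; ring
  have e1 : (⌊c1⌋:ℝ) - c1 = -(Int.fract c1) := by rw [Int.fract]; ring
  have e2 : ((⌊c0⌋+1 : ℤ):ℝ) - c0 = 1-(Int.fract c0) := by rw [Int.fract]; push_cast; ring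
  have e3 : ((⌊c1⌋+1 : ℤ):ℝ) - c1 = 1-(Int.fract c1) := by rw [Int.fract]; push_cast; ring
  refine avg4 (Int.fract_nonneg c0) (Int.fract_lt_one c0).le (Int.fract_nonneg c1) (Int.fract_lt_one c1).le ha hb ?_ ?_ ?_ ?_ (D := D)
  · have := h ⌊c0⌋ ⌊c1⌋; rwa [e0, e1] at this
  · have := h (⌊c0⌋+1) ⌊c1⌋; rwa [e2, e1] at this
  · have := h ⌊c0⌋ (⌊c1⌋+1); rwa [e0, e3] at this
  · have := h (⌊c0⌋+1) (⌊c1⌋+1); rwa [e2, e3] at this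

lemma mahler_col {ε : ℝ} (hε : 0 < ε) {k : G} (h : ∀ m, m ≠ 0 → ε ≤ ‖act (star k) m‖)
    (hmin : ∀ γ, NN k ≤ NN (k * io γ)) (h0 : cn k 0 ≤ cn k 2) (h1 : cn k 1 ≤ cn k 2) :
    cn k 2 ≤ 2 / ε^2 := by
  have hmn : ∀ m n : ℤ, cn k 2 ≤ (k.mt 0 2 + m * k.mt 0 0 + n * k.mt 0 1)^2 +
      (k.mt 1 2 + m * k.mt 1 0 + n * k.mt 1 1)^2 + (k.mt 2 2 + m * k.mt 2 0 + n * k.mt 2 1)^2 := by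
    intro m n
    have := hmin (colop m n)
    simp [NN, cn, val_mul, mul3, io_apply, val_colop] at this
    unfold cn
    linarith
  set w0 := k.mt 1 0 * k.mt 2 1 - k.mt 1 1 * k.mt 2 0 with hw0
  set w1 := k.mt 0 1 * k.mt 2 0 - k.mt 0 0 * k.mt 2 1 with hw1
  set w2 := k.mt 0 0 * k.mt 1 1 - k.mt 0 1 * k.mt 1 0 with hw2
  set W := w0^2 + w1^2 + w2^2 with hW
  have hWε : ε^2 ≤ W := by
    have a := h ![1,0,0] (by intro h0; have := congrFun h0 0; simp at this)
    by_contra hlt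
    push Not at hlt
    have : ‖act (star k) ![1,0,0]‖ < ε := by
      rw [pi_norm_lt_iff hε]
      intro i
      rw [Real.norm_eq_abs]
      apply abs_lt_of_sq_lt_sq _ hε.le
      refine lt_of_le_of_lt ?_ hlt
      rw [act_apply, star_mt]
      fin_cases i <;> simp [hW, hw0, hw1, hw2] <;> nlinarith [sq_nonneg w0, sq_nonneg w1, sq_nonneg w2]
    linarith
  have hWp : 0 < W := lt_of_lt_of_le (by positivity) hWε
  have hdet := det_mt k
  rw [Matrix.det_fin_three] at hdet
  -- coordinates of w/W
  set c0 := ((k.mt 1 1 * k.mt 2 2 - k.mt 1 2 * k.mt 2 1) * w0 + (k.mt 0 2 * k.mt 2 1 - k.mt 0 1 * k.mt 2 2) * w1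
    + (k.mt 0 1 * k.mt 1 2 - k.mt 0 2 * k.mt 1 1) * w2) / W with hc0
  set c1 := ((k.mt 1 2 * k.mt 2 0 - k.mt 1 0 * k.mt 2 2) * w0 + (k.mt 0 0 * k.mt 2 2 - k.mt 0 2 * k.mt 2 0) * w1
    + (k.mt 0 2 * k.mt 1 0 - k.mt 0 0 * k.mt 1 2) * w2) / W with hc1
  have hc0' : c0 * W = ((k.mt 1 1 * k.mt 2 2 - k.mt 1 2 * k.mt 2 1) * w0 + (k.mt 0 2 * k.mt 2 1 - k.mt 0 1 * k.mt 2 2) * w1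
    + (k.mt 0 1 * k.mt 1 2 - k.mt 0 2 * k.mt 1 1) * w2) := by rw [hc0]; field_simp
  have hc1' : c1 * W = ((k.mt 1 2 * k.mt 2 0 - k.mt 1 0 * k.mt 2 2) * w0 + (k.mt 0 0 * k.mt 2 2 - k.mt 0 2 * k.mt 2 0) * w1
    + (k.mt 0 2 * k.mt 1 0 - k.mt 0 0 * k.mt 1 2) * w2) := by rw [hc1]; field_simp
  have r0 : k.mt 0 2 = w0 / W - c0 * k.mt 0 0 - c1 * k.mt 0 1 := by
    field_simp
    linear_combination (k.mt 0 0) * hc0' + (k.mt 0 1) * hc1' + w0 * hdet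
  have r1 : k.mt 1 2 = w1 / W - c0 * k.mt 1 0 - c1 * k.mt 1 1 := by
    field_simp
    linear_combination (k.mt 1 0) * hc0' + (k.mt 1 1) * hc1' + w1 * hdet
  have r2 : k.mt 2 2 = w2 / W - c0 * k.mt 2 0 - c1 * k.mt 2 1 := by
    field_simp
    linear_combination (k.mt 2 0) * hc0' + (k.mt 2 1) * hc1' + w2 * hdet
  set D := k.mt 0 0 * k.mt 0 1 + k.mt 1 0 * k.mt 1 1 + k.mt 2 0 * k.mt 2 1
  have hαβ : ∀ m n : ℤ, cn k 2 ≤ 1/W + (m - c0)^2 * cn k 0 + (n - c1)^2 * cn k 1 + 2 * (m-c0)*(n-c1)*D := by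
    intro m n
    have e := hmn m n
    have hW2 : (w0/W)^2 + (w1/W)^2 + (w2/W)^2 = 1/W := by
      field_simp; linarith
    have o1 : w0/W * k.mt 0 0 + w1/W * k.mt 1 0 + w2/W * k.mt 2 0 = 0 := by
      field_simp; rw [hw0, hw1, hw2]; ring
    have o2 : w0/W * k.mt 0 1 + w1/W * k.mt 1 1 + w2/W * k.mt 2 1 = 0 := by
      field_simp; rw [hw0, hw1, hw2]; ring
    refine e.trans (le_of_eq ?_)
    rw [r0, r1, r2]
    unfold cn
    linear_combination hW2 + 2*(m-c0)*o1 + 2*(n-c1)*o2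
  have p0 : 0 ≤ cn k 0 := by unfold cn; positivity
  have p1 : 0 ≤ cn k 1 := by unfold cn; positivity
  have tot := avg hαβ p0 p1
  have : 1/W ≤ 1/ε^2 := one_div_le_one_div_of_le (by positivity) hWε
  have : 2/ε^2 = 2*(1/ε^2) := by ring
  linarith

lemma NN_cyc (k : G) : NN (k * io cyc) = NN k := by
  obtain ⟨a, b, c⟩ := cn_cyc k
  unfold NN; rw [a, b, c]; ring

lemma mahler_all {ε : ℝ} (hε : 0 < ε) {k : G} (h : ∀ m, m ≠ 0 → ε ≤ ‖act (star k) m‖)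
    (hmin : ∀ γ, NN k ≤ NN (k * io γ)) (j : Fin 3) : cn k j ≤ 2 / ε^2 := by
  have key : ∀ k : G, (∀ m, m ≠ 0 → ε ≤ ‖act (star k) m‖) → (∀ γ, NN k ≤ NN (k * io γ)) →
      (∀ m, m ≠ 0 → ε ≤ ‖act (star (k * io cyc)) m‖) ∧ (∀ γ, NN (k * io cyc) ≤ NN (k * io cyc * io γ)) := by
    intro k h hmin
    refine ⟨star_bound_io h _, fun γ => ?_⟩
    rw [NN_cyc, mul_assoc, ← map_mul]; exact hmin _
  obtain ⟨h', hmin'⟩ := key k h hmin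
  obtain ⟨h'', hmin''⟩ := key _ h' hmin'
  obtain ⟨a0, a1, a2⟩ := cn_cyc k
  obtain ⟨b0, b1, b2⟩ := cn_cyc (k * io cyc)
  have c := mahler_col hε h hmin
  have c' := mahler_col hε h' hmin'
  have c'' := mahler_col hε h'' hmin''
  rw [a0, a1, a2] at c'
  rw [b0, b1, b2, a0, a1, a2] at c''
  have all : cn k 0 ≤ 2/ε^2 ∧ cn k 1 ≤ 2/ε^2 ∧ cn k 2 ≤ 2/ε^2 := by
    rcases le_total (cn k 0) (cn k 1) with x | x <;> rcases le_total (cn k 1) (cn k 2) with y | y <;>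
      rcases le_total (cn k 0) (cn k 2) with z | z
    · have := c z y; exact ⟨by linarith, by linarith, by linarith⟩
    · have := c (by linarith) y; exact ⟨by linarith, by linarith, by linarith⟩
    · have := c'' y x; exact ⟨by linarith, by linarith, by linarith⟩
    · have := c'' y x; exact ⟨by linarith, by linarith, by linarith⟩
    · have := c z y; exact ⟨by linarith, by linarith, by linarith⟩
    · have := c' x z; exact ⟨by linarith, by linarith, by linarith⟩
    · have := c'  x (by linarith); exact ⟨by linarith, by linarith, by linarith⟩
    · have := c' x z; exact ⟨by linarith, by linarith, by linarith⟩
  fin_cases j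
  · exact all.1
  · exact all.2.1
  · exact all.2.2

lemma io_col (h : G) (γ : Ga) (i j : Fin 3) : (h * io γ).mt i j = act h (fun l => γ.mt l j) i := by
  rw [act_apply, val_mul, mul3]; simp [io_apply]

theorem mahler {ε : ℝ} (hε : 0 < ε) {h : G} (hb : ∀ m, m ≠ 0 → ε ≤ ‖act (star h) m‖) :
    ∃ γ, ∀ i j, |(h * io γ).mt i j| ≤ 2 / ε^2 + 1 := by
  have hfin : {γ : Ga | NN (h * io γ) ≤ NN (h * io 1)}.Finite := by
    set M := NN (h * io 1)
    have hf := finite_act h (|M| + 2)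
    have hp : (Set.pi univ (fun _ : Fin 3 => {m : Fin 3 → ℤ | ‖act h m‖ < |M| + 2})).Finite :=
      Set.Finite.pi (fun _ => hf)
    have hinj : Function.Injective (fun γ : Ga => (fun j l => γ.mt l j : Fin 3 → Fin 3 → ℤ)) := by
      intro a b hab
      apply val_inj
      ext i j
      exact congrFun (congrFun hab j) i
    refine (hp.preimage hinj.injOn).subset ?_
    intro γ hγ j _
    show ‖act h (fun l => γ.mt l j)‖ < |M| + 2
    refine lt_of_le_of_lt ?_ (by linarith : |M| + 1 < |M| + 2)
    rw [pi_norm_le_iff_of_nonneg (by positivity)]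
    intro i
    rw [← io_col, Real.norm_eq_abs]
    have h1 : (h * io γ).mt i j ^ 2 ≤ NN (h * io γ) := by
      unfold NN cn
      fin_cases i <;> fin_cases j <;> simp only [Fin.zero_eta, Fin.mk_one, Fin.reduceFinMk] <;> nlinarith only [sq_nonneg ((h * io γ).mt 0 0), sq_nonneg ((h * io γ).mt 0 1), sq_nonneg ((h * io γ).mt 0 2), sq_nonneg ((h * io γ).mt 1 0), sq_nonneg ((h * io γ).mt 1 1), sq_nonneg ((h * io γ).mt 1 2), sq_nonneg ((h * io γ).mt 2 0), sq_nonneg ((h * io γ).mt 2 1), sq_nonneg ((h * io γ).mt 2 2)]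
    have h2 : (h * io γ).mt i j ^ 2 ≤ |M| := h1.trans (le_trans hγ (le_abs_self _))
    rw [← sq_abs] at h2
    nlinarith [abs_nonneg ((h * io γ).mt i j), abs_nonneg M]
  obtain ⟨γ, hγ, hmin⟩ := Set.exists_min_image _ (fun γ => NN (h * io γ)) hfin ⟨1, le_refl (NN (h * io 1))⟩
  refine ⟨γ, fun i j => ?_⟩
  have hmin' : ∀ δ, NN (h * io γ) ≤ NN (h * io γ * io δ) := by
    intro δ
    rw [mul_assoc, ← map_mul]
    by_cases hd : NN (h * io (γ * δ)) ≤ NN (h * io 1)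
    · exact hmin _ hd
    · push Not at hd; exact le_trans hγ hd.le
  have c := mahler_all hε (star_bound_io hb γ) hmin' j
  have c2 : (h * io γ).mt i j ^ 2 ≤ 2 / ε^2 := by
    refine le_trans ?_ c
    unfold cn
    fin_cases i <;> simp only [Fin.zero_eta, Fin.mk_one, Fin.reduceFinMk] <;> nlinarith only [sq_nonneg ((h * io γ).mt 0 j), sq_nonneg ((h * io γ).mt 1 j), sq_nonneg ((h * io γ).mt 2 j)]
  rw [← sq_abs] at c2
  nlinarith [abs_nonneg ((h * io γ).mt i j)]

def AA (ρ : ℝ) (g : G) : Prop := ∀ m, Prim m → ∀ c : ℝ, act g m = ![c,0,0] → ρ ≤ |c|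

lemma hit_of_AA {ρ : ℝ} (hρ : 0 < ρ) {g : G} (h : AA ρ g) (m : Fin 3 → ℤ) (hm : Prim m) :
    ∃ t, 0 ≤ t ∧ ρ ≤ ‖act (u t * g) m‖ := by
  have lin : ∀ y z : ℝ, z ≠ 0 → ∃ t, 0 ≤ t ∧ ρ ≤ |y + t * z| := by
    intro y z hz
    have hz' : 0 < |z| := abs_pos.2 hz
    refine ⟨(ρ + |y|)/|z|, by positivity, ?_⟩
    have h1 : |(ρ + |y|)/|z| * z| = ρ + |y| := by
      rw [abs_mul, abs_div, abs_abs, abs_of_nonneg (by positivity : 0 ≤ ρ + |y|)]; field_simp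
    have := abs_sub_abs_le_abs_sub ((ρ + |y|)/|z| * z) (-y)
    rw [h1, abs_neg, sub_neg_eq_add, add_comm _ y] at this
    linarith
  by_cases hz : act g m 2 = 0
  · by_cases hy : act g m 1 = 0
    · refine ⟨0, le_rfl, ?_⟩
      rw [u_zero, one_mul]
      have := h m hm (act g m 0) (by ext i; fin_cases i <;> simp [hz, hy])
      exact this.trans (norm_le_pi_norm (act g m) 0)
    · obtain ⟨t, ht, hle⟩ := lin (act g m 0) _ hy
      refine ⟨t, ht, hle.trans ?_⟩
      have := norm_le_pi_norm (act (u t * g) m) 0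
      rw [act_u] at this ⊢
      simpa [hz] using this
  · obtain ⟨t, ht, hle⟩ := lin (act g m 1) _ hz
    refine ⟨t, ht, hle.trans ?_⟩
    have := norm_le_pi_norm (act (u t * g) m) 1
    rw [act_u] at this ⊢
    simpa using this

lemma isCompact_box (C : ℝ) : IsCompact {g : G | ∀ i j, |g.mt i j| ≤ C} := by
  have h1 : IsCompact (Set.pi univ (fun _ : Fin 3 => Set.pi univ (fun _ : Fin 3 => Icc (-C) C)) : Set M3) :=
    isCompact_univ_pi fun _ => isCompact_univ_pi fun _ => isCompact_Icc
  have h2 := (Matrix.SpecialLinearGroup.isClosedEmbedding_val (n := Fin 3) (R := ℝ)).isCompact_preimage h1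
  refine h2.of_isClosed_subset ?_ ?_
  · have : {g : G | ∀ i j, |g.mt i j| ≤ C} = ⋂ i, ⋂ j, {g : G | |g.mt i j| ≤ C} := by
      ext g; simp
    rw [this]
    refine isClosed_iInter fun i => isClosed_iInter fun j => isClosed_le ?_ continuous_const
    exact (continuous_val.matrix_elem i j).abs
  intro g hg i _ j _
  exact abs_le.1 (hg i j)

theorem NDM {ρ : ℝ} (hρ : 0 < ρ) (hρ1 : ρ ≤ 1) : ∃ K : Set G, IsCompact K ∧ ∀ g, AA ρ g → AA ρ (star g) →
    ∃ t, 0 ≤ t ∧ ∃ γ, u t * g * io γ ∈ K := by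
  obtain ⟨ε, hε, h⟩ := ND hρ hρ1
  refine ⟨_, isCompact_box (2/ε^2+1), fun g h1 h2 => ?_⟩
  obtain ⟨t, ht, hb⟩ := h g (hit_of_AA hρ h1) (hit_of_AA hρ h2)
  obtain ⟨γ, hγ⟩ := mahler hε hb
  exact ⟨t, ht, γ, hγ⟩

end Opp
end

noncomputable section
namespace Opp
open Matrix Set Filter Topology
open scoped Pointwise

structure Inv (X : Set G) : Prop where
  closed : IsClosed X
  left : ∀ t, ∀ x ∈ X, u t * x ∈ X
  right : ∀ γ, ∀ x ∈ X, x * io γ ∈ X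

lemma AA_unique {w : G} {m m' : Fin 3 → ℤ} {c c' : ℝ} (hm : Prim m) (hm' : Prim m')
    (h : act w m = ![c,0,0]) (h' : act w m' = ![c',0,0]) : |c| = |c'| := by
  have hc : c ≠ 0 := by
    rintro rfl
    apply act_ne w hm.ne
    rw [h]; ext i; fin_cases i <;> rfl
  have e : (fun i => c' * (m i : ℝ)) = fun i => c * (m' i : ℝ) := by
    apply mulVec_inj w
    have e1 : (fun i => c' * (m i : ℝ)) = c' • (fun i => (m i : ℝ)) := rfl
    have e2 : (fun i => c * (m' i : ℝ)) = c • (fun i => (m' i : ℝ)) := rfl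
    rw [e1, e2, Matrix.mulVec_smul, Matrix.mulVec_smul]
    change c' • act w m = c • act w m'
    rw [h, h']; ext i; fin_cases i <;> simp [mul_comm]
  have f : ∀ i, c' * (m i : ℝ) = c * (m' i : ℝ) := fun i => congrFun e i
  have key : ∀ i j, m i * m' j = m j * m' i := by
    intro i j
    have : c * ((m i : ℝ) * m' j) = c * (m j * m' i) := by
      linear_combination - (m i : ℝ) * f j + m j * f i
    exact_mod_cast mul_left_cancel₀ hc this
  rcases prim_parallel hm hm' (key 1 2) (key 2 0) (key 0 1) with r | r
  · rw [r, h] at h'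
    have := congrFun h' 0
    simp at this; rw [this]
  · rw [r, act_neg, h] at h'
    have := congrFun h' 0
    simp at this; rw [← this, abs_neg]

lemma isClosed_cast (A : Set (Fin 3 → ℤ)) : IsClosed ((fun m : Fin 3 → ℤ => fun i => (m i : ℝ)) '' A) := by
  have h : IsClosedEmbedding (fun m : Fin 3 → ℤ => fun i => (m i : ℝ)) :=
    IsClosedEmbedding.piMap fun _ => Int.isClosedEmbedding_coe_real
  exact h.isClosedMap _ (isClosed_discrete A)

lemma exists_AA {X : Set G} (hX : Inv X) (hne : X.Nonempty) :
    ∃ X1 ⊆ X, Inv X1 ∧ X1.Nonempty ∧ ∃ ρ, 0 < ρ ∧ ∀ x ∈ X1, AA ρ x := by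
  by_cases H : ∃ z ∈ X, ∃ m, Prim m ∧ ∃ c : ℝ, act z m = ![c,0,0]
  · obtain ⟨z, hz, m, hm, c, hc⟩ := H
    refine ⟨X ∩ {w | ∃ m, Prim m ∧ act w m = ![c,0,0]}, inter_subset_left, ⟨?_, ?_, ?_⟩, ⟨z, hz, m, hm, hc⟩, |c|, ?_, ?_⟩
    · apply hX.closed.inter
      have : {w : G | ∃ m, Prim m ∧ act w m = ![c,0,0]} =
        (fun w : G => (w⁻¹).mt *ᵥ ![c,0,0]) ⁻¹' ((fun m : Fin 3 → ℤ => fun i => (m i : ℝ)) '' {m | Prim m}) := by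
        ext w
        constructor
        · rintro ⟨m, hm, h⟩
          exact ⟨m, hm, by simp only [← h]; exact (inv_mulVec_act w m).symm⟩
        · rintro ⟨m, hm, h⟩
          refine ⟨m, hm, ?_⟩
          simp only at h
          rw [act, h, Matrix.mulVec_mulVec, ← val_mul]; simp [val_one]
      rw [this]
      refine (isClosed_cast _).preimage ?_
      exact (continuous_val.comp continuous_inv).matrix_mulVec continuous_const
    · rintro t x ⟨hx, m, hm, h⟩
      refine ⟨hX.left t x hx, m, hm, ?_⟩
      rw [act_u, h]; simp
    · rintro γ x ⟨hx, m, hm, h⟩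
      refine ⟨hX.right γ x hx, (γ⁻¹).mt *ᵥ m, prim_mul _ hm, ?_⟩
      rw [act_io, Matrix.mulVec_mulVec, ← val_mul]; simp [val_one, h]
    · rw [abs_pos]
      rintro rfl
      apply act_ne z hm.ne
      rw [hc]; ext i; fin_cases i <;> rfl
    · rintro x ⟨hx, m, hm, h⟩ m' hm' c' h'
      exact (AA_unique hm hm' h h').le
  · exact ⟨X, subset_rfl, hX, hne, 1, one_pos, fun x hx m hm c hc => (H ⟨x, hx, m, hm, c, hc⟩).elim⟩

lemma Inv_star {X : Set G} (hX : Inv X) : Inv (star ⁻¹' X) := by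
  refine ⟨hX.closed.preimage continuous_star, fun t x hx => ?_, fun γ x hx => ?_⟩
  · rw [mem_preimage, star_mul', star_u]; exact hX.left _ _ hx
  · rw [mem_preimage, star_mul', ← io_starZ]; exact hX.right _ _ hx

lemma AA.mono {ρ ρ' : ℝ} (h : ρ' ≤ ρ) {g : G} (hg : AA ρ g) : AA ρ' g :=
  fun m hm c hc => h.trans (hg m hm c hc)

lemma exists_NDX {X : Set G} (hX : Inv X) (hne : X.Nonempty) :
    ∃ X1 ⊆ X, Inv X1 ∧ X1.Nonempty ∧ ∃ K, IsCompact K ∧ ∀ x ∈ X1, ∃ t, 0 ≤ t ∧ ∃ γ, u t * x * io γ ∈ K := by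
  obtain ⟨X1, h1, i1, n1, ρ1, p1, a1⟩ := exists_AA hX hne
  obtain ⟨x, hx⟩ := n1
  obtain ⟨X2, h2, i2, ⟨y, hy⟩, ρ2, p2, a2⟩ := exists_AA (Inv_star i1) ⟨star x, by rw [mem_preimage, star_star']; exact hx⟩
  have hsub : star ⁻¹' X2 ⊆ X1 := fun z hz => by
    have := h2 hz
    rwa [mem_preimage, star_star'] at this
  obtain ⟨K, hK, hKn⟩ := NDM (lt_min (lt_min p1 p2) one_pos) (min_le_right (min ρ1 ρ2) 1)
  refine ⟨star ⁻¹' X2, hsub.trans h1, Inv_star i2, ⟨star y, by rw [mem_preimage, star_star']; exact hy⟩, K, hK, ?_⟩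
  intro z hz
  exact hKn z ((a1 z (hsub hz)).mono ((min_le_left _ _).trans (min_le_left _ _)))
    ((a2 _ hz).mono ((min_le_left _ _).trans (min_le_right _ _)))

lemma Inv_omega {X : Set G} (hX : Inv X) (y : G) :
    Inv (⋂ n : ℕ, closure {z | ∃ t : ℝ, n ≤ t ∧ ∃ γ, u t * y * io γ = z}) := by
  refine ⟨isClosed_iInter fun n => isClosed_closure, fun s x hx => ?_, fun γ x hx => ?_⟩
  · rw [mem_iInter] at hx ⊢
    intro n
    obtain ⟨k, hk⟩ := exists_nat_ge (n - s)
    refine map_mem_closure (f := fun z => u s * z) (continuous_const.mul continuous_id) (hx k) ?_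
    rintro z ⟨t, ht, γ, rfl⟩
    exact ⟨s + t, by linarith, γ, by rw [u_add]; simp only [mul_assoc]⟩
  · rw [mem_iInter] at hx ⊢
    intro n
    refine map_mem_closure (f := fun z => z * io γ) (continuous_id.mul continuous_const) (hx n) ?_
    rintro z ⟨t, ht, γ', rfl⟩
    exact ⟨t, ht, γ' * γ, by rw [map_mul]; simp only [mul_assoc]⟩

instance : LocallyCompactSpace M3 := inferInstanceAs (LocallyCompactSpace (Fin 3 → Fin 3 → ℝ))
instance : LocallyCompactSpace G :=
  (Matrix.SpecialLinearGroup.isClosedEmbedding_val (n := Fin 3) (R := ℝ)).locallyCompactSpace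
instance : T2Space G :=
  (Matrix.SpecialLinearGroup.isClosedEmbedding_val (n := Fin 3) (R := ℝ)).isEmbedding.t2Space

lemma isClosed_io : IsClosed (Set.range io) := by
  have h : IsClosedEmbedding (Matrix.SpecialLinearGroup.map (n := Fin 3) (Int.castRingHom ℝ)) :=
    IsClosedEmbedding.specialLinearGroup_map Int.isClosedEmbedding_coe_real
  exact h.isClosed_range

def Rec (Y : Set G) : Prop := ∀ y ∈ Y, ∀ y' ∈ Y, ∀ O ∈ 𝓝 y', ∀ T : ℝ, ∃ t, T ≤ t ∧ ∃ γ, u t * y * io γ ∈ O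

lemma compact_of_rec {Y : Set G} (hY : Inv Y) (hne : Y.Nonempty) (hR : Rec Y) :
    ∃ K, IsCompact K ∧ ∀ y ∈ Y, ∃ γ, y * io γ ∈ K := by
  obtain ⟨y0, hy0⟩ := hne
  obtain ⟨W, hW, hWn⟩ := exists_compact_mem_nhds y0
  have hWY : IsCompact (W ∩ Y) := hW.inter_right hY.closed
  obtain ⟨s, hs⟩ := hWY.elim_finite_subcover (fun p : {t : ℝ // 1 ≤ t} × Ga => {x | u p.1 * x * io p.2 ∈ interior W})
    (fun p => isOpen_interior.preimage ((continuous_const.mul continuous_id).mul continuous_const)) (by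
      intro x hx
      obtain ⟨t, ht, γ, h⟩ := hR x hx.2 y0 hy0 _ (interior_mem_nhds.2 hWn) 1
      exact mem_iUnion.2 ⟨(⟨t, ht⟩, γ), h⟩)
  obtain ⟨T, hT⟩ : ∃ T : ℝ, ∀ p ∈ s, (p.1 : ℝ) ≤ T := by
    obtain ⟨T, hT⟩ := (s.image (fun p => (p.1 : ℝ))).bddAbove
    exact ⟨T, fun p hp => hT (Finset.mem_coe.2 (Finset.mem_image_of_mem _ hp))⟩
  have claim : ∀ n : ℕ, ∀ t : ℝ, 0 ≤ t → t ≤ n → ∀ y ∈ W ∩ Y, ∃ s ∈ Icc (0:ℝ) (max T 1), ∃ x ∈ W, ∃ γ, u t * y = u s * x * io γ := by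
    intro n
    induction n with
    | zero =>
      intro t h0 h1 y hy
      exact ⟨t, ⟨h0, by simp at h1; exact h1.trans (zero_le_one.trans (le_max_right _ _))⟩, y, hy.1, 1, by simp⟩
    | succ n ih =>
      intro t h0 h1 y hy
      by_cases htT : t ≤ max T 1
      · exact ⟨t, ⟨h0, htT⟩, y, hy.1, 1, by simp⟩
      push Not at htT
      obtain ⟨p, hp, hpx⟩ := mem_iUnion₂.1 (hs hy)
      have hp1 := p.1.2
      have hp2 := hT p hp
      have := le_max_left T 1
      push_cast at h1
      obtain ⟨s', hs', x, hx, γ, e⟩ := ih (t - p.1) (by linarith) (by linarith) (u p.1 * y * io p.2)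
        ⟨interior_subset hpx, hY.right _ _ (hY.left _ _ hy.2)⟩
      refine ⟨s', hs', x, hx, γ * p.2⁻¹, ?_⟩
      have e2 : u t * y = u (t - p.1) * (u p.1 * y * io p.2) * (io p.2)⁻¹ := by
        have : u t = u (t - p.1) * u p.1 := by rw [← u_add]; simp
        rw [this]; group
      rw [e2, e, map_mul, map_inv]; group
  let K := (fun q : ℝ × G => u q.1 * q.2) '' (Icc (0:ℝ) (max T 1) ×ˢ W)
  have hK : IsCompact K := (isCompact_Icc.prod hW).image ((continuous_u.comp continuous_fst).mul continuous_snd)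
  have hcl : IsClosed (K * Set.range io) := isClosed_io.mul_left_of_isCompact hK
  refine ⟨K, hK, fun y hy => ?_⟩
  have hmem : y ∈ closure (K * Set.range io) := by
    rw [mem_closure_iff_nhds]
    intro O hO
    obtain ⟨t, ht, γ, h⟩ := hR y0 hy0 y hy O hO 0
    obtain ⟨n, hn⟩ := exists_nat_ge t
    obtain ⟨s', hs', x, hx, γ', e⟩ := claim n t ht hn y0 ⟨mem_of_mem_nhds hWn, hy0⟩
    refine ⟨_, h, u s' * x, ⟨(s', x), ⟨hs', hx⟩, rfl⟩, io (γ' * γ), ⟨_, rfl⟩, ?_⟩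
    simp only
    rw [e, map_mul]; group
  rw [hcl.closure_eq] at hmem
  obtain ⟨k, hk, _, ⟨γ, rfl⟩, e⟩ := hmem
  refine ⟨γ⁻¹, ?_⟩
  rw [← e]; simpa using hk

theorem exists_min {X : Set G} (hX : Inv X) (hne : X.Nonempty) :
    ∃ Y ⊆ X, Inv Y ∧ Y.Nonempty ∧ (∀ Z ⊆ Y, Inv Z → Z.Nonempty → Z = Y) ∧ Rec Y ∧
      ∃ K, IsCompact K ∧ ∀ y ∈ Y, ∃ γ, y * io γ ∈ K := by
  obtain ⟨X1, hX1, i1, n1, K, hK, hret⟩ := exists_NDX hX hne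
  obtain ⟨Y, hY1, hmin⟩ := zorn_superset_nonempty {Z | Z ⊆ X1 ∧ Inv Z ∧ Z.Nonempty} (by
    intro c hc hch hcn
    refine ⟨⋂₀ c, ⟨?_, ⟨?_, ?_, ?_⟩, ?_⟩, fun s hs => sInter_subset_of_mem hs⟩
    · obtain ⟨z, hz⟩ := hcn
      exact (sInter_subset_of_mem hz).trans (hc hz).1
    · exact isClosed_sInter fun s hs => (hc hs).2.1.closed
    · intro t x hx s hs; exact (hc hs).2.1.left _ _ (hx s hs)
    · intro t x hx s hs; exact (hc hs).2.1.right _ _ (hx s hs)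
    · have : Nonempty c := hcn.to_subtype
      have h := IsCompact.nonempty_iInter_of_directed_nonempty_isCompact_isClosed (fun s : c => (s : Set G) ∩ K)
        (by
          intro a b
          rcases hch.total a.2 b.2 with h | h
          · exact ⟨a, subset_rfl, inter_subset_inter_left _ h⟩
          · exact ⟨b, inter_subset_inter_left _ h, subset_rfl⟩)
        (by
          rintro ⟨s, hs⟩
          obtain ⟨x, hx⟩ := (hc hs).2.2
          obtain ⟨t, ht, γ, h⟩ := hret x ((hc hs).1 hx)
          exact ⟨_, (hc hs).2.1.right _ _ ((hc hs).2.1.left _ _ hx), h⟩)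
        (fun s => hK.inter_left (hc s.2).2.1.closed)
        (fun s => (hc s.2).2.1.closed.inter hK.isClosed)
      obtain ⟨x, hx⟩ := h
      rw [mem_iInter] at hx
      exact ⟨x, fun s hs => (hx ⟨s, hs⟩).1⟩) X1 ⟨subset_rfl, i1, n1⟩
  obtain ⟨⟨_, hYi, hYn⟩, hYm⟩ := hmin
  have hmin' : ∀ Z ⊆ Y, Inv Z → Z.Nonempty → Z = Y := fun Z hZ hi hn =>
    hZ.antisymm (hYm ⟨hZ.trans hY1, hi, hn⟩ hZ)
  have hRec : Rec Y := by
    intro y hy y' hy' O hO T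
    have hAY : ∀ n : ℕ, {z | ∃ t : ℝ, n ≤ t ∧ ∃ γ, u t * y * io γ = z} ⊆ Y := by
      rintro n z ⟨t, ht, γ, rfl⟩
      exact hYi.right _ _ (hYi.left _ _ hy)
    have hΩ : (⋂ n : ℕ, closure {z | ∃ t : ℝ, n ≤ t ∧ ∃ γ, u t * y * io γ = z}) = Y := by
      apply hmin' _ _ (Inv_omega hYi y)
      · have h := IsCompact.nonempty_iInter_of_sequence_nonempty_isCompact_isClosed
          (fun n : ℕ => closure {z | ∃ t : ℝ, n ≤ t ∧ ∃ γ, u t * y * io γ = z} ∩ K)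
          (by
            intro n
            refine inter_subset_inter_left _ (closure_mono ?_)
            rintro z ⟨t, ht, h⟩
            exact ⟨t, by push_cast at ht; linarith, h⟩)
          (by
            intro n
            obtain ⟨t, ht, γ, h⟩ := hret (u n * y) (hY1 (hYi.left _ _ hy))
            exact ⟨_, subset_closure ⟨t + n, by linarith, γ, by rw [u_add]; simp only [mul_assoc]⟩, h⟩)
          (hK.inter_left isClosed_closure)
          (fun n => isClosed_closure.inter hK.isClosed)
        obtain ⟨x, hx⟩ := h
        rw [mem_iInter] at hx
        exact ⟨x, mem_iInter.2 fun n => (hx n).1⟩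
      · intro x hx
        have := closure_minimal (hAY 0) hYi.closed (mem_iInter.1 hx 0)
        exact this
    rw [← hΩ, mem_iInter] at hy'
    obtain ⟨n, hn⟩ := exists_nat_ge T
    obtain ⟨z, hzO, t, ht, γ, rfl⟩ := mem_closure_iff_nhds.1 (hy' n) O hO
    exact ⟨t, hn.trans ht, γ, hzO⟩
  exact ⟨Y, hY1.trans hX1, hYi, hYn, hmin', hRec, compact_of_rec hYi hYn hRec⟩

end Opp
end

noncomputable section
namespace Opp
open Matrix Set Filter Topology

lemma mk_F {M h : M3} (hM : hᵀ * J * h = M) (hd : M.det = 1) : ∃ g : G, F g = M := by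
  have h1 : h.det * h.det = 1 := by
    have := congrArg Matrix.det hM
    rw [Matrix.det_mul, Matrix.det_mul, Matrix.det_transpose, det_J, hd] at this
    linarith
  rcases mul_self_eq_one_iff.1 h1 with h1 | h1
  · exact ⟨⟨h, h1⟩, hM⟩
  · refine ⟨⟨-h, ?_⟩, ?_⟩
    · rw [Matrix.det_neg, h1]; norm_num
    · rw [← hM]; simp [F, cg, Matrix.SpecialLinearGroup.mt]

def NP (C : M3) : Prop := C 0 0 ≤ 0 ∨ C 0 0 * C 1 1 - C 0 1 ^ 2 ≤ 0

lemma NP_closed : IsClosed {C : M3 | NP C} := by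
  have c : ∀ i j, Continuous (fun C : M3 => C i j) := fun i j => continuous_id.matrix_elem i j
  exact (isClosed_le (c 0 0) continuous_const).union
    (isClosed_le (((c 0 0).mul (c 1 1)).sub ((c 0 1).pow 2)) continuous_const)

lemma quad3 (C : M3) (w : Fin 3 → ℝ) : w ⬝ᵥ (C *ᵥ w) = C 0 0 * w 0^2 + C 1 1 * w 1^2 + C 2 2 * w 2^2
    + (C 0 1 + C 1 0) * w 0 * w 1 + (C 0 2 + C 2 0) * w 0 * w 2 + (C 1 2 + C 2 1) * w 1 * w 2 := by
  simp [dotProduct, Matrix.mulVec, Fin.sum_univ_three]; ring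

lemma sym_apply {C : M3} (h : Cᵀ = C) (i j : Fin 3) : C i j = C j i := by
  conv_lhs => rw [← h]
  rfl

lemma NP_of {C : M3} (hs : Cᵀ = C) (hd : C.det = 1) {w : Fin 3 → ℝ} (hw : w ≠ 0) (h : w ⬝ᵥ (C *ᵥ w) ≤ 0) : NP C := by
  by_contra hn
  unfold NP at hn
  push Not at hn
  obtain ⟨h1, h2⟩ := hn
  rw [quad3] at h
  rw [Matrix.det_fin_three] at hd
  rw [sym_apply hs 1 0, sym_apply hs 2 0, sym_apply hs 2 1] at h hd
  set m := C 0 0 * C 1 1 - C 0 1 ^ 2 with hm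
  set k := C 0 0 * C 1 2 - C 0 1 * C 0 2 with hk
  have id1 : m * C 0 0 * (C 0 0 * w 0^2 + C 1 1 * w 1^2 + C 2 2 * w 2^2
    + (C 0 1 + C 0 1) * w 0 * w 1 + (C 0 2 + C 0 2) * w 0 * w 2 + (C 1 2 + C 1 2) * w 1 * w 2)
    = m * (C 0 0 * w 0 + C 0 1 * w 1 + C 0 2 * w 2)^2 + (m * w 1 + k * w 2)^2 + C 0 0 * w 2 ^2 := by
    rw [← mul_one (C 0 0 * w 2 ^2), ← hd, hm, hk]; ring
  have h3 : m * C 0 0 * (C 0 0 * w 0^2 + C 1 1 * w 1^2 + C 2 2 * w 2^2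
    + (C 0 1 + C 0 1) * w 0 * w 1 + (C 0 2 + C 0 2) * w 0 * w 2 + (C 1 2 + C 1 2) * w 1 * w 2) ≤ 0 :=
    mul_nonpos_of_nonneg_of_nonpos (by positivity) h
  rw [id1] at h3
  have p1 : 0 ≤ m * (C 0 0 * w 0 + C 0 1 * w 1 + C 0 2 * w 2)^2 := by positivity
  have p2 : 0 ≤ (m * w 1 + k * w 2)^2 := by positivity
  have p3 : 0 ≤ C 0 0 * w 2 ^2 := by positivity
  have e3 : C 0 0 * w 2 ^2 = 0 := by linarith
  have w2 : w 2 = 0 := by simpa [h1.ne'] using e3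
  have e2 : (m * w 1 + k * w 2)^2 = 0 := by linarith
  have w1 : w 1 = 0 := by simpa [h2.ne', w2] using e2
  have e1 : m * (C 0 0 * w 0 + C 0 1 * w 1 + C 0 2 * w 2)^2 = 0 := by linarith
  have w0 : w 0 = 0 := by simpa [h2.ne', w2, w1, h1.ne'] using e1
  apply hw; ext i; fin_cases i <;> assumption

lemma of_NP {C : M3} (hs : Cᵀ = C) (h : NP C) : ∃ w : Fin 3 → ℝ, w ≠ 0 ∧ w ⬝ᵥ (C *ᵥ w) ≤ 0 := by
  by_cases h0 : C 0 0 ≤ 0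
  · refine ⟨![1,0,0], fun h => by simpa using congrFun h 0, ?_⟩
    rw [quad3]; simpa using h0
  · refine ⟨![-C 0 1, C 0 0, 0], fun h => by have := congrFun h 1; simp at this; linarith, ?_⟩
    have h1 := h.resolve_left h0
    rw [quad3, sym_apply hs 1 0]
    simp only [Matrix.cons_val]
    nlinarith

lemma sylvester {M : M3} (hs : Mᵀ = M) (hd : M.det = 1) (hn : NP M) : ∃ g : G, F g = M := by
  have hH : M.IsHermitian := by rw [Matrix.IsHermitian, Matrix.conjTranspose_eq_transpose_of_trivial, hs]
  obtain ⟨U, l, hU, hl⟩ : ∃ (U : M3) (l : Fin 3 → ℝ), U.det ≠ 0 ∧ M = Uᵀ * diagonal l * U := by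
    refine ⟨(hH.eigenvectorUnitary : M3)ᵀ, hH.eigenvalues, ?_, ?_⟩
    · have h := (Matrix.mem_unitaryGroup_iff).1 hH.eigenvectorUnitary.2
      intro h0
      rw [Matrix.det_transpose] at h0
      have := congrArg Matrix.det h
      rw [Matrix.det_mul, h0] at this; simp at this
    · have := hH.spectral_theorem
      rw [Unitary.conjStarAlgAut_apply] at this
      convert! this using 1
  have hprod : U.det ^ 2 * (l 0 * l 1 * l 2) = 1 := by
    rw [← hd, hl, Matrix.det_mul, Matrix.det_mul, Matrix.det_transpose, Matrix.det_diagonal, Fin.prod_univ_three]; ring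
  have hpos : 0 < l 0 * l 1 * l 2 := by
    by_contra hc
    push Not at hc
    nlinarith [sq_nonneg U.det]
  set D : M3 := diagonal fun i => Real.sqrt |l i| with hD
  -- key
  have key : ∀ (h : M3) (s : Fin 3 → ℝ), hᵀ * J * h = diagonal s → (∀ i, s i * |l i| = l i) → ∃ g : G, F g = M := by
    intro h s e hsl
    refine mk_F (h := h * D * U) ?_ hd
    have : (h * D * U)ᵀ * J * (h * D * U) = Uᵀ * (Dᵀ * (hᵀ * J * h) * D) * U := by
      simp only [Matrix.transpose_mul, Matrix.mul_assoc]
    rw [this, e, hD, Matrix.diagonal_transpose, Matrix.diagonal_mul_diagonal, Matrix.diagonal_mul_diagonal, hl]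
    congr 3
    ext i
    have := Real.mul_self_sqrt (abs_nonneg (l i))
    calc _ = s i * (√|l i| * √|l i|) := by ring
      _ = _ := by rw [this, hsl]
  have notpos : ¬ (0 < l 0 ∧ 0 < l 1 ∧ 0 < l 2) := by
    rintro ⟨h0, h1, h2⟩
    obtain ⟨w, hw, hle⟩ := of_NP hs hn
    apply hw
    apply Matrix.eq_zero_of_mulVec_eq_zero hU
    have : w ⬝ᵥ (M *ᵥ w) = l 0 * (U *ᵥ w) 0 ^2 + l 1 * (U *ᵥ w) 1 ^2 + l 2 * (U *ᵥ w) 2 ^2 := by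
      rw [hl, ← Matrix.mulVec_mulVec, ← Matrix.mulVec_mulVec, Matrix.mulVec_transpose, dotProduct_comm,
        ← Matrix.dotProduct_mulVec, dotProduct, Fin.sum_univ_three]
      simp only [Matrix.mulVec_diagonal]; ring
    rw [this] at hle
    have p0 : 0 ≤ l 0 * (U *ᵥ w) 0 ^2 := by positivity
    have p1 : 0 ≤ l 1 * (U *ᵥ w) 1 ^2 := by positivity
    have p2 : 0 ≤ l 2 * (U *ᵥ w) 2 ^2 := by positivity
    have q0 : l 0 * (U *ᵥ w) 0 ^2 = 0 := by linarith
    have q1 : l 1 * (U *ᵥ w) 1 ^2 = 0 := by linarith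
    have q2 : l 2 * (U *ᵥ w) 2 ^2 = 0 := by linarith
    ext i; fin_cases i
    · simpa [h0.ne'] using q0
    · simpa [h1.ne'] using q1
    · simpa [h2.ne'] using q2
  have pa : ∀ i, 0 < l i → (1:ℝ) * |l i| = l i := fun i h => by rw [abs_of_pos h, one_mul]
  have na : ∀ i, l i < 0 → (-1:ℝ) * |l i| = l i := fun i h => by rw [abs_of_neg h]; ring
  have ne : ∀ i, l i ≠ 0 := by
    intro i h; fin_cases i <;> simp at h <;> simp [h] at hpos
  rcases lt_or_gt_of_ne (ne 0) with a | a <;> rcases lt_or_gt_of_ne (ne 1) with b | b <;>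
    rcases lt_or_gt_of_ne (ne 2) with c | c
  · exact absurd hpos (not_lt.2 (mul_nonpos_of_nonneg_of_nonpos (mul_nonneg_of_nonpos_of_nonpos a.le b.le) c.le))
  · refine key !![1,0,1;0,1,0;-1/2,0,1/2] ![-1,-1,1] ?_ ?_
    · apply ext3 <;> simp [J, mul3] <;> norm_num
    · intro i; fin_cases i; exacts [na _ a, na _ b, pa _ c]
  · refine key !![1,1,0;0,0,1;-1/2,1/2,0] ![-1,1,-1] ?_ ?_
    · apply ext3 <;> simp [J, mul3] <;> norm_num
    · intro i; fin_cases i; exacts [na _ a, pa _ b, na _ c]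
  · exact absurd hpos (not_lt.2 (mul_nonpos_of_nonpos_of_nonneg (mul_nonpos_of_nonpos_of_nonneg a.le b.le) c.le))
  · refine key !![1,1,0;0,0,1;1/2,-1/2,0] ![1,-1,-1] ?_ ?_
    · apply ext3 <;> simp [J, mul3] <;> norm_num
    · intro i; fin_cases i; exacts [pa _ a, na _ b, na _ c]
  · exact absurd hpos (not_lt.2 (mul_nonpos_of_nonpos_of_nonneg (mul_nonpos_of_nonneg_of_nonpos a.le b.le) c.le))
  · exact absurd hpos (not_lt.2 (mul_nonpos_of_nonneg_of_nonpos (mul_nonneg a.le b.le) c.le))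
  · exact absurd ⟨a, b, c⟩ notpos

lemma cg_apply (C : M3) (g : G) (i j : Fin 3) : cg C g i j = ∑ l, ∑ k, g.mt k i * C k l * g.mt l j := by
  simp only [cg, Matrix.mul_apply, Finset.sum_mul, Matrix.transpose_apply]

def IsRat (T : M3) : Prop := ∃ c : ℝ, ∃ M : Matrix (Fin 3) (Fin 3) ℤ, ∀ i j, T i j = c * (M i j : ℝ)

lemma rat_lemma {T : M3} (hT : Tᵀ = T) (hne : T ≠ 0) (Λ : Set Ga) (hΛ : ∀ γ ∈ Λ, cg T (io γ) = T)
    (H : ∀ P : M3, Pᵀ = P → (∀ γ ∈ Λ, cg P (io γ) = P) → ∃ a : ℝ, P = a • T) : IsRat T := by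
  obtain ⟨i0, j0, h0⟩ : ∃ i j, T i j ≠ 0 := by
    by_contra hc; push Not at hc; exact hne (by ext i j; exact hc i j)
  obtain ⟨φ, hφ⟩ : ∃ φ : Module.Dual ℚ ℝ, φ (T i0 j0) ≠ 0 := by
    by_contra hc; push Not at hc
    exact h0 ((Module.forall_dual_apply_eq_zero_iff ℚ _).1 hc)
  obtain ⟨a, ha⟩ := H (Matrix.of fun i j => (φ (T i j) : ℝ)) (by
      ext i j; simp [sym_apply hT j i]) (by
      intro γ hγ
      ext i j
      have e := congrFun (congrFun (hΛ γ hγ) i) j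
      rw [cg_apply] at e ⊢
      simp only [Matrix.of_apply]
      rw [← e, map_sum]
      push_cast
      refine Finset.sum_congr rfl fun l _ => ?_
      rw [map_sum]; push_cast
      refine Finset.sum_congr rfl fun k _ => ?_
      rw [io_apply, io_apply]
      have : ((γ.mt k i : ℤ) : ℝ) * T k l * ((γ.mt l j : ℤ) : ℝ) = (γ.mt k i * γ.mt l j) • T k l := by
        rw [zsmul_eq_mul]; push_cast; ring
      rw [this, map_zsmul, zsmul_eq_mul]; push_cast; ring)
  have he : ∀ i j, (φ (T i j) : ℝ) = a * T i j := fun i j => congrFun (congrFun ha i) j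
  have ha0 : a ≠ 0 := by
    rintro rfl; have := he i0 j0; simp at this; exact hφ this
  obtain ⟨d, hd⟩ := IsLocalization.exist_integer_multiples_of_finite (nonZeroDivisors ℤ)
    (fun p : Fin 3 × Fin 3 => φ (T p.1 p.2))
  choose M hM using hd
  have hd0 : ((d : ℤ) : ℝ) ≠ 0 := by exact_mod_cast nonZeroDivisors.coe_ne_zero d
  refine ⟨a⁻¹ * ((d : ℤ) : ℝ)⁻¹, Matrix.of fun i j => M (i,j), fun i j => ?_⟩
  have h1 := hM (i,j)
  simp at h1
  have h2 : ((M (i,j) : ℤ) : ℝ) = (d : ℤ) * (φ (T i j) : ℝ) := by exact_mod_cast h1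
  rw [Matrix.of_apply, h2, he]; field_simp

lemma poly_bdd {c0 c1 c2 c3 c4 C : ℝ} (h : ∀ T : ℝ, ∃ t, T ≤ |t| ∧ |c0 + c1 * t + c2 * t^2 + c3 * t^3 + c4 * t^4| ≤ C) :
    c1 = 0 ∧ c2 = 0 ∧ c3 = 0 ∧ c4 = 0 := by
  open Polynomial in
  let p : ℝ[X] := Polynomial.C c0 + Polynomial.C c1 * X + Polynomial.C c2 * X^2 + Polynomial.C c3 * X^3 + Polynomial.C c4 * X^4
  choose t ht hb using fun n : ℕ => h n
  by_cases hp : 0 < p.degree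
  · have h1 : Tendsto (fun n => ‖t n‖) atTop atTop := tendsto_atTop_mono ht tendsto_natCast_atTop_atTop
    have h2 := p.tendsto_norm_atTop hp h1
    obtain ⟨n, hn⟩ := (h2.eventually_gt_atTop C).exists
    have := hb n
    simp only [p, Polynomial.eval_add, Polynomial.eval_mul, Polynomial.eval_C, Polynomial.eval_X, Polynomial.eval_pow, Real.norm_eq_abs] at hn
    linarith
  · push Not at hp
    have h1 := Polynomial.eq_C_of_degree_le_zero hp
    have hc : ∀ n, 0 < n → p.coeff n = 0 := fun n hn => by
      rw [h1, Polynomial.coeff_C, if_neg hn.ne']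
    have a1 := hc 1 (by norm_num)
    have a2 := hc 2 (by norm_num)
    have a3 := hc 3 (by norm_num)
    have a4 := hc 4 (by norm_num)
    simp [p, Polynomial.coeff_X, Polynomial.coeff_C, Polynomial.coeff_X_pow] at a1 a2 a3 a4
    exact ⟨a1, a2, a3, a4⟩

lemma cg_u22 {B : M3} (hB : Bᵀ = B) (t : ℝ) : cg B (u (-t)) 2 2 =
    B 2 2 + (-2 * B 1 2) * t + (B 1 1 + B 0 2) * t^2 + (- B 0 1) * t^3 + (B 0 0 / 4) * t^4 := by
  simp [cg, val_u, mul3]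
  rw [sym_apply hB 1 0, sym_apply hB 2 0, sym_apply hB 2 1]; ring

lemma poly_lemma {B : M3} (hB : Bᵀ = B) {C : ℝ} (h : ∀ T : ℝ, ∃ t, T ≤ |t| ∧ |cg B (u (-t)) 2 2| ≤ C) :
    ∃ a b : ℝ, B = a • J + b • E33 := by
  simp only [cg_u22 hB] at h
  obtain ⟨h1, h2, h3, h4⟩ := poly_bdd h
  refine ⟨B 0 2, B 2 2, ?_⟩
  apply ext3 <;> simp [J, E33] <;> (try rw [sym_apply hB 1 0]) <;> (try rw [sym_apply hB 2 0]) <;> (try rw [sym_apply hB 2 1]) <;> linarith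

end Opp
end

noncomputable section
namespace Opp
open Matrix Set Filter Topology

structure Hyp (S : M3) : Prop where
  sym : Sᵀ = S
  det : S.det = 1
  np : ∃ w : Fin 3 → ℝ, w ≠ 0 ∧ w ⬝ᵥ (S *ᵥ w) ≤ 0
  nr : ¬ IsRat S

def Orb (S : M3) : Set M3 := Set.range fun γ => cg S (io γ)

lemma IsRat_cg {S : M3} (γ : Ga) (h : IsRat (cg S (io γ))) : IsRat S := by
  obtain ⟨c, M, hM⟩ := h
  refine ⟨c, ((γ⁻¹).mt)ᵀ * M * (γ⁻¹).mt, fun i j => ?_⟩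
  have e : S = cg (cg S (io γ)) (io γ⁻¹) := by rw [map_inv, cg_inv]
  conv_lhs => rw [e]
  rw [cg_apply]
  simp only [Matrix.mul_apply, Finset.sum_mul, Matrix.transpose_apply]
  push_cast
  rw [Finset.mul_sum]
  refine Finset.sum_congr rfl fun l _ => ?_
  rw [Finset.mul_sum]
  refine Finset.sum_congr rfl fun k _ => ?_
  rw [hM, io_apply, io_apply]; ring

lemma Hyp.cg {S : M3} (h : Hyp S) (γ : Ga) : Hyp (cg S (io γ)) := by
  refine ⟨cg_symm h.sym _, by rw [det_cg, h.det], ?_, fun hr => h.nr (IsRat_cg γ hr)⟩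
  obtain ⟨w, hw, hle⟩ := h.np
  refine ⟨((io γ)⁻¹).mt *ᵥ w, fun h0 => hw (mulVec_inj ((io γ)⁻¹) (by rw [h0, Matrix.mulVec_zero])), ?_⟩
  have e : (Opp.cg S (io γ)) *ᵥ (((io γ)⁻¹).mt *ᵥ w) = (io γ).mtᵀ *ᵥ (S *ᵥ w) := by
    rw [Opp.cg, Matrix.mulVec_mulVec, Matrix.mul_assoc, ← val_mul]
    simp [val_one, Matrix.mulVec_mulVec]
  rw [e, Matrix.mulVec_transpose, dotProduct_comm, ← Matrix.dotProduct_mulVec, Matrix.mulVec_mulVec, ← val_mul]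
  simp only [mul_inv_cancel, val_one, Matrix.one_mulVec]
  rw [dotProduct_comm]; exact hle

lemma Hyp.exF {S : M3} (h : Hyp S) : ∃ g, F g = S := by
  obtain ⟨w, hw, hle⟩ := h.np
  exact sylvester h.sym h.det (NP_of h.sym h.det hw hle)

lemma closure_exF {S : M3} (h : Hyp S) {C : M3} (hC : C ∈ closure (Orb S)) : ∃ g, F g = C := by
  have cl : IsClosed {C : M3 | Cᵀ = C ∧ C.det = 1 ∧ NP C} :=
    (isClosed_eq (continuous_id.matrix_transpose) continuous_id).inter
      ((isClosed_eq continuous_id.matrix_det continuous_const).inter NP_closed)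
  have hs : Orb S ⊆ {C : M3 | Cᵀ = C ∧ C.det = 1 ∧ NP C} := by
    rintro _ ⟨γ, rfl⟩
    have h' := h.cg γ
    obtain ⟨w, hw, hle⟩ := h'.np
    exact ⟨h'.sym, h'.det, NP_of h'.sym h'.det hw hle⟩
  obtain ⟨h1, h2, h3⟩ := closure_minimal hs cl hC
  exact sylvester h1 h2 h3

lemma Orb_inv {S C : M3} (h : C ∈ Orb S) (γ : Ga) : cg C (io γ) ∈ Orb S := by
  obtain ⟨γ', rfl⟩ := h
  exact ⟨γ' * γ, by simp only; rw [map_mul, cg_mul]⟩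

lemma closure_inv {S C : M3} (h : C ∈ closure (Orb S)) (γ : Ga) : cg C (io γ) ∈ closure (Orb S) :=
  map_mem_closure (f := fun C => cg C (io γ)) (continuous_cg_left (io γ)) h fun _ hx => Orb_inv hx γ

lemma derived_inv {S C : M3} (h : C ∈ derivedSet (Orb S)) (γ : Ga) : cg C (io γ) ∈ derivedSet (Orb S) := by
  rw [mem_derivedSet, accPt_iff_frequently_nhdsNE] at h ⊢
  have ht : Tendsto (fun C => cg C (io γ)) (𝓝[≠] C) (𝓝[≠] (cg C (io γ))) := by
    refine tendsto_nhdsWithin_iff.2 ⟨((continuous_cg_left (io γ)).tendsto C).mono_left nhdsWithin_le_nhds, ?_⟩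
    filter_upwards [self_mem_nhdsWithin] with D hD e
    exact hD (cg_inj _ e)
  exact ht.frequently (h.mono fun D hD => Orb_inv hD γ)

lemma exists_AA_pt (g : G) : ∃ ρ, 0 < ρ ∧ ∀ t, AA ρ (u t * g) := by
  suffices H : ∃ ρ, 0 < ρ ∧ AA ρ g by
    obtain ⟨ρ, hρ, h⟩ := H
    refine ⟨ρ, hρ, fun t m hm c hc => h m hm c ?_⟩
    rw [act_u] at hc
    have h2 : act g m 2 = 0 := by simpa using congrFun hc 2
    have h1 : act g m 1 = 0 := by simpa [h2] using congrFun hc 1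
    have h0 : act g m 0 = c := by simpa [h2, h1] using congrFun hc 0
    ext i; fin_cases i <;> simpa
  by_cases H : ∃ m, Prim m ∧ ∃ c : ℝ, act g m = ![c,0,0]
  · obtain ⟨m, hm, c, hc⟩ := H
    refine ⟨|c|, ?_, fun m' hm' c' hc' => (AA_unique hm hm' hc hc').le⟩
    rw [abs_pos]
    rintro rfl
    apply act_ne g hm.ne
    rw [hc]; ext i; fin_cases i <;> rfl
  · exact ⟨1, one_pos, fun m hm c hc => (H ⟨m, hm, c, hc⟩).elim⟩

lemma returns (g : G) : ∃ K, IsCompact K ∧ ∀ i : ℕ, ∃ t : ℝ, i ≤ t ∧ ∃ γ, u t * g * io γ ∈ K := by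
  obtain ⟨ρ1, p1, h1⟩ := exists_AA_pt g
  obtain ⟨ρ2, p2, h2⟩ := exists_AA_pt (star g)
  obtain ⟨K, hK, hKn⟩ := NDM (lt_min (lt_min p1 p2) one_pos) (min_le_right (min ρ1 ρ2) 1)
  refine ⟨K, hK, fun i => ?_⟩
  obtain ⟨t, ht, γ, h⟩ := hKn (u i * g) ((h1 _).mono ((min_le_left _ _).trans (min_le_left _ _)))
    (by rw [star_mul', star_u]; exact (h2 _).mono ((min_le_left _ _).trans (min_le_right _ _)))
  exact ⟨t + i, by linarith, γ, by rw [u_add]; simpa only [mul_assoc] using h⟩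

lemma bdd_cg {K : Set G} (hK : IsCompact K) (P : M3) : ∃ C, ∀ k ∈ K, |cg P k⁻¹ 2 2| ≤ C := by
  have hc : Continuous (fun k : G => cg P k⁻¹ 2 2) := ((continuous_cg_right P).comp continuous_inv).matrix_elem 2 2
  exact hK.exists_bound_of_continuousOn hc.continuousOn

lemma fixed_of_discrete {S : M3} (hD : derivedSet (Orb S) = ∅) {g : G} (hg : F g = S) {P : M3} (hP : Pᵀ = P)
    (hinv : ∀ γ, cg S (io γ) = S → cg P (io γ) = P) : ∃ a b : ℝ, cg P g⁻¹ = a • J + b • E33 := by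
  obtain ⟨K, hK, hret⟩ := returns g
  choose t ht γ hγ using hret
  have hfin : (Orb S ∩ F '' K).Finite := by
    by_contra hc
    have hinf : (Orb S ∩ F '' K).Infinite := hc
    obtain ⟨x, hx, hacc⟩ := hinf.exists_accPt_of_subset_isCompact (hK.image continuous_F) inter_subset_right
    have : x ∈ derivedSet (Orb S) := hacc.mono (principal_mono.2 inter_subset_left)
    rw [hD] at this; exact this
  have hmem : ∀ i, cg S (io (γ i)) ∈ Orb S ∩ F '' K := by
    intro i
    refine ⟨⟨γ i, rfl⟩, _, hγ i, ?_⟩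
    rw [mul_assoc, F_u, F_mul, hg]
  have : Finite ↥(Orb S ∩ F '' K) := hfin
  obtain ⟨C0, hC0⟩ := Finite.exists_infinite_fiber (fun i => (⟨_, hmem i⟩ : ↥(Orb S ∩ F '' K)))
  have hinf : {i | cg S (io (γ i)) = C0}.Infinite := by
    rw [Set.infinite_coe_iff] at hC0
    convert hC0 using 1
    ext i; simp [Subtype.ext_iff]
  obtain ⟨i0, hi0⟩ := hinf.nonempty
  obtain ⟨C, hC⟩ := bdd_cg hK (cg P (io (γ i0)))
  refine poly_lemma (cg_symm hP _) (C := C) fun T => ?_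
  obtain ⟨n, hn⟩ := exists_nat_ge T
  obtain ⟨i, hi, hin⟩ := hinf.exists_gt n
  refine ⟨t i, ?_, ?_⟩
  · have : (n : ℝ) ≤ i := by exact_mod_cast hin.le
    have := ht i
    exact le_trans (by linarith) (le_abs_self _)
  · have e1 : cg P (io (γ i)) = cg P (io (γ i0)) := by
      have : cg P (io (γ i * (γ i0)⁻¹)) = P := by
        apply hinv
        rw [map_mul, cg_mul, hi, ← hi0, map_inv, cg_inv]
      rw [map_mul, map_inv, cg_mul] at this
      have := congrArg (fun X => cg X (io (γ i0))) this
      simpa only [cg_inv'] using this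
    have e2 : cg (cg P g⁻¹) (u (-t i)) = cg (cg P (io (γ i0))) (u (t i) * g * io (γ i))⁻¹ := by
      rw [← e1, ← cg_mul, ← cg_mul, u_neg]; congr 1; group
    rw [e2]; exact hC _ (hγ i)

lemma cg_J_JG : cg J JG = J := by
  apply ext3 <;> simp [cg, val_JG, J, mul3]
lemma F_JG (g : G) : F (JG * g) = F g := by rw [F, cg_mul, cg_J_JG]; rfl

lemma derived_nonempty {S : M3} (h : Hyp S) : (derivedSet (Orb S)).Nonempty := by
  by_contra hc
  rw [Set.not_nonempty_iff_eq_empty] at hc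
  obtain ⟨g, hg⟩ := h.exF
  have hne : S ≠ 0 := by
    intro h0; have := h.det; rw [h0] at this; simp at this
  refine h.nr (rat_lemma h.sym hne {γ | cg S (io γ) = S} (fun γ hγ => hγ) fun P hP hinv => ?_)
  obtain ⟨a, b, hab⟩ := fixed_of_discrete hc hg hP hinv
  obtain ⟨a', b', hab'⟩ := fixed_of_discrete hc (g := JG * g) (by rw [F_JG, hg]) hP hinv
  have e : cg (a' • J + b' • E33) JG = a • J + b • E33 := by
    rw [← hab', ← hab, ← cg_mul]; congr 1; rw [_root_.mul_inv_rev]; group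
  have hb : b = 0 := by
    have := congrFun (congrFun e 2) 2
    simp [cg, val_JG, J, E33, mul3] at this
    linarith
  refine ⟨a, ?_⟩
  rw [hb, zero_smul, add_zero] at hab
  have := congrArg (fun X => cg X g) hab
  simp only [cg_inv', cg_smul] at this
  rw [this, ← hg]; rfl

/-- data of a minimal set -/
structure MinSet (S : M3) (Y : Set G) (K : Set G) : Prop where
  inv : Inv Y
  ne : Y.Nonempty
  mem : ∀ y ∈ Y, F y ∈ derivedSet (Orb S)
  min : ∀ Z ⊆ Y, Inv Z → Z.Nonempty → Z = Y
  recc : Rec Y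
  comp : IsCompact K
  cov : ∀ y ∈ Y, ∃ γ, y * io γ ∈ K

lemma exists_minset {S : M3} (h : Hyp S) : ∃ Y K, MinSet S Y K := by
  have hcl : IsClosed (derivedSet (Orb S)) := isClosed_derivedSet _
  have hi : Inv {g | F g ∈ derivedSet (Orb S)} := by
    refine ⟨hcl.preimage continuous_F, fun t x hx => ?_, fun γ x hx => ?_⟩
    · rw [mem_setOf_eq, F_u]; exact hx
    · rw [mem_setOf_eq, F_mul]; exact derived_inv hx γ
  obtain ⟨C, hC⟩ := derived_nonempty h
  obtain ⟨g, hg⟩ := closure_exF h (derivedSet_subset_closure _ hC)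
  obtain ⟨Y, h1, h2, h3, h4, h5, K, h6, h7⟩ := exists_min hi ⟨g, by rw [mem_setOf_eq, hg]; exact hC⟩
  exact ⟨Y, K, h2, h3, h1, h4, h5, h6, h7⟩

def RR (S : M3) (Y : Set G) : Set ℝ := {s | ∀ y ∈ Y, F y + s • E y ∈ closure (Orb S)}

lemma RR_closed (S : M3) (Y : Set G) : IsClosed (RR S Y) := by
  have : RR S Y = ⋂ y ∈ Y, {s : ℝ | F y + s • E y ∈ closure (Orb S)} := by
    ext s; simp [RR]
  rw [this]
  refine isClosed_biInter fun y _ => isClosed_closure.preimage ?_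
  exact continuous_const.add (continuous_id.smul continuous_const)

lemma RR_zero {S : M3} {Y K : Set G} (h : MinSet S Y K) : (0:ℝ) ∈ RR S Y := by
  intro y hy
  rw [zero_smul, add_zero]
  exact derivedSet_subset_closure _ (h.mem y hy)

lemma RR_of_one {S : M3} {Y K : Set G} (h : MinSet S Y K) {s : ℝ} {y : G} (hy : y ∈ Y)
    (hs : F y + s • E y ∈ closure (Orb S)) : s ∈ RR S Y := by
  have hc : Continuous (fun x : G => F x + s • E x) := continuous_F.add (continuous_E.const_smul s)
  have hi : Inv (Y ∩ {x | F x + s • E x ∈ closure (Orb S)}) := by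
    refine ⟨h.inv.closed.inter (isClosed_closure.preimage hc), ?_, ?_⟩
    · rintro t x ⟨hx, hx'⟩
      refine ⟨h.inv.left t x hx, ?_⟩
      rw [mem_setOf_eq, F_u, E_u]; exact hx'
    · rintro γ x ⟨hx, hx'⟩
      refine ⟨h.inv.right γ x hx, ?_⟩
      rw [mem_setOf_eq, F_mul, E_mul, ← cg_smul, ← cg_add]; exact closure_inv hx' γ
  have := h.min _ inter_subset_left hi ⟨y, hy, hs⟩
  intro z hz
  rw [← this] at hz
  exact hz.2

end Opp
end

noncomputable section
namespace Opp
open Matrix Set Filter Topology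

lemma coef_zero {B : M3} (hB : Bᵀ = B) (h1 : -2 * B 1 2 = 0) (h2 : B 1 1 + B 0 2 = 0) (h3 : - B 0 1 = 0)
    (h4 : B 0 0 / 4 = 0) : B = B 0 2 • J + B 2 2 • E33 := by
  apply ext3 <;> simp [J, E33] <;> (try rw [sym_apply hB 1 0]) <;> (try rw [sym_apply hB 2 0]) <;> (try rw [sym_apply hB 2 1]) <;> linarith

lemma exT (k1 k2 k3 k4 : ℝ) : ∃ T : ℝ, 0 ≤ T ∧ (¬ (k1 = 0 ∧ k2 = 0 ∧ k3 = 0 ∧ k4 = 0) →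
    |k1| * T + |k2| * T^2 + |k3| * T^3 + |k4| * T^4 = 1) := by
  by_cases h : k1 = 0 ∧ k2 = 0 ∧ k3 = 0 ∧ k4 = 0
  · exact ⟨0, le_rfl, fun h' => (h' h).elim⟩
  set m := |k1| + |k2| + |k3| + |k4| with hm
  have a1 := abs_nonneg k1
  have a2 := abs_nonneg k2
  have a3 := abs_nonneg k3
  have a4 := abs_nonneg k4
  have hpos : 0 < m := by
    rcases lt_or_eq_of_le (show 0 ≤ m by positivity) with h' | h'
    · exact h'
    · exfalso; apply h
      refine ⟨abs_eq_zero.1 ?_, abs_eq_zero.1 ?_, abs_eq_zero.1 ?_, abs_eq_zero.1 ?_⟩ <;> linarith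
  set T0 := max 1 (1/m) with hT0
  have h1 : 1 ≤ T0 := le_max_left _ _
  have h2 : 1 ≤ m * T0 := by
    have := le_max_right 1 (1/m)
    calc 1 = m * (1/m) := by field_simp
      _ ≤ _ := mul_le_mul_of_nonneg_left this hpos.le
  have hc : Continuous (fun T : ℝ => |k1| * T + |k2| * T^2 + |k3| * T^3 + |k4| * T^4) := by fun_prop
  have := intermediate_value_Icc (by linarith : (0:ℝ) ≤ T0) hc.continuousOn
  obtain ⟨T, hT, e⟩ := this (show (1:ℝ) ∈ _ by
    refine ⟨by simp, ?_⟩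
    have b2 : T0 ≤ T0^2 := by nlinarith
    have b3 : T0 ≤ T0^3 := by nlinarith
    have b4 : T0 ≤ T0^4 := by nlinarith
    have := mul_le_mul_of_nonneg_left b2 a2
    have := mul_le_mul_of_nonneg_left b3 a3
    have := mul_le_mul_of_nonneg_left b4 a4
    rw [hm] at h2
    linarith)
  exact ⟨T, hT.1, fun _ => e⟩

lemma cg_u_scaled {B : M3} (hB : Bᵀ = B) {c1 c2 c3 c4 r T τ : ℝ} (hr : r * T = 1)
    (h1 : c1 = -2 * B 1 2 * T) (h2 : c2 = (B 1 1 + B 0 2) * T^2) (h3 : c3 = - B 0 1 * T^3) (h4 : c4 = B 0 0 / 4 * T^4) :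
    cg B (u (-(T * τ))) = !![B 0 0, B 0 1 - 4 * c4 * r^3 * τ, B 0 2 + c3 * r^2 * τ + 2 * c4 * r^2 * τ^2;
      B 0 1 - 4 * c4 * r^3 * τ, B 1 1 + 2 * c3 * r^2 * τ + 4 * c4 * r^2 * τ^2, -(c1 + 2*c2*τ + 3*c3*τ^2 + 4*c4*τ^3) * r / 2;
      B 0 2 + c3 * r^2 * τ + 2 * c4 * r^2 * τ^2, -(c1 + 2*c2*τ + 3*c3*τ^2 + 4*c4*τ^3) * r / 2,
      B 2 2 + c1 * τ + c2 * τ^2 + c3 * τ^3 + c4 * τ^4] := by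
  have e1 : -2 * B 1 2 = c1 * r := by rw [h1]; linear_combination (2 * B 1 2) * hr
  have hr0 : r ≠ 0 := by rintro rfl; simp at hr
  have hT : T = r⁻¹ := (inv_eq_of_mul_eq_one_right hr).symm
  subst hT
  rw [h1, h2, h3, h4]
  apply ext3 <;> simp [cg, val_u, mul3] <;> (try rw [sym_apply hB 1 0]) <;> (try rw [sym_apply hB 2 0]) <;>
    (try rw [sym_apply hB 2 1]) <;> (try field_simp) <;> (try ring)

lemma tendsto_M3 {α : Type*} {l : Filter α} {f : α → M3} {A : M3}
    (h : ∀ i j, Tendsto (fun x => f x i j) l (𝓝 (A i j))) : Tendsto f l (𝓝 A) :=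
  tendsto_pi_nhds.2 fun i => tendsto_pi_nhds.2 fun j => h i j

lemma Orb_sym {S C : M3} (h : Hyp S) (hC : C ∈ Orb S) : Cᵀ = C := by
  obtain ⟨γ, rfl⟩ := hC; exact (h.cg γ).sym
lemma Orb_det {S C : M3} (h : Hyp S) (hC : C ∈ Orb S) : C.det = 1 := by
  obtain ⟨γ, rfl⟩ := hC; exact (h.cg γ).det

lemma ultra_bdd {α : Type*} (U : Ultrafilter α) (f : α → ℝ) (h : ∀ᶠ x in (U : Filter α), |f x| ≤ 1) :
    ∃ c, Tendsto f U (𝓝 c) := by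
  have : ((U.map f : Ultrafilter ℝ) : Filter ℝ) ≤ 𝓟 (Icc (-1) 1) := by
    rw [le_principal_iff]
    exact h.mono fun x hx => abs_le.1 hx
  obtain ⟨c, _, hc⟩ := isCompact_Icc.ultrafilter_le_nhds (U.map f) this
  exact ⟨c, hc⟩

theorem nonexc {S : M3} {Y K : Set G} (hS : Hyp S) (h : MinSet S Y K) {y : G} (hy : y ∈ Y)
    (hf : ∃ᶠ C in 𝓝 (F y), C ∈ Orb S ∧ ∀ σ : ℝ, C ≠ F y + σ • E y) :
    ∃ p q : ℝ, p < q ∧ Icc p q ⊆ RR S Y := by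
  obtain ⟨U, hU, hUm⟩ : ∃ U : Ultrafilter M3, (U : Filter M3) ≤ 𝓝 (F y) ∧ {C | C ∈ Orb S ∧ ∀ σ : ℝ, C ≠ F y + σ • E y} ∈ (U : Filter M3) := by
    have : (𝓝 (F y) ⊓ 𝓟 {C | C ∈ Orb S ∧ ∀ σ : ℝ, C ≠ F y + σ • E y}).NeBot := frequently_mem_iff_neBot.1 hf
    obtain ⟨U, hU⟩ := Ultrafilter.exists_le (𝓝 (F y) ⊓ 𝓟 {C | C ∈ Orb S ∧ ∀ σ : ℝ, C ≠ F y + σ • E y})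
    exact ⟨U, hU.trans inf_le_left, le_principal_iff.1 (hU.trans inf_le_right)⟩
  set B : M3 → M3 := fun C => cg C y⁻¹ - J with hBdef
  have hB0 : Tendsto B U (𝓝 0) := by
    have : Continuous B := (continuous_cg_left _).sub continuous_const
    have h1 := (this.tendsto (F y)).mono_left hU
    have h2 : B (F y) = 0 := by simp only [hBdef, F, cg_inv, sub_self]
    rwa [h2] at h1
  have hBe : ∀ i j, Tendsto (fun C => B C i j) U (𝓝 0) := fun i j =>
    ((continuous_id.matrix_elem i j).tendsto (0 : M3)).comp hB0
  choose! T hT0 hT1 using fun C : M3 => exT (-2 * B C 1 2) (B C 1 1 + B C 0 2) (- B C 0 1) (B C 0 0 / 4)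
  have hCB : ∀ C, C = cg (J + B C) y := by
    intro C; simp only [hBdef]; rw [add_sub_cancel, cg_inv']
  have hgood : ∀ᶠ C in (U : Filter M3), (B C)ᵀ = B C ∧ C ∈ Orb S ∧
      |-2 * B C 1 2| * T C + |B C 1 1 + B C 0 2| * T C^2 + |- B C 0 1| * T C^3 + |B C 0 0 / 4| * T C^4 = 1 := by
    refine Filter.mem_of_superset hUm ?_
    rintro C ⟨hC, hne⟩
    have hs : (B C)ᵀ = B C := by
      simp only [hBdef, Matrix.transpose_sub, J_symm, cg_symm (Orb_sym hS hC)]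
    refine ⟨hs, hC, hT1 C ?_⟩
    rintro ⟨h1, h2, h3, h4⟩
    have e := coef_zero hs h1 h2 h3 h4
    have e2 := hCB C
    have hd := Orb_det hS hC
    rw [e2, det_cg, e, Matrix.det_fin_three] at hd
    simp [J, E33] at hd
    have hb : B C 0 2 = 0 := by
      have : (1 + B C 0 2)^3 = 1 := by linear_combination hd
      have h3 : (B C 0 2) * ((B C 0 2 + 3/2)^2 + 3/4) = 0 := by linear_combination this
      rcases mul_eq_zero.1 h3 with h | h
      · exact h
      · nlinarith [sq_nonneg (B C 0 2 + 3/2)]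
    apply hne (B C 2 2)
    conv_lhs => rw [e2, e, hb, zero_smul, zero_add, cg_add, cg_smul]
    rfl
  -- T → ∞
  set m : M3 → ℝ := fun C => |-2 * B C 1 2| + |B C 1 1 + B C 0 2| + |- B C 0 1| + |B C 0 0 / 4| with hmdef
  have hm0 : Tendsto m U (𝓝 0) := by
    have := (((((hBe 1 2).const_mul (-2)).abs).add ((hBe 1 1).add (hBe 0 2)).abs).add (hBe 0 1).neg.abs).add ((hBe 0 0).div_const 4).abs
    simpa [hmdef] using this
  have hTinf : Tendsto T U atTop := by
    rw [tendsto_atTop]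
    intro N
    set N' := max N 1
    have hN1 : 1 ≤ N' := le_max_right _ _
    have hlt : ∀ᶠ C in (U : Filter M3), m C < 1 / N'^4 := hm0.eventually_lt_const (by positivity)
    filter_upwards [hgood, hlt] with C hC hC2
    by_contra hcon
    push Not at hcon
    have hle : T C ≤ N' := hcon.le.trans (le_max_left _ _)
    have h0 := hT0 C
    have b1 : T C ≤ N'^4 := hle.trans (by nlinarith [pow_le_pow_right₀ hN1 (show 1 ≤ 4 by norm_num)])
    have b2 : T C^2 ≤ N'^4 := (pow_le_pow_left₀ h0 hle 2).trans (pow_le_pow_right₀ hN1 (by norm_num))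
    have b3 : T C^3 ≤ N'^4 := (pow_le_pow_left₀ h0 hle 3).trans (pow_le_pow_right₀ hN1 (by norm_num))
    have b4 : T C^4 ≤ N'^4 := (pow_le_pow_left₀ h0 hle 4)
    have hm1 : m C * N'^4 < 1 := by rwa [lt_div_iff₀ (by positivity)] at hC2
    have := mul_le_mul_of_nonneg_left b1 (abs_nonneg (-2 * B C 1 2))
    have := mul_le_mul_of_nonneg_left b2 (abs_nonneg (B C 1 1 + B C 0 2))
    have := mul_le_mul_of_nonneg_left b3 (abs_nonneg (- B C 0 1))
    have := mul_le_mul_of_nonneg_left b4 (abs_nonneg (B C 0 0 / 4))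
    have := hC.2.2
    simp only [hmdef] at hm1
    linarith
  have hr0 : Tendsto (fun C => (T C)⁻¹) U (𝓝 0) := tendsto_inv_atTop_zero.comp hTinf
  have hab : ∀ C, ∀ k : ℝ, ∀ i : ℕ, |k * T C^i| = |k| * T C^i := fun C k i => by
    rw [abs_mul, abs_of_nonneg (pow_nonneg (hT0 C) i)]
  have nn : ∀ C, ∀ k : ℝ, ∀ i : ℕ, 0 ≤ |k| * T C^i := fun C k i => mul_nonneg (abs_nonneg _) (pow_nonneg (hT0 C) i)
  obtain ⟨c1, hc1⟩ := ultra_bdd U (fun C => -2 * B C 1 2 * T C) (hgood.mono fun C hC => by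
    have := hab C (-2 * B C 1 2) 1
    rw [pow_one] at this
    rw [this]
    linarith [hC.2.2, nn C (B C 1 1 + B C 0 2) 2, nn C (- B C 0 1) 3, nn C (B C 0 0 / 4) 4])
  obtain ⟨c2, hc2⟩ := ultra_bdd U (fun C => (B C 1 1 + B C 0 2) * T C^2) (hgood.mono fun C hC => by
    rw [hab]
    have := nn C (-2 * B C 1 2) 1
    rw [pow_one] at this
    linarith [hC.2.2, nn C (- B C 0 1) 3, nn C (B C 0 0 / 4) 4])
  obtain ⟨c3, hc3⟩ := ultra_bdd U (fun C => (- B C 0 1) * T C^3) (hgood.mono fun C hC => by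
    rw [hab]
    have := nn C (-2 * B C 1 2) 1
    rw [pow_one] at this
    linarith [hC.2.2, nn C (B C 1 1 + B C 0 2) 2, nn C (B C 0 0 / 4) 4])
  obtain ⟨c4, hc4⟩ := ultra_bdd U (fun C => (B C 0 0 / 4) * T C^4) (hgood.mono fun C hC => by
    rw [hab]
    have := nn C (-2 * B C 1 2) 1
    rw [pow_one] at this
    linarith [hC.2.2, nn C (B C 1 1 + B C 0 2) 2, nn C (- B C 0 1) 3])
  have hsum : |c1| + |c2| + |c3| + |c4| = 1 := by
    have h1 := ((hc1.abs.add hc2.abs).add hc3.abs).add hc4.abs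
    refine tendsto_nhds_unique h1 (tendsto_const_nhds.congr' ?_)
    filter_upwards [hgood] with C hC
    have := hab C (-2 * B C 1 2) 1
    rw [pow_one] at this
    rw [hab, hab, hab, this, hC.2.2]
  set s : ℝ → ℝ := fun τ => c1 * τ + c2 * τ^2 + c3 * τ^3 + c4 * τ^4 with hs
  have main : ∀ τ, s τ ∈ RR S Y := by
    intro τ
    have hlim : Tendsto (fun C => cg (B C) (u (-(T C * τ)))) U (𝓝 (s τ • E33)) := by
      have hl : Tendsto (fun C => (!![B C 0 0, B C 0 1 - 4 * (B C 0 0 / 4 * T C^4) * (T C)⁻¹^3 * τ, B C 0 2 + (- B C 0 1 * T C^3) * (T C)⁻¹^2 * τ + 2 * (B C 0 0 / 4 * T C^4) * (T C)⁻¹^2 * τ^2;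
      B C 0 1 - 4 * (B C 0 0 / 4 * T C^4) * (T C)⁻¹^3 * τ, B C 1 1 + 2 * (- B C 0 1 * T C^3) * (T C)⁻¹^2 * τ + 4 * (B C 0 0 / 4 * T C^4) * (T C)⁻¹^2 * τ^2, -((-2 * B C 1 2 * T C) + 2*((B C 1 1 + B C 0 2) * T C^2)*τ + 3*(- B C 0 1 * T C^3)*τ^2 + 4*(B C 0 0 / 4 * T C^4)*τ^3) * (T C)⁻¹ / 2;
      B C 0 2 + (- B C 0 1 * T C^3) * (T C)⁻¹^2 * τ + 2 * (B C 0 0 / 4 * T C^4) * (T C)⁻¹^2 * τ^2, -((-2 * B C 1 2 * T C) + 2*((B C 1 1 + B C 0 2) * T C^2)*τ + 3*(- B C 0 1 * T C^3)*τ^2 + 4*(B C 0 0 / 4 * T C^4)*τ^3) * (T C)⁻¹ / 2,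
      B C 2 2 + (-2 * B C 1 2 * T C) * τ + ((B C 1 1 + B C 0 2) * T C^2) * τ^2 + (- B C 0 1 * T C^3) * τ^3 + (B C 0 0 / 4 * T C^4) * τ^4] : M3)) U (𝓝 (s τ • E33)) := by
        have l01 : Tendsto (fun C => B C 0 1 - 4 * (B C 0 0 / 4 * T C^4) * (T C)⁻¹^3 * τ) U (𝓝 0) := by
          simpa using (hBe 0 1).sub (((hc4.const_mul 4).mul (hr0.pow 3)).mul_const τ)
        have l02 : Tendsto (fun C => B C 0 2 + (- B C 0 1 * T C^3) * (T C)⁻¹^2 * τ + 2 * (B C 0 0 / 4 * T C^4) * (T C)⁻¹^2 * τ^2) U (𝓝 0) := by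
          simpa using ((hBe 0 2).add ((hc3.mul (hr0.pow 2)).mul_const τ)).add (((hc4.const_mul 2).mul (hr0.pow 2)).mul_const (τ^2))
        have l11 : Tendsto (fun C => B C 1 1 + 2 * (- B C 0 1 * T C^3) * (T C)⁻¹^2 * τ + 4 * (B C 0 0 / 4 * T C^4) * (T C)⁻¹^2 * τ^2) U (𝓝 0) := by
          simpa using ((hBe 1 1).add (((hc3.const_mul 2).mul (hr0.pow 2)).mul_const τ)).add (((hc4.const_mul 4).mul (hr0.pow 2)).mul_const (τ^2))
        have l12 : Tendsto (fun C => -((-2 * B C 1 2 * T C) + 2*((B C 1 1 + B C 0 2) * T C^2)*τ + 3*(- B C 0 1 * T C^3)*τ^2 + 4*(B C 0 0 / 4 * T C^4)*τ^3) * (T C)⁻¹ / 2) U (𝓝 0) := by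
          have := ((((hc1.add ((hc2.const_mul 2).mul_const τ)).add ((hc3.const_mul 3).mul_const (τ^2))).add ((hc4.const_mul 4).mul_const (τ^3))).neg.mul hr0).div_const 2
          rw [mul_zero, zero_div] at this
          exact this
        have l22 : Tendsto (fun C => B C 2 2 + (-2 * B C 1 2 * T C) * τ + ((B C 1 1 + B C 0 2) * T C^2) * τ^2 + (- B C 0 1 * T C^3) * τ^3 + (B C 0 0 / 4 * T C^4) * τ^4) U (𝓝 (s τ)) := by
          have := ((((hBe 2 2).add (hc1.mul_const τ)).add (hc2.mul_const (τ^2))).add (hc3.mul_const (τ^3))).add (hc4.mul_const (τ^4))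
          rw [zero_add] at this
          exact this
        have hE : s τ • E33 = !![0,0,0;0,0,0;0,0,s τ] := by
          apply ext3 <;> simp [E33]
        rw [hE]
        refine tendsto_M3 fun i j => ?_
        fin_cases i <;> fin_cases j
        exacts [hBe 0 0, l01, l02, l01, l11, l12, l02, l12, l22]
      refine hl.congr' ?_
      filter_upwards [hgood, hTinf.eventually_gt_atTop 0] with C hC hTp
      exact (cg_u_scaled hC.1 (inv_mul_cancel₀ hTp.ne') rfl rfl rfl rfl).symm
    choose γ hγ using fun C => h.cov (u (T C * τ) * y) (h.inv.left _ _ hy)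
    obtain ⟨k, hk, hkl⟩ := h.comp.ultrafilter_le_nhds (U.map fun C => u (T C * τ) * y * io (γ C))
      (by rw [le_principal_iff]; exact (Filter.univ_mem' hγ : _ ∈ (U : Filter M3)))
    have hkt : Tendsto (fun C => u (T C * τ) * y * io (γ C)) U (𝓝 k) := hkl
    have hkY : k ∈ Y := h.inv.closed.mem_of_tendsto hkt (Filter.Eventually.of_forall fun C => h.inv.right _ _ (h.inv.left _ _ hy))
    refine RR_of_one h hkY ?_
    have hlim2 := tendsto_cg ((tendsto_const_nhds (x := J)).add hlim) hkt
    have e : cg (J + s τ • E33) k = F k + s τ • E k := by rw [cg_add, cg_smul]; rfl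
    rw [e] at hlim2
    refine mem_closure_of_tendsto hlim2 ?_
    filter_upwards [hgood] with C hC
    have : cg (J + cg (B C) (u (-(T C * τ)))) (u (T C * τ) * y * io (γ C)) = cg C (io (γ C)) := by
      have e1 : J + cg (B C) (u (-(T C * τ))) = cg (J + B C) (u (-(T C * τ))) := by rw [cg_add, cg_J_u]
      have e2 : cg C (io (γ C)) = cg (J + B C) (y * io (γ C)) := by rw [cg_mul, ← hCB C]
      rw [e1, e2, ← cg_mul, u_neg]
      congr 1; simp only [mul_assoc, inv_mul_cancel_left]
    rw [this]; exact Orb_inv hC.2.1 _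
  obtain ⟨τ0, hτ0⟩ : ∃ τ, s τ ≠ 0 := by
    by_contra hc
    push Not at hc
    obtain ⟨h1, h2, h3, h4⟩ := poly_bdd (c0 := 0) (c1 := c1) (c2 := c2) (c3 := c3) (c4 := c4) (C := 0) (fun T => ⟨T, le_abs_self T, by
      have := hc T
      simp only [hs] at this
      rw [abs_nonpos_iff]; linarith⟩)
    simp [h1, h2, h3, h4] at hsum
  have hcs : Continuous s := by simp only [hs]; fun_prop
  have hsub := intermediate_value_uIcc (f := s) (a := 0) (b := τ0) hcs.continuousOn
  have hs0 : s 0 = 0 := by simp [hs]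
  rw [hs0] at hsub
  refine ⟨min 0 (s τ0), max 0 (s τ0), ?_, ?_⟩
  · rw [min_lt_max]; exact hτ0.symm
  · intro x hx
    obtain ⟨τ, _, rfl⟩ := hsub hx
    exact main τ

end Opp
end

noncomputable section
namespace Opp
open Matrix Set Filter Topology

lemma exists_entry {A : M3} (h : A ≠ 0) : ∃ i j, A i j ≠ 0 := by
  by_contra hc; push Not at hc; exact h (by ext i j; exact hc i j)

lemma line_closed (A B : M3) (hB : B ≠ 0) : IsClosed {C : M3 | ∃ σ : ℝ, C = A + σ • B} := by
  obtain ⟨i, j, hij⟩ := exists_entry hB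
  have : {C : M3 | ∃ σ : ℝ, C = A + σ • B} = {C : M3 | C = A + ((C i j - A i j) / B i j) • B} := by
    ext C; constructor
    · rintro ⟨σ, hσ⟩
      have : (C i j - A i j) / B i j = σ := by rw [hσ]; simp [hij]
      rw [mem_setOf_eq, this]; exact hσ
    · intro h; exact ⟨_, h⟩
  rw [this]
  have hc : Continuous (fun C : M3 => (C i j - A i j) / B i j) :=
    ((continuous_id.matrix_elem i j).sub continuous_const).div_const _
  exact isClosed_eq continuous_id (continuous_const.add (hc.smul continuous_const))

def Exc (S : M3) (Y : Set G) : Prop := ∀ y ∈ Y, ∀ᶠ C in 𝓝 (F y), C ∈ Orb S → ∃ σ : ℝ, C = F y + σ • E y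

lemma exc_closure {S : M3} {Y : Set G} (he : Exc S Y) {y : G} (hy : y ∈ Y) :
    ∀ᶠ C in 𝓝 (F y), C ∈ closure (Orb S) → ∃ σ : ℝ, C = F y + σ • E y := by
  have h := eventually_eventually_nhds.2 (he y hy)
  filter_upwards [h] with C hC hcl
  have hf : ∃ᶠ D in 𝓝 C, D ∈ Orb S := mem_closure_iff_frequently.1 hcl
  have hf2 : ∃ᶠ D in 𝓝 C, D ∈ {D : M3 | ∃ σ : ℝ, D = F y + σ • E y} := (hf.and_eventually hC).mono fun D hD => hD.2 hD.1
  have := mem_closure_iff_frequently.2 hf2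
  rwa [(line_closed _ _ (E_ne y)).closure_eq] at this

lemma small_sigma {S : M3} {Y K : Set G} (h : MinSet S Y K) (he : Exc S Y) {y : G} (hy : y ∈ Y) {ε : ℝ} (hε : 0 < ε) :
    ∃ σ : ℝ, σ ≠ 0 ∧ |σ| < ε ∧ F y + σ • E y ∈ Orb S := by
  obtain ⟨i, j, hij⟩ := exists_entry (E_ne y)
  have hacc := h.mem y hy
  rw [mem_derivedSet, accPt_iff_frequently_nhdsNE] at hacc
  have hcont : Continuous (fun C : M3 => |(C i j - F y i j) / E y i j|) :=
    (((continuous_id.matrix_elem i j).sub continuous_const).div_const _).abs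
  have h1 : ∀ᶠ C in 𝓝 (F y), |(C i j - F y i j) / E y i j| < ε := by
    apply (hcont.tendsto (F y)).eventually_lt_const
    simpa using hε
  have h2 : ∀ᶠ C in 𝓝[≠] (F y), C ≠ F y := self_mem_nhdsWithin
  obtain ⟨C, hC, hCne, hCl, hCs⟩ := (hacc.and_eventually (h2.and (((he y hy).filter_mono nhdsWithin_le_nhds).and (h1.filter_mono nhdsWithin_le_nhds)))).exists
  obtain ⟨σ, rfl⟩ := hCl hC
  refine ⟨σ, ?_, ?_, hC⟩
  · rintro rfl; simp at hCne
  · simpa [hij] using hCs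

lemma NFlem {g : G} {l σ : ℝ} (hE : cg E33 g = l • E33) (hF : cg J g = J + σ • E33) :
    g.mt 2 0 = 0 ∧ g.mt 2 1 = 0 ∧ g.mt 1 0 = 0 ∧ g.mt 1 1 ^ 2 = 1 ∧ g.mt 0 0 * g.mt 2 2 = 1 ∧
    g.mt 0 1 * g.mt 2 2 = g.mt 1 1 * g.mt 1 2 ∧ 2 * g.mt 0 2 * g.mt 2 2 - g.mt 1 2 ^ 2 = σ ∧ g.mt 2 2 ^ 2 = l := by
  have a : ∀ i j, cg E33 g i j = (l • E33) i j := fun i j => by rw [hE]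
  have b : ∀ i j, cg J g i j = (J + σ • E33) i j := fun i j => by rw [hF]
  have a00 := a 0 0
  have a11 := a 1 1
  have a22 := a 2 2
  have b00 := b 0 0
  have b11 := b 1 1
  have b02 := b 0 2
  have b12 := b 1 2
  have b22 := b 2 2
  simp [cg, E33, mul3] at a00 a11 a22
  simp [cg, J, E33, mul3, a00, a11] at b00 b11 b02 b12 b22
  rw [b00] at b02
  exact ⟨a00, a11, b00, by linarith, by linarith, by linarith, by linarith, by linarith⟩

lemma nbhd_mul (y : G) {O : Set M3} (hO : O ∈ 𝓝 (F y)) : {g : G | F (g * y) ∈ O} ∈ 𝓝 (1 : G) := by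
  have hc : Continuous (fun g : G => F (g * y)) := continuous_F.comp (continuous_id.mul continuous_const)
  apply hc.continuousAt
  simpa using hO

/-- return elements have normal form -/
lemma exc_return {S : M3} {Y K : Set G} (h : MinSet S Y K) (he : Exc S Y) {y : G} (hy : y ∈ Y) {O : Set G} (hO : O ∈ 𝓝 (1:G)) :
    ∃ g ∈ O, (∃ t : ℝ, 1 ≤ t ∧ ∃ γ, g * y = u t * y * io γ) ∧ ∃ κ t' r : ℝ, 0 < κ ∧
      g.mt = !![κ⁻¹, t', r; 0, 1, t' * κ; 0, 0, κ] := by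
  have h0 := eventually_eventually_nhds.2 (exc_closure he hy)
  have hpos : ∀ᶠ g : G in 𝓝 1, 0 < g.mt 2 2 :=
    ((continuous_val.matrix_elem 2 2).tendsto (1:G)).eventually_const_lt (by simp [val_one])
  have hpos1 : ∀ᶠ g : G in 𝓝 1, 0 < g.mt 1 1 :=
    ((continuous_val.matrix_elem 1 1).tendsto (1:G)).eventually_const_lt (by simp [val_one])
  have hN : O ∩ {g : G | F (g * y) ∈ {D | ∀ᶠ C in 𝓝 D, C ∈ closure (Orb S) → ∃ σ : ℝ, C = F y + σ • E y}} ∩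
      ({g : G | 0 < g.mt 2 2} ∩ {g : G | 0 < g.mt 1 1}) ∈ 𝓝 (1 : G) :=
    inter_mem (inter_mem hO (nbhd_mul y h0)) (inter_mem hpos hpos1)
  have hN2 : (fun z => z * y⁻¹) ⁻¹' (O ∩ {g : G | F (g * y) ∈ {D | ∀ᶠ C in 𝓝 D, C ∈ closure (Orb S) → ∃ σ : ℝ, C = F y + σ • E y}} ∩
      ({g : G | 0 < g.mt 2 2} ∩ {g : G | 0 < g.mt 1 1})) ∈ 𝓝 y := by
    have hc : Continuous (fun z : G => z * y⁻¹) := continuous_id.mul continuous_const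
    apply hc.continuousAt
    simpa using hN
  obtain ⟨t, ht, γ, hz⟩ := h.recc y hy y hy _ hN2 1
  set g := u t * y * io γ * y⁻¹ with hg
  obtain ⟨⟨hgO, hgF⟩, hg2, hg1⟩ := hz
  change 0 < g.mt 2 2 at hg2
  change 0 < g.mt 1 1 at hg1
  have hgy : g * y = u t * y * io γ := by rw [hg]; group
  have hgY : g * y ∈ Y := by rw [hgy]; exact h.inv.right _ _ (h.inv.left _ _ hy)
  change ∀ᶠ C in 𝓝 (F (g * y)), C ∈ closure (Orb S) → ∃ σ : ℝ, C = F y + σ • E y at hgF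
  obtain ⟨σ, hσ⟩ := hgF.self_of_nhds (derivedSet_subset_closure _ (h.mem _ hgY))
  have hacc := h.mem _ hgY
  rw [mem_derivedSet, accPt_iff_frequently_nhdsNE] at hacc
  have h2 : ∀ᶠ C in 𝓝[≠] (F (g*y)), C ≠ F (g*y) := self_mem_nhdsWithin
  obtain ⟨C, hC, hCne, hC1, hC2⟩ := (hacc.and_eventually (h2.and (((he _ hgY).filter_mono nhdsWithin_le_nhds).and (hgF.filter_mono nhdsWithin_le_nhds)))).exists
  obtain ⟨s1, hs1⟩ := hC1 hC
  obtain ⟨s2, hs2⟩ := hC2 (subset_closure hC)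
  have hs1n : s1 ≠ 0 := by rintro rfl; apply hCne; rw [hs1]; simp
  have hEl : E (g * y) = ((s2 - σ) / s1) • E y := by
    have : s1 • E (g * y) = (s2 - σ) • E y := by
      have e := hs1.symm.trans hs2
      rw [hσ] at e
      rw [sub_smul]
      have := congrArg (fun X => X - F y - σ • E y) e
      rw [show F y + σ • E y + s1 • E (g * y) - F y - σ • E y = s1 • E (g*y) by abel] at this
      rw [this]; abel
    rw [div_eq_inv_mul, mul_smul, ← this, smul_smul, inv_mul_cancel₀ hs1n, one_smul]
  have hE' : cg E33 g = ((s2 - σ) / s1) • E33 := by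
    apply cg_inj y
    rw [← cg_mul, cg_smul]; exact hEl
  have hF' : cg J g = J + σ • E33 := by
    apply cg_inj y
    rw [← cg_mul, cg_add, cg_smul]; exact hσ
  obtain ⟨e1, e2, e3, e4, e5, e6, e7, e8⟩ := NFlem hE' hF'
  have e11 : g.mt 1 1 = 1 := by nlinarith
  refine ⟨g, hgO, ⟨t, ht, γ, hgy⟩, g.mt 2 2, g.mt 0 1, g.mt 0 2, hg2, ?_⟩
  have e00 : g.mt 0 0 = (g.mt 2 2)⁻¹ := eq_inv_of_mul_eq_one_left e5
  rw [e11, one_mul] at e6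
  apply ext3 <;> simp [e1, e2, e3, e11, e00, e6]

lemma nf_u {g : G} {κ t' r : ℝ} (hκ : 0 < κ) (hg : g.mt = !![κ⁻¹, t', r; 0, 1, t' * κ; 0, 0, κ]) (s : ℝ) :
    g * u s = u (s * κ⁻¹) * g := by
  apply val_inj
  rw [val_mul, val_mul, hg]
  apply ext3 <;> simp [val_u, mul3] <;> field_simp <;> (try ring)

lemma nf_J {g : G} {κ t' r : ℝ} (hκ : 0 < κ) (hg : g.mt = !![κ⁻¹, t', r; 0, 1, t' * κ; 0, 0, κ]) :
    cg J g = J + (2 * r * κ - (t' * κ)^2) • E33 := by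
  have := hκ.ne'
  apply ext3 <;> simp [cg, hg, J, E33, mul3, this] <;> (try ring)

lemma nf_E {g : G} {κ t' r : ℝ} (hg : g.mt = !![κ⁻¹, t', r; 0, 1, t' * κ; 0, 0, κ]) :
    cg E33 g = κ^2 • E33 := by
  apply ext3 <;> simp [cg, hg, E33, mul3] <;> (try ring)

lemma nf_stab {S : M3} {Y K : Set G} (h : MinSet S Y K) {y : G} (hy : y ∈ Y) {g : G} {κ t' r : ℝ} (hκ : 0 < κ)
    (hg : g.mt = !![κ⁻¹, t', r; 0, 1, t' * κ; 0, 0, κ]) (hgy : g * y ∈ Y) :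
    (∀ x ∈ Y, g * x ∈ Y) ∧ (∀ x ∈ Y, g⁻¹ * x ∈ Y) := by
  have cont : ∀ k : G, Continuous (fun x : G => k * x) := fun k => continuous_const.mul continuous_id
  constructor
  · have hi : Inv (Y ∩ {x | g * x ∈ Y}) := by
      refine ⟨h.inv.closed.inter (h.inv.closed.preimage (cont g)), ?_, ?_⟩
      · rintro t x ⟨hx, hx'⟩
        refine ⟨h.inv.left _ _ hx, ?_⟩
        rw [mem_setOf_eq, ← mul_assoc, nf_u hκ hg, mul_assoc]; exact h.inv.left _ _ hx'
      · rintro γ x ⟨hx, hx'⟩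
        refine ⟨h.inv.right _ _ hx, ?_⟩
        rw [mem_setOf_eq, ← mul_assoc]; exact h.inv.right _ _ hx'
    have e := h.min _ inter_subset_left hi ⟨y, hy, hgy⟩
    intro x hx; rw [← e] at hx; exact hx.2
  · have hi : Inv (Y ∩ {x | g⁻¹ * x ∈ Y}) := by
      refine ⟨h.inv.closed.inter (h.inv.closed.preimage (cont g⁻¹)), ?_, ?_⟩
      · rintro t x ⟨hx, hx'⟩
        refine ⟨h.inv.left _ _ hx, ?_⟩
        have : g⁻¹ * (u t * x) = u (t * κ) * (g⁻¹ * x) := by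
          rw [inv_mul_eq_iff_eq_mul, ← mul_assoc, ← mul_assoc, nf_u hκ hg, mul_inv_cancel_right₀ hκ.ne', mul_inv_cancel_right]
        rw [mem_setOf_eq, this]; exact h.inv.left _ _ hx'
      · rintro γ x ⟨hx, hx'⟩
        refine ⟨h.inv.right _ _ hx, ?_⟩
        rw [mem_setOf_eq, ← mul_assoc]; exact h.inv.right _ _ hx'
    have e := h.min _ inter_subset_left hi ⟨g * y, hgy, by simpa using hy⟩
    intro x hx; rw [← e] at hx; exact hx.2

lemma nf_R {S : M3} {Y K : Set G} (h : MinSet S Y K) {y : G} (hy : y ∈ Y) {g : G} {κ t' r : ℝ} (hκ : 0 < κ)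
    (hg : g.mt = !![κ⁻¹, t', r; 0, 1, t' * κ; 0, 0, κ]) (hgy : g * y ∈ Y) (s : ℝ) :
    s ∈ RR S Y ↔ (2 * r * κ - (t' * κ)^2) + κ^2 * s ∈ RR S Y := by
  obtain ⟨h1, h2⟩ := nf_stab h hy hκ hg hgy
  have key : ∀ x, F (g * x) + s • E (g * x) = F x + ((2 * r * κ - (t' * κ)^2) + κ^2 * s) • E x := by
    intro x
    unfold F E
    rw [cg_mul, cg_mul, nf_J hκ hg, nf_E hg, cg_add, cg_smul, cg_smul, add_smul, mul_comm (κ^2) s, mul_smul, add_assoc]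
  constructor
  · intro hs x hx
    rw [← key]; exact hs _ (h1 x hx)
  · intro hs x hx
    have := hs _ (h2 x hx)
    rw [← key] at this
    simpa using this

lemma gap {R : Set ℝ} (hR : IsClosed R) {a0 b0 z : ℝ} (ha : a0 ∈ R) (hb : b0 ∈ R) (hz : z ∉ R) (h1 : a0 ≤ z) (h2 : z ≤ b0) :
    ∃ a ∈ R, ∃ b ∈ R, a < b ∧ ∀ x, a < x → x < b → x ∉ R := by
  have c1 : IsClosed (R ∩ Iic z) := hR.inter isClosed_Iic
  have c2 : IsClosed (R ∩ Ici z) := hR.inter isClosed_Ici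
  have bd1 : BddAbove (R ∩ Iic z) := ⟨z, fun x hx => hx.2⟩
  have bd2 : BddBelow (R ∩ Ici z) := ⟨z, fun x hx => hx.2⟩
  have m1 := c1.csSup_mem ⟨a0, ha, h1⟩ bd1
  have m2 := c2.csInf_mem ⟨b0, hb, h2⟩ bd2
  have l1 : sSup (R ∩ Iic z) < z := lt_of_le_of_ne m1.2 fun e => hz (e ▸ m1.1)
  have l2 : z < sInf (R ∩ Ici z) := lt_of_le_of_ne m2.2 fun e => hz (e ▸ m2.1)
  refine ⟨_, m1.1, _, m2.1, l1.trans l2, fun x hx1 hx2 hx => ?_⟩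
  rcases le_total x z with hxz | hxz
  · exact absurd (le_csSup bd1 ⟨hx, hxz⟩) (not_le.2 hx1)
  · exact absurd (csInf_le bd2 ⟨hx, hxz⟩) (not_le.2 hx2)

lemma exc_period {S : M3} {Y K : Set G} (h : MinSet S Y K) (he : Exc S Y)
    (hno : ¬ ∃ p q : ℝ, p < q ∧ Icc p q ⊆ RR S Y) :
    ∃ y ∈ Y, ∃ t0 : ℝ, t0 ≠ 0 ∧ ∃ γ, y * io γ = u t0 * y := by
  obtain ⟨y, hy⟩ := h.ne
  obtain ⟨σ1, hσ1, _, hσm⟩ := small_sigma h he hy one_pos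
  have hR1 : σ1 ∈ RR S Y := RR_of_one h hy (subset_closure hσm)
  have hR0 : (0:ℝ) ∈ RR S Y := RR_zero h
  obtain ⟨z, hz, hzR⟩ : ∃ z ∈ Icc (min 0 σ1) (max 0 σ1), z ∉ RR S Y := by
    by_contra hc
    push Not at hc
    exact hno ⟨min 0 σ1, max 0 σ1, by rw [min_lt_max]; exact hσ1.symm, hc⟩
  have hmin : min 0 σ1 ∈ RR S Y := by rcases min_choice 0 σ1 with e | e <;> rw [e] <;> assumption
  have hmax : max 0 σ1 ∈ RR S Y := by rcases max_choice 0 σ1 with e | e <;> rw [e] <;> assumption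
  obtain ⟨a, ha, b, hb, hab, hgap⟩ := gap (RR_closed S Y) hmin hmax hzR hz.1 hz.2
  have c22 : Continuous (fun g : G => g.mt 2 2) := continuous_val.matrix_elem 2 2
  have cσ : Continuous (fun g : G => 2 * g.mt 0 2 * g.mt 2 2 - g.mt 1 2 ^ 2) :=
    ((continuous_const.mul (continuous_val.matrix_elem 0 2)).mul c22).sub ((continuous_val.matrix_elem 1 2).pow 2)
  have cf : ∀ s : ℝ, ∀ᶠ g : G in 𝓝 1, |(2 * g.mt 0 2 * g.mt 2 2 - g.mt 1 2 ^ 2) + g.mt 2 2 ^2 * s - s| < b - a := by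
    intro s
    have : Continuous (fun g : G => |(2 * g.mt 0 2 * g.mt 2 2 - g.mt 1 2 ^ 2) + g.mt 2 2 ^2 * s - s|) :=
      ((cσ.add ((c22.pow 2).mul continuous_const)).sub continuous_const).abs
    exact (this.tendsto 1).eventually_lt_const (by simpa [val_one] using hab)
  have cfi : ∀ s : ℝ, ∀ᶠ g : G in 𝓝 1, |(s - (2 * g.mt 0 2 * g.mt 2 2 - g.mt 1 2 ^ 2)) / g.mt 2 2 ^2 - s| < b - a := by
    intro s
    have : ContinuousAt (fun g : G => |(s - (2 * g.mt 0 2 * g.mt 2 2 - g.mt 1 2 ^ 2)) / g.mt 2 2 ^2 - s|) 1 :=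
      (((continuous_const.sub cσ).continuousAt.div (c22.pow 2).continuousAt (by simp [val_one])).sub continuousAt_const).abs
    exact this.tendsto.eventually_lt_const (by simpa [val_one] using hab)
  have ct : ∀ᶠ g : G in 𝓝 1, g.mt 0 1 < 1 :=
    ((continuous_val.matrix_elem 0 1).tendsto (1:G)).eventually_lt_const (by simp [val_one])
  obtain ⟨g, ⟨hga, hgb, hga', hgb', hgt⟩, ⟨t, ht, γ, hgy⟩, κ, t', r, hκ, hg⟩ :=
    exc_return h he hy ((cf a).and ((cf b).and ((cfi a).and ((cfi b).and ct))))
  have hgY : g * y ∈ Y := by rw [hgy]; exact h.inv.right _ _ (h.inv.left _ _ hy)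
  have iff := nf_R h hy hκ hg hgY
  simp [hg] at hga hgb hga' hgb' hgt
  set σ := 2 * r * κ - (t' * κ)^2 with hσ
  have hk2 : 0 < κ^2 := by positivity
  have finv : ∀ s, σ + κ^2 * ((s - σ)/κ^2) = s := fun s => by field_simp; ring
  have hia : (a - σ)/κ^2 ∈ RR S Y := by rw [iff, finv]; exact ha
  have hib : (b - σ)/κ^2 ∈ RR S Y := by rw [iff, finv]; exact hb
  have hfa := (iff a).1 ha
  have hfb := (iff b).1 hb
  rw [abs_lt] at hga hgb hga' hgb'
  have f1 : σ + κ^2 * a ≤ a := by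
    by_contra hc; push Not at hc
    exact hgap _ hc (by linarith) hfa
  have f2 : (a - σ)/κ^2 ≤ a := by
    by_contra hc; push Not at hc
    exact hgap _ hc (by linarith) hia
  have f3 : b ≤ σ + κ^2 * b := by
    by_contra hc; push Not at hc
    exact hgap _ (by linarith) hc hfb
  have f4 : b ≤ (b - σ)/κ^2 := by
    by_contra hc; push Not at hc
    exact hgap _ (by linarith) hc hib
  rw [div_le_iff₀ hk2] at f2
  rw [le_div_iff₀ hk2] at f4
  have g1 : σ + κ^2 * a = a := by linarith
  have g2 : σ + κ^2 * b = b := by linarith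
  have g3 : (κ^2 - 1) * (b - a) = 0 := by linear_combination g2 - g1
  have g4 : κ^2 = 1 := by
    rcases mul_eq_zero.1 g3 with e | e <;> linarith
  have g5 : κ = 1 := by nlinarith
  have g6 : σ = 0 := by rw [g4] at g1; linarith
  rw [hσ, g5] at g6
  have hgu : g = u t' := by
    apply val_inj
    rw [hg, val_u, g5]
    apply ext3 <;> simp
    linarith
  refine ⟨y, hy, t' - t, by linarith, γ, ?_⟩
  rw [hgu] at hgy
  have : y * io γ = (u t)⁻¹ * (u t * y * io γ) := by group
  rw [this, ← hgy, ← u_neg, ← mul_assoc, ← u_add]; congr 2; ring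

end Opp
end

noncomputable section
namespace Opp
open Matrix Set Filter Topology

lemma fixA {P : M3} (hP : Pᵀ = P) {y : G} {t0 : ℝ} (ht0 : t0 ≠ 0) {γ : Ga} (h : y * io γ = u t0 * y)
    (hfix : cg P (io γ) = P) : ∃ a b : ℝ, P = a • F y + b • E y := by
  have h1 : cg (cg P y⁻¹) (u t0) = cg P y⁻¹ := by
    have e : y⁻¹ * u t0 = io γ * y⁻¹ := by
      rw [eq_mul_inv_iff_mul_eq, mul_assoc, ← h]; group
    rw [← cg_mul, e, cg_mul, hfix]
  have h2 : ∀ k : ℕ, cg (cg P y⁻¹) (u (k * t0)) = cg P y⁻¹ := by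
    intro k
    induction k with
    | zero => simp [u_zero, cg_one]
    | succ k ih =>
      rw [show ((k+1:ℕ):ℝ) * t0 = k * t0 + t0 by push_cast; ring, u_add, cg_mul, ih, h1]
  obtain ⟨a, b, hab⟩ := poly_lemma (B := cg P y⁻¹) (cg_symm hP _) (C := |cg P y⁻¹ 2 2|) (by
    intro T
    obtain ⟨k, hk⟩ := exists_nat_ge (T / |t0|)
    refine ⟨-(k * t0), ?_, ?_⟩
    · rw [abs_neg, abs_mul, Nat.abs_cast]
      rwa [div_le_iff₀ (abs_pos.2 ht0)] at hk
    · rw [neg_neg, h2])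
  refine ⟨a, b, ?_⟩
  rw [← cg_inv' P y, hab, cg_add, cg_smul, cg_smul]; rfl

lemma det_EE (a b : ℝ) (g h : G) : (a • E g + b • E h).det = 0 := by
  rw [Matrix.det_fin_three]
  simp only [Matrix.add_apply, Matrix.smul_apply, E_apply, smul_eq_mul]
  ring

lemma coefF {a a' b b' : ℝ} {y y2 : G} (h : a • F y + b • E y = a' • F y + b' • E y2) : a = a' := by
  have e : (a - a') • F y = b' • E y2 + (-b) • E y := by
    rw [sub_smul, neg_smul]
    rw [eq_comm, ← sub_eq_zero] at h
    rw [← sub_eq_zero, ← neg_eq_zero, ← h]; abel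
  have := congrArg Matrix.det e
  rw [det_EE, Matrix.det_smul, det_F, mul_one] at this
  have := pow_eq_zero_iff (by simp) |>.1 this
  linarith

lemma intpow {N : Matrix (Fin 3) (Fin 3) ℤ} {γ : Ga} {κ : ℝ}
    (h : N.map (Int.cast : ℤ → ℝ) * (io γ).mt = κ • N.map (Int.cast : ℤ → ℝ)) {i j : Fin 3} (hN : N i j ≠ 0) : 1 ≤ |κ| := by
  by_contra hc
  push Not at hc
  have hk : ∀ k : ℕ, N.map (Int.cast : ℤ → ℝ) * (io (γ^k)).mt = κ^k • N.map (Int.cast : ℤ → ℝ) := by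
    intro k
    induction k with
    | zero => simp [val_one]
    | succ k ih => rw [pow_succ, map_mul, val_mul, ← Matrix.mul_assoc, ih, Matrix.smul_mul, h, smul_smul, pow_succ]
  have hi : ∀ k : ℕ, ∃ z : ℤ, κ^k * (N i j : ℝ) = z := by
    intro k
    have := congrFun (congrFun (hk k) i) j
    refine ⟨(N * (γ^k).mt) i j, ?_⟩
    simp only [Matrix.smul_apply, smul_eq_mul, Matrix.map_apply] at this
    rw [← this, mul3, mul3]
    simp only [Matrix.map_apply, io_apply]
    push_cast; rfl
  have ht : Tendsto (fun k : ℕ => |κ|^k * |(N i j : ℝ)|) atTop (𝓝 (0 * |(N i j : ℝ)|)) :=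
    (tendsto_pow_atTop_nhds_zero_of_lt_one (abs_nonneg _) hc).mul_const _
  rw [zero_mul] at ht
  obtain ⟨k, hk1⟩ := (ht.eventually_lt_const one_pos).exists
  obtain ⟨z, hz⟩ := hi k
  have hz1 : |(z:ℝ)| < 1 := by rw [← hz, abs_mul, abs_pow]; exact hk1
  have hz0 : z = 0 := by
    have : |z| < 1 := by exact_mod_cast hz1
    exact Int.abs_lt_one_iff.1 this
  rw [hz0] at hz
  have hN' : (N i j : ℝ) ≠ 0 := by exact_mod_cast hN
  have hk0 : κ = 0 := by
    rcases mul_eq_zero.1 (hz.trans Int.cast_zero) with e | e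
    · by_contra h0; exact absurd e (pow_ne_zero _ h0)
    · exact absurd e hN'
  rw [hk0, zero_smul] at h
  have h3 : N.map (Int.cast : ℤ → ℝ) = 0 := by
    have : N.map (Int.cast : ℤ → ℝ) * (io γ).mt * ((io γ)⁻¹).mt = 0 := by rw [h, Matrix.zero_mul]
    rw [Matrix.mul_assoc, ← val_mul, mul_inv_cancel, val_one, Matrix.mul_one] at this
    exact this
  have := congrFun (congrFun h3 i) j
  simp at this
  exact hN this

lemma cancelY (y : G) {A B : M3} (h : y.mt * A = y.mt * B) : A = B := by
  have := congrArg (fun X => (y⁻¹).mt * X) h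
  simp only [← Matrix.mul_assoc, ← val_mul, inv_mul_cancel, val_one, Matrix.one_mul] at this
  exact this

def E13 : M3 := !![0,0,1;0,0,0;0,0,0]

lemma core_E {y : G} {γp γ : Ga} {t0 δ : ℝ} (h0 : y * io γp = u t0 * y) (ht0 : t0 ≠ 0)
    (hγ : cg (F y) (io γ) = F y + δ • E y) (nr : ¬ IsRat (F y)) :
    ∃ l : ℝ, cg (E y) (io γ) = l • E y := by
  set y2 := y * io γ⁻¹ with hy2
  have hF2 : F y = F y2 + δ • E y2 := by
    have := congrArg (fun X => cg X (io γ⁻¹)) hγ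
    simp only [cg_add, cg_smul, ← F_mul, ← E_mul] at this
    rw [← hy2, mul_assoc, ← map_mul, mul_inv_cancel, map_one, mul_one] at this
    exact this
  have h2 : y2 * io (γ * γp * γ⁻¹) = u t0 * y2 := by
    rw [hy2, ← mul_assoc, ← h0, map_mul, map_mul, map_inv]; group
  by_cases hl : ∃ l : ℝ, E y = l • E y2
  · obtain ⟨l, hl⟩ := hl
    refine ⟨l, ?_⟩
    conv_lhs => rw [hl]
    rw [cg_smul, ← E_mul, hy2, mul_assoc, ← map_mul, inv_mul_cancel, map_one, mul_one]
  · exfalso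
    apply nr
    have fF : ∀ (z : G) (g : Ga), z * io g = u t0 * z → cg (F z) (io g) = F z := by
      intro z g hz; rw [← F_mul, hz, F_u]
    have fE : ∀ (z : G) (g : Ga), z * io g = u t0 * z → cg (E z) (io g) = E z := by
      intro z g hz; rw [← E_mul, hz, E_u]
    have hne : F y ≠ 0 := by
      intro h; have := det_F y; rw [h] at this; simp at this
    refine rat_lemma (F_symm y) hne {γp, γ * γp * γ⁻¹} ?_ ?_
    · intro g hg
      rcases hg with rfl | rfl
      · exact fF _ _ h0
      · rw [hF2, cg_add, cg_smul, fF _ _ h2, fE _ _ h2]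
    · intro P hP hfix
      obtain ⟨a, b, e1⟩ := fixA hP ht0 h0 (hfix _ (by simp))
      obtain ⟨a', b', e2⟩ := fixA hP ht0 h2 (hfix _ (by simp))
      have e3 : P = a' • F y + (b' - a' * δ) • E y2 := by
        rw [e2, hF2, sub_smul, smul_add, smul_smul]; abel
      have ha := coefF (e1.symm.trans e3)
      have e4 : b • E y = (b' - a' * δ) • E y2 := by
        have := e1.symm.trans e3
        rw [ha] at this
        exact add_left_cancel this
      have hb : b = 0 := by
        by_contra hb
        apply hl
        refine ⟨b⁻¹ * (b' - a' * δ), ?_⟩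
        rw [mul_smul, ← e4, smul_smul, inv_mul_cancel₀ hb, one_smul]
      exact ⟨a, by rw [e1, hb]; simp⟩

lemma map_sub_one (γ : Ga) : (γ.mt - 1).map (Int.cast : ℤ → ℝ) = (io γ).mt - 1 := by
  ext i j
  simp only [Matrix.map_apply, Matrix.sub_apply, io_apply, Matrix.one_apply]
  push_cast
  split_ifs <;> simp

lemma map_mulZ (A B : Matrix (Fin 3) (Fin 3) ℤ) :
    (A * B).map (Int.cast : ℤ → ℝ) = A.map (Int.cast : ℤ → ℝ) * B.map (Int.cast : ℤ → ℝ) := by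
  ext i j
  simp only [Matrix.map_apply, mul3]
  push_cast; rfl

lemma conj_sub {y : G} {γ : Ga} {h : G} (e : y * io γ = h * y) :
    y.mt * (γ.mt - 1).map (Int.cast : ℤ → ℝ) = (h.mt - 1) * y.mt := by
  rw [map_sub_one, Matrix.mul_sub, Matrix.sub_mul, ← val_mul, e, val_mul, Matrix.mul_one, Matrix.one_mul]

lemma period_core {y : G} {γp γ : Ga} {t0 δ : ℝ} (h0 : y * io γp = u t0 * y) (ht0 : t0 ≠ 0) (hδ : δ ≠ 0)
    (hγ : cg (F y) (io γ) = F y + δ • E y) (nr : ¬ IsRat (F y)) {i j : Fin 3}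
    (hq : ((γp.mt - 1) * (γp.mt - 1)) i j ≠ 0) :
    t0^2 ≤ 2 * (((γp.mt - 1) * (γp.mt - 1)) i j : ℝ)^2 * |δ| := by
  obtain ⟨l, hl⟩ := core_E h0 ht0 hγ nr
  set h : G := y * io γ * y⁻¹ with hh
  have hy : y * io γ = h * y := by rw [hh]; group
  have hJ : cg J h = J + δ • E33 := by
    apply cg_inj y
    rw [← cg_mul, ← hy, cg_mul, cg_add, cg_smul]; exact hγ
  have hE : cg E33 h = l • E33 := by
    apply cg_inj y
    rw [← cg_mul, ← hy, cg_mul, cg_smul]; exact hl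
  obtain ⟨a1, a2, a3, a4, a5, a6, a7, a8⟩ := NFlem hE hJ
  set κ := h.mt 2 2 with hκ
  have hκ0 : κ ≠ 0 := by rintro e; rw [e] at a5; simp at a5
  set A := γp.mt - 1 with hA
  have hYA := conj_sub h0
  rw [← hA] at hYA
  have hWW : ((u t0).mt - 1) * ((u t0).mt - 1) = t0^2 • E13 := by
    apply ext3 <;> simp [mul3, val_u, E13] <;> try ring
  have hYN : y.mt * (A * A).map (Int.cast : ℤ → ℝ) = t0^2 • (E13 * y.mt) := by
    rw [map_mulZ, ← Matrix.mul_assoc, hYA, Matrix.mul_assoc, hYA, ← Matrix.mul_assoc, hWW, Matrix.smul_mul]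
  have hEH : E13 * h.mt = κ • E13 := by
    apply ext3 <;> simp [mul3, E13, a1, a2, ← hκ]
  have hN1 : (A * A).map (Int.cast : ℤ → ℝ) * (io γ).mt = κ • (A * A).map (Int.cast : ℤ → ℝ) := by
    apply cancelY y
    rw [← Matrix.mul_assoc, hYN, Matrix.smul_mul, Matrix.mul_assoc, ← val_mul, hy, val_mul, ← Matrix.mul_assoc, hEH,
      Matrix.mul_smul, hYN, Matrix.smul_mul, smul_comm]
  have hN2 : (A * A).map (Int.cast : ℤ → ℝ) * (io γ⁻¹).mt = κ⁻¹ • (A * A).map (Int.cast : ℤ → ℝ) := by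
    have := congrArg (fun X => κ⁻¹ • (X * (io γ⁻¹).mt)) hN1
    simp only [Matrix.mul_assoc, ← val_mul, ← map_mul, mul_inv_cancel, map_one, val_one, Matrix.mul_one] at this
    rw [Matrix.smul_mul, smul_smul, inv_mul_cancel₀ hκ0, one_smul] at this
    exact this.symm
  have k1 := intpow hN1 hq
  have k2 := intpow hN2 hq
  have hκ1 : |κ| = 1 := by
    rw [abs_inv] at k2
    have : |κ| ≤ 1 := by
      rw [← inv_inv |κ|]; exact inv_le_one_of_one_le₀ k2
    linarith
  have hκ2 : κ^2 = 1 := by rw [← sq_abs, hκ1]; norm_num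
  have hl1 : l = 1 := by rw [← a8, hκ2]
  have hJ2 : cg J (h * h) = J + (2 * δ) • E33 := by
    rw [cg_mul, hJ, cg_add, cg_smul, hJ, hE, hl1, one_smul, two_mul, add_smul, add_assoc]
  have hE2 : cg E33 (h * h) = (1:ℝ) • E33 := by
    rw [cg_mul, hE, cg_smul, hE, hl1, one_smul, one_smul]
  obtain ⟨b1, b2, b3, b4, b5, b6, b7, b8⟩ := NFlem hE2 hJ2
  have c22 : (h * h).mt 2 2 = 1 := by
    rw [val_mul, mul3, a1, a2, ← hκ]; linarith
  have c11 : (h * h).mt 1 1 = 1 := by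
    rw [val_mul, mul3, a2, a3]; linarith
  rw [c22] at b5 b6 b7
  rw [c11] at b6
  have e12 := b6
  rw [mul_one, one_mul] at e12
  set t := (h * h).mt 0 1 with ht
  set r := (h * h).mt 0 2 with hr
  have hH2 : (h * h).mt = !![1, t, r; 0, 1, t; 0, 0, 1] := by
    apply ext3 <;> simp [b1, b2, b3, c11, c22, ← ht, ← hr] <;> linarith
  have hy2 : y * io (γ * γ) = (h * h) * y := by
    clear_value h
    rw [map_mul, ← mul_assoc, hy, mul_assoc h y, hy, mul_assoc]
  have hYB := conj_sub hy2
  set B := (γ * γ).mt - 1 with hB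
  have hWD : ((u t0).mt - 1) * ((h * h).mt - 1) = (t0 * t) • E13 := by
    rw [hH2]
    apply ext3 <;> simp [mul3, val_u, E13] <;> try ring
  have hYAB : y.mt * (A * B).map (Int.cast : ℤ → ℝ) = (t0 * t) • (E13 * y.mt) := by
    rw [map_mulZ, ← Matrix.mul_assoc, hYA, Matrix.mul_assoc, hYB, ← Matrix.mul_assoc, hWD, Matrix.smul_mul]
  have r1 : t0 • (A * B).map (Int.cast : ℤ → ℝ) = t • (A * A).map (Int.cast : ℤ → ℝ) := by
    apply cancelY y
    rw [Matrix.mul_smul, Matrix.mul_smul, hYAB, hYN, smul_smul, smul_smul]; congr 1; ring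
  have hlin : t0 • ((h * h).mt - 1) - t • ((u t0).mt - 1) = (t0 * r - t * t0^2/2) • E13 := by
    rw [hH2]
    apply ext3 <;> simp [val_u, E13] <;> try ring
  have r2 : t0^2 • (t0 • B.map (Int.cast : ℤ → ℝ) - t • A.map (Int.cast : ℤ → ℝ)) = (t0 * r - t * t0^2/2) • (A * A).map (Int.cast : ℤ → ℝ) := by
    apply cancelY y
    rw [Matrix.mul_smul, Matrix.mul_sub, Matrix.mul_smul, Matrix.mul_smul, hYA, hYB, ← Matrix.smul_mul, ← Matrix.smul_mul,
      ← Matrix.sub_mul, hlin, Matrix.mul_smul, hYN, Matrix.smul_mul, smul_comm]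
  have s1 := congrFun (congrFun r1 i) j
  have s2 := congrFun (congrFun r2 i) j
  simp only [Matrix.smul_apply, Matrix.sub_apply, Matrix.map_apply, smul_eq_mul] at s1 s2
  generalize (A * A) i j = q at *
  generalize (A * B) i j = p at *
  generalize A i j = a at *
  generalize B i j = b at *
  have hq' : (q:ℝ) ≠ 0 := by exact_mod_cast hq
  have key : 2 * (q:ℝ)^2 * δ = t0^2 * ((2 * (q * b - p * a) - p^2 + p * q : ℤ) : ℝ) := by
    have e1 : t = t0 * p / q := by field_simp; linarith
    have e2 : r = δ + t^2/2 := by rw [← e12] at b7; linarith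
    have s3 : t0 * (t0 * b - t * a) = (r - t * t0/2) * q := by
      apply mul_left_cancel₀ ht0; linear_combination s2
    rw [e2, e1] at s3
    field_simp at s3
    push_cast
    linear_combination (-1) * s3
  have hz : (2 * (q * b - p * a) - p^2 + p * q : ℤ) ≠ 0 := by
    intro hz
    rw [hz] at key
    simp [hq', hδ] at key
  have hz1 : (1:ℝ) ≤ |((2 * (q * b - p * a) - p^2 + p * q : ℤ) : ℝ)| := by
    have := Int.one_le_abs hz
    exact_mod_cast this
  have : 2 * (q:ℝ)^2 * |δ| = t0^2 * |((2 * (q * b - p * a) - p^2 + p * q : ℤ) : ℝ)| := by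
    have := congrArg abs key
    rw [abs_mul (2 * (q:ℝ)^2), abs_mul (t0^2), abs_of_nonneg (by positivity : (0:ℝ) ≤ 2 * (q:ℝ)^2), abs_of_nonneg (by positivity : (0:ℝ) ≤ t0^2)] at this
    exact this
  rw [this]
  nlinarith [sq_nonneg t0]

lemma period_false {S : M3} {Y K : Set G} (hS : Hyp S) (h : MinSet S Y K) (he : Exc S Y) {y : G} (hy : y ∈ Y)
    {t0 : ℝ} (ht0 : t0 ≠ 0) {γp : Ga} (hp : y * io γp = u t0 * y) : False := by
  obtain ⟨i, j, hq⟩ : ∃ i j, ((γp.mt - 1) * (γp.mt - 1)) i j ≠ 0 := by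
    by_contra hc
    push Not at hc
    have hz : (γp.mt - 1) * (γp.mt - 1) = 0 := by ext i j; exact hc i j
    have hYA := conj_sub hp
    have hYN : y.mt * ((γp.mt - 1) * (γp.mt - 1)).map (Int.cast : ℤ → ℝ) = ((u t0).mt - 1) * ((u t0).mt - 1) * y.mt := by
      rw [map_mulZ, ← Matrix.mul_assoc, hYA, Matrix.mul_assoc, hYA, ← Matrix.mul_assoc]
    rw [hz] at hYN
    have h0 : ((u t0).mt - 1) * ((u t0).mt - 1) = 0 := by
      have := congrArg (fun X => X * (y⁻¹).mt) hYN
      simp only [Matrix.mul_assoc, ← val_mul, mul_inv_cancel, val_one, Matrix.mul_one] at this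
      rw [← this]; ext i j; simp [mul3]
    have := congrFun (congrFun h0 0) 2
    simp [mul3, val_u] at this
    exact ht0 this
  set q := ((γp.mt - 1) * (γp.mt - 1)) i j with hqd
  have hq' : (q:ℝ) ≠ 0 := by exact_mod_cast hq
  have hε : 0 < t0^2 / (2 * (q:ℝ)^2) / 2 := by positivity
  obtain ⟨s1, hs1, hs1l, hs1m⟩ := small_sigma h he hy hε
  obtain ⟨s2, hs2, hs2l, hs2m⟩ := small_sigma h he hy (lt_min hε (abs_pos.2 hs1))
  have hd : s2 - s1 ≠ 0 := by
    intro e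
    have : s2 = s1 := by linarith
    rw [this] at hs2l
    exact lt_irrefl _ (lt_of_lt_of_le hs2l (min_le_right _ _))
  have hdl : |s2 - s1| < t0^2 / (2 * (q:ℝ)^2) := by
    have := abs_sub s2 s1
    have := lt_of_lt_of_le hs2l (min_le_left _ _)
    linarith
  set y1 := v (s1/2) * y with hy1
  have hF1 : F y1 = F y + s1 • E y := by rw [hy1, F_v]; congr 2; ring
  have hE1 : E y1 = E y := by rw [hy1, E_v]
  have hp1 : y1 * io γp = u t0 * y1 := by
    rw [hy1, mul_assoc, hp, ← mul_assoc, v_u, mul_assoc]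
  obtain ⟨a, ha⟩ := hs1m
  obtain ⟨b, hb⟩ := hs2m
  simp only at ha hb
  have hnr : ¬ IsRat (F y1) := by
    rw [hF1, ← ha]; exact (hS.cg a).nr
  have hγ : cg (F y1) (io (a⁻¹ * b)) = F y1 + (s2 - s1) • E y1 := by
    rw [hF1, ← ha, map_mul, cg_mul, map_inv, cg_inv, hb, ha, hE1, sub_smul]; abel
  have := period_core hp1 ht0 hd hγ hnr (i := i) (j := j) hq
  rw [← hqd] at this
  rw [lt_div_iff₀ (by positivity)] at hdl
  linarith

theorem interval {S : M3} (hS : Hyp S) : ∃ y : G, ∃ p q : ℝ, p < q ∧ ∀ s ∈ Icc p q, F y + s • E y ∈ closure (Orb S) := by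
  obtain ⟨Y, K, h⟩ := exists_minset hS
  obtain ⟨y, hy⟩ := h.ne
  suffices H : ∃ p q, p < q ∧ Icc p q ⊆ RR S Y by
    obtain ⟨p, q, hpq, hs⟩ := H
    exact ⟨y, p, q, hpq, fun s hs' => hs hs' y hy⟩
  by_contra hno
  have he : Exc S Y := by
    intro z hz
    by_contra hc
    rw [not_eventually] at hc
    refine hno (nonexc hS h hz (hc.mono fun C hC => ?_))
    push Not at hC
    exact hC
  obtain ⟨z, hz, t0, ht0, γ, hγ⟩ := exc_period h he hno
  exact period_false hS h he hz ht0 hγ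

end Opp
end

noncomputable section
namespace Opp
open Matrix Set Filter Topology

lemma int_cone {ι : Type*} [Fintype ι] {U : Set (ι → ℝ)} (hU : IsOpen U) (hne : U.Nonempty)
    (hs : ∀ x ∈ U, ∀ N : ℕ, 0 < N → (N : ℝ) • x ∈ U) : ∃ m : ι → ℤ, (fun i => (m i : ℝ)) ∈ U := by
  have hd : DenseRange (Pi.map (fun (_ : ι) => ((↑) : ℚ → ℝ))) := DenseRange.piMap fun _ => Rat.denseRange_cast
  obtain ⟨r, hr⟩ := hd.exists_mem_open hU hne
  set D : ℕ := ∏ i, (r i).den with hD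
  have hD0 : 0 < D := Finset.prod_pos fun i _ => (r i).den_pos
  have h1 : ∀ i, ∃ z : ℤ, (D : ℝ) * (r i : ℝ) = z := by
    intro i
    obtain ⟨k, hk⟩ : (r i).den ∣ D := Finset.dvd_prod_of_mem _ (Finset.mem_univ i)
    refine ⟨k * (r i).num, ?_⟩
    have hden : ((r i).den : ℝ) ≠ 0 := by exact_mod_cast (r i).den_ne_zero
    have : (r i : ℝ) = (r i).num / (r i).den := by exact_mod_cast (Rat.num_div_den (r i)).symm
    rw [hk, this]; push_cast; field_simp
  choose m hm using h1
  refine ⟨m, ?_⟩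
  have := hs _ hr D hD0
  convert this using 1
  ext i
  rw [← hm i]; simp

def qv (C : M3) (x : Fin 3 → ℝ) : ℝ := x ⬝ᵥ (C *ᵥ x)

lemma qv_cg (C : M3) (g : G) (x : Fin 3 → ℝ) : qv (cg C g) x = qv C (g.mt *ᵥ x) := by
  unfold qv cg
  rw [Matrix.mul_assoc, ← Matrix.mulVec_mulVec, ← Matrix.mulVec_mulVec, Matrix.dotProduct_mulVec, Matrix.vecMul_transpose]

lemma qv_smul (C : M3) (a : ℝ) (x : Fin 3 → ℝ) : qv C (a • x) = a^2 * qv C x := by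
  unfold qv
  rw [Matrix.mulVec_smul, smul_dotProduct, dotProduct_smul]; simp; ring

lemma qv_cont (C : M3) : Continuous (qv C) := by
  unfold qv
  exact continuous_id.dotProduct (continuous_const.matrix_mulVec continuous_id)

lemma qv_cont2 (x : Fin 3 → ℝ) : Continuous (fun C => qv C x) := by
  unfold qv
  exact continuous_const.dotProduct (continuous_id.matrix_mulVec continuous_const)

lemma qv_line (C D : M3) (s : ℝ) (x : Fin 3 → ℝ) : qv (C + s • D) x = qv C x + s * qv D x := by
  unfold qv
  rw [Matrix.add_mulVec, Matrix.smul_mulVec, dotProduct_add, dotProduct_smul]; simp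

theorem dense3 {S : M3} (hS : Hyp S) : Dense {r : ℝ | ∃ m : Fin 3 → ℤ, qv S (fun i => (m i : ℝ)) = r} := by
  obtain ⟨y, p, q, hpq, hcl⟩ := interval hS
  set x0 : Fin 3 → ℝ := (y⁻¹).mt *ᵥ ![-(p+q)/4, 0, 1] with hx0
  have hyx : y.mt *ᵥ x0 = ![-(p+q)/4, 0, 1] := by
    rw [hx0, Matrix.mulVec_mulVec, ← val_mul, mul_inv_cancel, val_one, Matrix.one_mulVec]
  have hval : ∀ s, qv (F y + s • E y) x0 = s - (p+q)/2 := by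
    intro s
    rw [qv_line, F, E, qv_cg, qv_cg, hyx]
    simp [qv, J, E33, Matrix.mulVec, dotProduct, Fin.sum_univ_three]; ring
  obtain ⟨m, hm1, hm2⟩ := int_cone (U := {x | qv (F y + p • E y) x < 0} ∩ {x | 0 < qv (F y + q • E y) x})
    ((isOpen_lt (qv_cont _) continuous_const).inter (isOpen_lt continuous_const (qv_cont _)))
    ⟨x0, by rw [mem_setOf_eq, hval]; linarith, by rw [mem_setOf_eq, hval]; linarith⟩ (by
      rintro x ⟨h1, h2⟩ N hN
      have hN' : (0:ℝ) < N := by exact_mod_cast hN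
      rw [mem_setOf_eq] at h1 h2
      constructor
      · rw [mem_setOf_eq, qv_smul]; nlinarith [pow_pos hN' 2]
      · rw [mem_setOf_eq, qv_smul]; positivity)
  rw [mem_setOf_eq] at hm1 hm2
  rw [Metric.dense_iff]
  intro c ε hε
  obtain ⟨N, hN⟩ := exists_nat_ge (|c| / (-qv (F y + p • E y) (fun i => (m i : ℝ))) + |c| / qv (F y + q • E y) (fun i => (m i : ℝ)) + 1)
  have hnp : 0 < -qv (F y + p • E y) (fun i => (m i : ℝ)) := by linarith
  have i1 : 0 ≤ |c| / (-qv (F y + p • E y) (fun i => (m i : ℝ))) := by positivity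
  have i2 : 0 ≤ |c| / qv (F y + q • E y) (fun i => (m i : ℝ)) := by positivity
  have hN1 : (1:ℝ) ≤ N := by linarith
  have hNs : (N:ℝ) ≤ (N:ℝ)^2 := by nlinarith
  have j1 : |c| / (-qv (F y + p • E y) (fun i => (m i : ℝ))) ≤ (N:ℝ)^2 := by linarith
  have j2 : |c| / qv (F y + q • E y) (fun i => (m i : ℝ)) ≤ (N:ℝ)^2 := by linarith
  rw [div_le_iff₀ hnp] at j1
  rw [div_le_iff₀ hm2] at j2
  have hcont : Continuous (fun s : ℝ => qv (F y + s • E y) ((N:ℝ) • (fun i => (m i : ℝ)))) := by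
    simp only [qv_line]; fun_prop
  have := intermediate_value_Icc hpq.le hcont.continuousOn
  obtain ⟨s, hs, hsv⟩ := this (show c ∈ _ by
    constructor
    · simp only [qv_smul]; linarith [neg_abs_le c]
    · simp only [qv_smul]; linarith [le_abs_self c])
  simp only at hsv
  have hev : ∀ᶠ C in 𝓝 (F y + s • E y), qv C ((N:ℝ) • (fun i => (m i : ℝ))) ∈ Metric.ball c ε := by
    apply (qv_cont2 _).continuousAt
    beta_reduce; rw [hsv]; exact Metric.ball_mem_nhds _ hε
  obtain ⟨C, ⟨γ, rfl⟩, hC⟩ := ((mem_closure_iff_frequently.1 (hcl s hs)).and_eventually hev).exists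
  refine ⟨_, hC, γ.mt *ᵥ ((N:ℤ) • m), ?_⟩
  simp only
  rw [qv_cg]
  congr 1
  ext i
  simp [Matrix.mulVec, dotProduct, io_apply]

end Opp
end

noncomputable section
namespace Opp
open Matrix Set Filter Topology

lemma exists_orth {n : ℕ} (hn : 3 ≤ n) (b : LinearMap.BilinForm ℝ (Fin n → ℝ)) (hs : ∀ x y, b x y = b y x)
    (hnd : ∀ v, (∀ w, b v w = 0) → v = 0) {v w : Fin n → ℝ} (hv : 0 < b v v) (hw : b w w < 0) :
    ∃ z, b v z = 0 ∧ b w z = 0 ∧ b z z ≠ 0 := by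
  have hker : LinearMap.ker ((b v).prod (b w)) ≠ ⊥ := by
    apply LinearMap.ker_ne_bot_of_finrank_lt
    simp; omega
  obtain ⟨z0, hz0, hne⟩ := Submodule.exists_mem_ne_zero_of_ne_bot hker
  simp at hz0
  obtain ⟨z, hz⟩ : ∃ z, b z0 z ≠ 0 := by
    by_contra hc; push Not at hc; exact hne (hnd _ hc)
  have hΔ : b v v * b w w - b v w ^ 2 < 0 := by nlinarith [sq_nonneg (b v w), mul_neg_of_pos_of_neg hv hw]
  set D := b v v * b w w - b v w ^ 2 with hD
  have hD0 : D ≠ 0 := hΔ.ne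
  set al := (b v z * b w w - b w z * b v w) / D with hal
  set be := (b w z * b v v - b v z * b v w) / D with hbe
  set z' := z - al • v - be • w with hz'
  have h1 : b v z' = 0 := by
    rw [hz']; simp only [map_sub, map_smul, smul_eq_mul]
    rw [hal, hbe]; field_simp; rw [hD]; ring
  have h2 : b w z' = 0 := by
    rw [hz']; simp only [map_sub, map_smul, smul_eq_mul]
    rw [hal, hbe, hs w v]; field_simp; rw [hD]; ring
  have h3 : b z0 z' ≠ 0 := by
    rw [hz']; simp only [map_sub, map_smul, smul_eq_mul]
    rw [hs z0 v, hs z0 w, hz0.1, hz0.2]; simpa using hz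
  by_cases k1 : b z0 z0 = 0
  · by_cases k2 : b z' z' = 0
    · refine ⟨z0 + z', by simp [hz0.1, h1], by simp [hz0.2, h2], ?_⟩
      simp [k1, k2, hs z' z0]; exact h3
    · exact ⟨z', h1, h2, k2⟩
  · exact ⟨z0, hz0.1, hz0.2, k1⟩

def Gm {n : ℕ} (b : LinearMap.BilinForm ℝ (Fin n → ℝ)) (x y z : Fin n → ℝ) : M3 :=
  !![b x x, b x y, b x z; b y x, b y y, b y z; b z x, b z y, b z z]

lemma b_formula {n : ℕ} (b : LinearMap.BilinForm ℝ (Fin n → ℝ)) (x y : Fin n → ℝ) :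
    b x y = ∑ i, ∑ j, b (Pi.single i 1) (Pi.single j 1) * x i * y j := by
  conv_lhs => rw [← Matrix.toLinearMap₂'_toMatrix' (R := ℝ) b, Matrix.toLinearMap₂'_apply]
  refine Finset.sum_congr rfl fun i _ => Finset.sum_congr rfl fun j _ => ?_
  rw [LinearMap.toMatrix₂'_apply]; simp; ring

lemma b_cont {n : ℕ} (b : LinearMap.BilinForm ℝ (Fin n → ℝ)) {X : Type*} [TopologicalSpace X] {f g : X → Fin n → ℝ}
    (hf : Continuous f) (hg : Continuous g) : Continuous (fun t => b (f t) (g t)) := by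
  simp only [b_formula b (f _)]
  fun_prop

lemma det_cont {n : ℕ} (b : LinearMap.BilinForm ℝ (Fin n → ℝ)) {X : Type*} [TopologicalSpace X] {f g h : X → Fin n → ℝ}
    (hf : Continuous f) (hg : Continuous g) (hh : Continuous h) : Continuous (fun t => (Gm b (f t) (g t) (h t)).det) := by
  simp only [Gm, Matrix.det_fin_three]
  simp
  have := b_cont b hf hf
  have := b_cont b hf hg
  have := b_cont b hf hh
  have := b_cont b hg hf
  have := b_cont b hg hg
  have := b_cont b hg hh
  have := b_cont b hh hf
  have := b_cont b hh hg
  have := b_cont b hh hh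
  fun_prop

lemma det_smul1 {n : ℕ} (b : LinearMap.BilinForm ℝ (Fin n → ℝ)) (x y z : Fin n → ℝ) (r s t : ℝ) :
    (Gm b (r • x) (s • y) (t • z)).det = (r * s * t)^2 * (Gm b x y z).det := by
  simp only [Gm, Matrix.det_fin_three]
  simp; ring

def ci {n : ℕ} (m : Fin n → ℤ) : Fin n → ℝ := fun i => (m i : ℝ)

structure Good {n : ℕ} (b : LinearMap.BilinForm ℝ (Fin n → ℝ)) (x y z : Fin n → ℝ) : Prop where
  pos : 0 < b x x
  neg : b y y < 0
  det : (Gm b x y z).det ≠ 0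

lemma exists_int_good {n : ℕ} (hn : 3 ≤ n) (b : LinearMap.BilinForm ℝ (Fin n → ℝ)) (hs : ∀ x y, b x y = b y x)
    (hnd : ∀ v, (∀ w, b v w = 0) → v = 0) {v w : Fin n → ℝ} (hv : 0 < b v v) (hw : b w w < 0) :
    ∃ x y z : Fin n → ℤ, Good b (ci x) (ci y) (ci z) := by
  obtain ⟨z, h1, h2, h3⟩ := exists_orth hn b hs hnd hv hw
  have hg : Good b v w z := by
    refine ⟨hv, hw, ?_⟩
    have : (Gm b v w z).det = b z z * (b v v * b w w - b v w ^ 2) := by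
      simp only [Gm, Matrix.det_fin_three]
      simp [hs w v, hs z v, hs z w, h1, h2]; ring
    rw [this]
    refine mul_ne_zero h3 ?_
    nlinarith [sq_nonneg (b v w), mul_neg_of_pos_of_neg hv hw]
  have c : ∀ k : Fin 3, Continuous (fun (X : Fin 3 × Fin n → ℝ) => (fun i => X (k, i) : Fin n → ℝ)) := by
    intro k; fun_prop
  obtain ⟨m, hm⟩ := int_cone (U := {X : Fin 3 × Fin n → ℝ | Good b (fun i => X (0, i)) (fun i => X (1, i)) (fun i => X (2, i))}) (by
      have : {X : Fin 3 × Fin n → ℝ | Good b (fun i => X (0, i)) (fun i => X (1, i)) (fun i => X (2, i))} =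
        {X | 0 < b (fun i => X (0, i)) (fun i => X (0, i))} ∩ ({X | b (fun i => X (1, i)) (fun i => X (1, i)) < 0} ∩
          {X | (Gm b (fun i => X (0, i)) (fun i => X (1, i)) (fun i => X (2, i))).det ≠ 0}) := by
        ext X; exact ⟨fun h => ⟨h.1, h.2, h.3⟩, fun h => ⟨h.1, h.2.1, h.2.2⟩⟩
      rw [this]
      exact (isOpen_lt continuous_const (b_cont b (c 0) (c 0))).inter
        ((isOpen_lt (b_cont b (c 1) (c 1)) continuous_const).inter
          (isOpen_ne_fun (det_cont b (c 0) (c 1) (c 2)) continuous_const)))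
    ⟨fun p => ![v, w, z] p.1 p.2, by simpa using hg⟩ (by
      intro X hX N hN
      have hN' : (0:ℝ) < N := by exact_mod_cast hN
      have e : ∀ k : Fin 3, (fun i => ((N:ℝ) • X) (k, i) : Fin n → ℝ) = (N:ℝ) • (fun i => X (k, i)) := fun k => rfl
      rw [mem_setOf_eq] at hX ⊢
      rw [e, e, e]
      refine ⟨?_, ?_, ?_⟩
      · have := hX.1; simp only [map_smul, LinearMap.smul_apply, smul_eq_mul]; positivity
      · have := hX.2; simp only [map_smul, LinearMap.smul_apply, smul_eq_mul]
        exact mul_neg_of_pos_of_neg hN' (mul_neg_of_pos_of_neg hN' this)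
      · rw [det_smul1]; exact mul_ne_zero (by positivity) hX.3)
  exact ⟨fun i => m (0, i), fun i => m (1, i), fun i => m (2, i), hm⟩

def Rt (c r : ℝ) : Prop := ∃ q : ℚ, r = q * c
lemma Rt.add {c r s : ℝ} (h : Rt c r) (h' : Rt c s) : Rt c (r + s) := by
  obtain ⟨q, rfl⟩ := h; obtain ⟨q', rfl⟩ := h'; exact ⟨q + q', by push_cast; ring⟩
lemma Rt.mul {c r : ℝ} (a : ℚ) (h : Rt c r) : Rt c (a * r) := by
  obtain ⟨q, rfl⟩ := h; exact ⟨a * q, by push_cast; ring⟩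

lemma Rt_of_isRat {n : ℕ} (b : LinearMap.BilinForm ℝ (Fin n → ℝ)) {x y z : Fin n → ℝ} (hx : b x x ≠ 0)
    (h : IsRat (Gm b x y z)) : Rt (b x x) (b z z) := by
  obtain ⟨c, M, hM⟩ := h
  have h0 := hM 0 0
  have h2 := hM 2 2
  simp [Gm] at h0 h2
  have hM0 : (M 0 0 : ℝ) ≠ 0 := by rintro e; rw [e] at h0; simp at h0; exact hx h0
  refine ⟨(M 2 2 : ℚ) / (M 0 0 : ℚ), ?_⟩
  rw [h0, h2]; push_cast; field_simp

lemma ci_add {n : ℕ} (x y : Fin n → ℤ) : ci (x + y) = ci x + ci y := by ext i; simp [ci]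
lemma ci_smul {n : ℕ} (k : ℤ) (x : Fin n → ℤ) : ci (k • x) = (k:ℝ) • ci x := by ext i; simp [ci]

lemma exists_irr {n : ℕ} (hn : 3 ≤ n) (b : LinearMap.BilinForm ℝ (Fin n → ℝ)) (hs : ∀ x y, b x y = b y x)
    (hnd : ∀ v, (∀ w, b v w = 0) → v = 0) {v w : Fin n → ℝ} (hv : 0 < b v v) (hw : b w w < 0)
    (hirr : ¬ ∃ (c : ℝ) (M : Matrix (Fin n) (Fin n) ℤ), ∀ x : Fin n → ℝ, b x x = c * ∑ i, ∑ j, (M i j : ℝ) * x i * x j) :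
    ∃ x y z : Fin n → ℤ, Good b (ci x) (ci y) (ci z) ∧ ¬ IsRat (Gm b (ci x) (ci y) (ci z)) := by
  by_contra hc
  push Not at hc
  obtain ⟨x, y, z, hg⟩ := exists_int_good hn b hs hnd hv hw
  set c := b (ci x) (ci x) with hcd
  have hz : Rt c (b (ci z) (ci z)) := Rt_of_isRat b hg.1.ne' (hc _ _ _ hg)
  have hall : ∀ a : Fin n → ℤ, Rt c (b (ci a) (ci a)) := by
    intro a
    have hcont : Continuous (fun t : ℝ => (Gm b (ci x) (ci y) (ci z + t • ci a)).det) :=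
      det_cont b continuous_const continuous_const (by fun_prop)
    have hev : ∀ᶠ t in 𝓝 (0:ℝ), (Gm b (ci x) (ci y) (ci z + t • ci a)).det ≠ 0 := by
      apply hcont.continuousAt.eventually_ne
      simpa using hg.3
    have hev2 := (tendsto_one_div_add_atTop_nhds_zero_nat (𝕜 := ℝ)).eventually hev
    obtain ⟨N0, hN0⟩ := eventually_atTop.1 hev2
    have hbig : ∀ N : ℕ, N0 ≤ N → Rt c (b (ci ((N+1 : ℤ) • z + a)) (ci ((N+1 : ℤ) • z + a))) := by
      intro N hN
      apply Rt_of_isRat b hg.1.ne' (hc x y _ ⟨hg.1, hg.2, ?_⟩)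
      have h1 := hN0 N hN
      have hN' : ((N:ℝ) + 1) ≠ 0 := by positivity
      have e : ci ((N+1 : ℤ) • z + a) = ((N:ℝ)+1) • (ci z + (1 / ((N:ℝ)+1)) • ci a) := by
        rw [ci_add, ci_smul, smul_add, smul_smul, mul_one_div_cancel hN', one_smul]; push_cast; rfl
      have := det_smul1 b (ci x) (ci y) (ci z + (1 / ((N:ℝ)+1)) • ci a) 1 1 ((N:ℝ)+1)
      rw [one_smul, one_smul] at this
      rw [e, this]
      exact mul_ne_zero (by positivity) h1
    have r1 := hbig N0 le_rfl
    have r2 := hbig (2 * N0 + 1) (by omega)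
    have key : b (ci a) (ci a) = ((2 * (N0+1)^2 : ℚ) : ℝ) * b (ci z) (ci z) + (((2:ℚ):ℝ) * b (ci ((N0+1 : ℤ) • z + a)) (ci ((N0+1 : ℤ) • z + a))
        + ((-1:ℚ):ℝ) * b (ci ((((2*N0+1:ℕ):ℤ)+1 : ℤ) • z + a)) (ci ((((2*N0+1:ℕ):ℤ)+1 : ℤ) • z + a))) := by
      simp only [ci_add, ci_smul, map_add, map_smul, LinearMap.add_apply, LinearMap.smul_apply, smul_eq_mul, hs (ci a) (ci z)]
      push_cast; ring
    rw [key]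
    exact (hz.mul _).add ((r1.mul _).add (r2.mul _))
  have hpair : ∀ i j : Fin n, Rt c (b (Pi.single i 1) (Pi.single j 1)) := by
    intro i j
    have es : ∀ i : Fin n, ci (Pi.single i 1) = Pi.single i 1 := by
      intro i; ext k; simp only [ci, Pi.single_apply]; split_ifs <;> simp
    have r1 := hall (Pi.single i 1 + Pi.single j 1)
    have r2 := hall (Pi.single i 1)
    have r3 := hall (Pi.single j 1)
    rw [ci_add] at r1
    rw [es] at r1 r2
    rw [es] at r1 r3
    have key : b (Pi.single i 1) (Pi.single j 1) = ((1/2:ℚ):ℝ) * b (Pi.single i 1 + Pi.single j 1) (Pi.single i 1 + Pi.single j 1)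
        + (((-1/2:ℚ):ℝ) * b (Pi.single i 1) (Pi.single i 1) + ((-1/2:ℚ):ℝ) * b (Pi.single j 1) (Pi.single j 1)) := by
      simp only [map_add, LinearMap.add_apply, hs (Pi.single j 1) (Pi.single i 1)]
      push_cast; ring
    rw [key]
    exact (r1.mul _).add ((r2.mul _).add (r3.mul _))
  choose q hq using hpair
  set D : ℕ := ∏ i, ∏ j, (q i j).den with hD
  have hD0 : (D:ℝ) ≠ 0 := by
    have : 0 < D := Finset.prod_pos fun i _ => Finset.prod_pos fun j _ => (q i j).den_pos
    exact_mod_cast this.ne'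
  have h1 : ∀ i j, ∃ z : ℤ, (D : ℝ) * (q i j : ℝ) = z := by
    intro i j
    obtain ⟨k, hk⟩ : (q i j).den ∣ D :=
      (Finset.dvd_prod_of_mem (fun j => (q i j).den) (Finset.mem_univ j)).trans
        (Finset.dvd_prod_of_mem (fun i => ∏ j, (q i j).den) (Finset.mem_univ i))
    refine ⟨k * (q i j).num, ?_⟩
    have hden : ((q i j).den : ℝ) ≠ 0 := by exact_mod_cast (q i j).den_ne_zero
    have : (q i j : ℝ) = (q i j).num / (q i j).den := by exact_mod_cast (Rat.num_div_den (q i j)).symm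
    rw [hk, this]; push_cast; field_simp
  choose M hM using h1
  refine hirr ⟨c / D, M, fun x => ?_⟩
  rw [b_formula b x x, Finset.mul_sum]
  refine Finset.sum_congr rfl fun i _ => ?_
  rw [Finset.mul_sum]
  refine Finset.sum_congr rfl fun j _ => ?_
  rw [hq i j, ← hM i j]
  field_simp

lemma cube_root {d : ℝ} (hd : d ≠ 0) : ∃ c : ℝ, c ≠ 0 ∧ c^3 * d = 1 := by
  have key : ∀ e : ℝ, 0 < e → ∃ c : ℝ, c^3 * e = 1 := by
    intro e he
    refine ⟨(e⁻¹) ^ (((3:ℕ):ℝ)⁻¹), ?_⟩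
    rw [Real.rpow_inv_natCast_pow (by positivity) (by norm_num)]
    exact inv_mul_cancel₀ he.ne'
  have : ∃ c : ℝ, c^3 * d = 1 := by
    rcases lt_or_gt_of_ne hd with h | h
    · obtain ⟨c, hc⟩ := key (-d) (by linarith)
      exact ⟨-c, by linarith [show (-c)^3 * d = c^3 * (-d) by ring]⟩
    · exact key d h
  obtain ⟨c, hc⟩ := this
  exact ⟨c, by rintro rfl; simp at hc, hc⟩

lemma Gm_qv {n : ℕ} (b : LinearMap.BilinForm ℝ (Fin n → ℝ)) (x y z : Fin n → ℝ) (w : Fin 3 → ℝ) (c : ℝ) :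
    qv (c • Gm b x y z) w = c * b (w 0 • x + (w 1 • y + w 2 • z)) (w 0 • x + (w 1 • y + w 2 • z)) := by
  simp only [map_add, map_smul, LinearMap.add_apply, LinearMap.smul_apply, smul_eq_mul]
  simp [qv, Gm, Matrix.mulVec, dotProduct, Fin.sum_univ_three]
  ring

theorem main {n : ℕ} (hn : 3 ≤ n) (b : LinearMap.BilinForm ℝ (Fin n → ℝ)) (hs : ∀ x y, b x y = b y x)
    (hnd : ∀ v, (∀ w, b v w = 0) → v = 0) {v w : Fin n → ℝ} (hv : 0 < b v v) (hw : b w w < 0)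
    (hirr : ¬ ∃ (c : ℝ) (M : Matrix (Fin n) (Fin n) ℤ), ∀ x : Fin n → ℝ, b x x = c * ∑ i, ∑ j, (M i j : ℝ) * x i * x j) :
    Dense {r : ℝ | ∃ m : Fin n → ℤ, b (ci m) (ci m) = r} := by
  obtain ⟨x, y, z, hg, hr⟩ := exists_irr hn b hs hnd hv hw hirr
  obtain ⟨c, hc0, hc⟩ := cube_root hg.3
  have hyp : Hyp (c • Gm b (ci x) (ci y) (ci z)) := by
    refine ⟨?_, ?_, ?_, ?_⟩
    · rw [Matrix.transpose_smul]; congr 1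
      apply ext3 <;> simp [Gm] <;> apply hs
    · rw [Matrix.det_smul]; simpa using hc
    · change ∃ w : Fin 3 → ℝ, w ≠ 0 ∧ qv _ w ≤ 0
      rcases lt_or_gt_of_ne hc0 with h | h
      · refine ⟨![1,0,0], fun e => by simpa using congrFun e 0, ?_⟩
        rw [Gm_qv]; simp; nlinarith [hg.1]
      · refine ⟨![0,1,0], fun e => by simpa using congrFun e 1, ?_⟩
        rw [Gm_qv]; simp; nlinarith [hg.2]
    · rintro ⟨c', M, hM⟩
      refine hr ⟨c⁻¹ * c', M, fun i j => ?_⟩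
      have := hM i j
      rw [Matrix.smul_apply, smul_eq_mul] at this
      rw [mul_assoc, ← this, inv_mul_cancel_left₀ hc0]
  have hd := dense3 hyp
  have hsurj : Function.Surjective (fun r : ℝ => c⁻¹ * r) := fun r => ⟨c * r, by simp [hc0]⟩
  have hd2 := hsurj.denseRange.dense_image (by fun_prop) hd
  refine hd2.mono ?_
  rintro _ ⟨_, ⟨m, rfl⟩, rfl⟩
  refine ⟨m 0 • x + (m 1 • y + m 2 • z), ?_⟩
  simp only
  rw [Gm_qv, inv_mul_cancel_left₀ hc0]
  simp only [ci_add, ci_smul]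

end Opp
end

theorem oppenheim_conjecture (n : ℕ) (hn : 3 ≤ n) (Q : QuadraticForm ℝ (Fin n → ℝ))
    (hnondeg : ∀ v : Fin n → ℝ, (∀ w : Fin n → ℝ, QuadraticMap.polar (⇑Q) v w = 0) → v = 0)
    (hindef : (∃ v : Fin n → ℝ, 0 < Q v) ∧ (∃ w : Fin n → ℝ, Q w < 0))
    (hirrational : ¬ ∃ (c : ℝ) (M : Matrix (Fin n) (Fin n) ℤ),
      ∀ x : Fin n → ℝ, Q x = c * ∑ i, ∑ j, (M i j : ℝ) * x i * x j) :
    Dense {r : ℝ | ∃ m : Fin n → ℤ, Q (fun i => (m i : ℝ)) = r} := by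
  obtain ⟨⟨v, hv⟩, w, hw⟩ := hindef
  have hb : ∀ x y, ((1/2:ℝ) • QuadraticMap.polarBilin Q) x y = (1/2:ℝ) * QuadraticMap.polar (⇑Q) x y := fun x y => rfl
  have hQ : ∀ x, ((1/2:ℝ) • QuadraticMap.polarBilin Q) x x = Q x := by
    intro x; rw [hb, QuadraticMap.polar_self]; simp
  have := Opp.main hn ((1/2:ℝ) • QuadraticMap.polarBilin Q) (fun x y => by rw [hb, hb, QuadraticMap.polar_comm])
    (fun v h => hnondeg v fun w => by have := h w; rw [hb] at this; linarith) (v := v) (w := w)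
    (by rw [hQ]; exact hv) (by rw [hQ]; exact hw) (by simpa only [hQ] using hirrational)
  simp only [hQ] at this
  exact this
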